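/- Let k be an algebraically closed field of characteristic different from 2 and let (α,β,γ) ∈ k³ satisfy α+β+γ+αβγ = 0, and assume that none of the following holds: (α = −1 and β = 1), (β = −1 and γ = 1), (α = 1 and γ = −1). Then the four-dimensional Sklyanin algebra S(α,β,γ) is a Noetherian domain (it is a left and right Noetherian ring with no zero divisors). -/

import Mathlib

noncomputable section

variable (k : Type*) [Field k]

/-- The generators `x₀, x₁, x₂, x₃` of the free algebra `k⟨x₀,x₁,x₂,x₃⟩`. -/
def g4 (i : Fin 4) : FreeAlgebra k (Fin 4) := FreeAlgebra.ι k i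

/-- The relation whose induced ring quotient is the quotient of `k⟨x₀,x₁,x₂,x₃⟩` by the
two-sided ideal generated by the six defining elements of `A(α,β,γ)`. -/
def fourRel (α β γ : k) : FreeAlgebra k (Fin 4) → FreeAlgebra k (Fin 4) → Prop := fun a b =>
  b = 0 ∧
    (a = g4 k 0 * g4 k 1 - g4 k 1 * g4 k 0
          - algebraMap k _ α * (g4 k 2 * g4 k 3 + g4 k 3 * g4 k 2) ∨
     a = g4 k 0 * g4 k 1 + g4 k 1 * g4 k 0 - (g4 k 2 * g4 k 3 - g4 k 3 * g4 k 2) ∨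
     a = g4 k 0 * g4 k 2 - g4 k 2 * g4 k 0
          - algebraMap k _ β * (g4 k 3 * g4 k 1 + g4 k 1 * g4 k 3) ∨
     a = g4 k 0 * g4 k 2 + g4 k 2 * g4 k 0 - (g4 k 3 * g4 k 1 - g4 k 1 * g4 k 3) ∨
     a = g4 k 0 * g4 k 3 - g4 k 3 * g4 k 0
          - algebraMap k _ γ * (g4 k 1 * g4 k 2 + g4 k 2 * g4 k 1) ∨
     a = g4 k 0 * g4 k 3 + g4 k 3 * g4 k 0 - (g4 k 1 * g4 k 2 - g4 k 2 * g4 k 1))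

/-- The algebra `A(α,β,γ)`; when `α+β+γ+αβγ = 0` this is the four-dimensional Sklyanin
algebra `S(α,β,γ)`. -/
abbrev SklyA (α β γ : k) : Type _ := RingQuot (fourRel k α β γ)

/-- The images of the generators `x₀, x₁, x₂, x₃` in `A(α,β,γ)`. -/
def agen (α β γ : k) (i : Fin 4) : SklyA k α β γ :=
  RingQuot.mkAlgHom k (fourRel k α β γ) (g4 k i)

namespace SklyaninFour

section GradedNoetherian

variable {F A : Type*} [Field F] [Ring A] [Algebra F A]

/-- A family of subspaces `J n ≤ V ^ n` stable under multiplication by `V` on both sides. -/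
structure IsGradedIdeal (V : Submodule F A) (J : ℕ → Submodule F A) : Prop where
  le : ∀ n, J n ≤ V ^ n
  left : ∀ n, V * J n ≤ J (n + 1)
  right : ∀ n, J n * V ≤ J (n + 1)

/-- Every graded right ideal containing `J` is, modulo `J`, generated in bounded degree. -/
def RightGN (V : Submodule F A) (J : ℕ → Submodule F A) : Prop :=
  ∀ I : ℕ → Submodule F A, (∀ n, J n ≤ I n) → (∀ n, I n ≤ V ^ n) →
    (∀ n, I n * V ≤ I (n + 1)) → ∃ N, ∀ n, N ≤ n → I (n + 1) ≤ I n * V ⊔ J (n + 1)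

theorem IsGradedIdeal.pow_mul_le {V : Submodule F A} {J : ℕ → Submodule F A}
    (hJ : IsGradedIdeal V J) (m n : ℕ) : V ^ m * J n ≤ J (m + n) := by
  induction m with
  | zero => simp
  | succ m ih =>
    rw [pow_succ', mul_assoc]
    refine (mul_le_mul_right ih _).trans ((hJ.left _).trans ?_)
    rw [show m + n + 1 = m + 1 + n by ring]

theorem right_mul_pow_le {V : Submodule F A} {I : ℕ → Submodule F A}
    (hI : ∀ n, I n * V ≤ I (n + 1)) (n m : ℕ) : I n * V ^ m ≤ I (n + m) := by
  induction m with
  | zero => simp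
  | succ m ih =>
    rw [pow_succ, ← mul_assoc]
    exact (mul_le_mul_left ih _).trans (hI _)

/-- The graded ideal obtained from `J` by adding the left multiples of an element `z` of
degree `d`. -/
def addNormal (V : Submodule F A) (J : ℕ → Submodule F A) (z : A) (d n : ℕ) : Submodule F A :=
  J n ⊔ ⨆ m, ⨆ _ : m + d = n, (V ^ m).map (LinearMap.mulRight F z)

theorem mem_addNormal {V : Submodule F A} {J : ℕ → Submodule F A} {z : A} {d n : ℕ} {x : A} :
    x ∈ addNormal V J z d n ↔
      x ∈ J n ∨ ∃ m, m + d = n ∧ ∃ b ∈ V ^ m, x - b * z ∈ J n := by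
  constructor
  · intro h
    obtain ⟨y, hy, w, hw, rfl⟩ := Submodule.mem_sup.1 h
    by_cases hd : d ≤ n
    · right
      have : (⨆ m, ⨆ _ : m + d = n, (V ^ m).map (LinearMap.mulRight F z)) ≤
          (V ^ (n - d)).map (LinearMap.mulRight F z) := by
        refine iSup_le fun m => iSup_le fun hm => ?_
        rw [← hm, Nat.add_sub_cancel]
      obtain ⟨b, hb, rfl⟩ := this hw
      exact ⟨n - d, Nat.sub_add_cancel hd, b, hb, by simpa using hy⟩
    · left
      have : (⨆ m, ⨆ _ : m + d = n, (V ^ m).map (LinearMap.mulRight F z)) ≤ ⊥ := by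
        refine iSup_le fun m => iSup_le fun hm => ?_
        omega
      rw [(Submodule.mem_bot F).1 (this hw), add_zero]
      exact hy
  · rintro (h | ⟨m, hm, b, hb, h⟩)
    · exact Submodule.mem_sup_left h
    · rw [← sub_add_cancel x (b * z)]
      refine add_mem (Submodule.mem_sup_left h) (Submodule.mem_sup_right ?_)
      exact Submodule.mem_iSup_of_mem m (Submodule.mem_iSup_of_mem hm ⟨b, hb, rfl⟩)

/-- `z` normalizes `V` modulo `J`. -/
structure IsNormalMod (V : Submodule F A) (J : ℕ → Submodule F A) (z : A) (d : ℕ) : Prop where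
  mem : z ∈ V ^ d
  left : ∀ x ∈ V, ∃ y ∈ V, x * z - z * y ∈ J (d + 1)
  right : ∀ x ∈ V, ∃ y ∈ V, z * x - y * z ∈ J (d + 1)

theorem addNormal_isGradedIdeal {V : Submodule F A} {J : ℕ → Submodule F A} {z : A} {d : ℕ}
    (hJ : IsGradedIdeal V J) (hz : IsNormalMod V J z d) :
    IsGradedIdeal V (addNormal V J z d) where
  le n := by
    intro x hx
    rcases mem_addNormal.1 hx with h | ⟨m, rfl, b, hb, h⟩
    · exact hJ.le n h
    · rw [← sub_add_cancel x (b * z)]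
      refine add_mem (hJ.le _ h) ?_
      rw [pow_add]
      exact Submodule.mul_mem_mul hb hz.mem
  left n := by
    rw [Submodule.mul_le]
    intro v hv x hx
    refine mem_addNormal.2 ?_
    rcases mem_addNormal.1 hx with h | ⟨m, rfl, b, hb, h⟩
    · exact Or.inl (hJ.left n (Submodule.mul_mem_mul hv h))
    · refine Or.inr ⟨m + 1, by ring, v * b, ?_, ?_⟩
      · rw [pow_succ']
        exact Submodule.mul_mem_mul hv hb
      · rw [mul_assoc, ← mul_sub]
        exact hJ.left _ (Submodule.mul_mem_mul hv h)
  right n := by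
    rw [Submodule.mul_le]
    intro x hx v hv
    refine mem_addNormal.2 ?_
    rcases mem_addNormal.1 hx with h | ⟨m, rfl, b, hb, h⟩
    · exact Or.inl (hJ.right n (Submodule.mul_mem_mul h hv))
    · obtain ⟨y, hy, hyz⟩ := hz.right v hv
      refine Or.inr ⟨m + 1, by ring, b * y, ?_, ?_⟩
      · rw [pow_succ]
        exact Submodule.mul_mem_mul hb hy
      · rw [show x * v - b * y * z = (x - b * z) * v + b * (z * v - y * z) by noncomm_ring]
        exact add_mem (hJ.right _ (Submodule.mul_mem_mul h hv))
          (hJ.pow_mul_le m (d + 1) (Submodule.mul_mem_mul hb hyz))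

theorem IsNormalMod.pow_mem {V : Submodule F A} {J : ℕ → Submodule F A} {z : A} {d : ℕ}
    (hz : IsNormalMod V J z d) (j : ℕ) : z ^ j ∈ V ^ (j * d) := by
  rw [mul_comm, pow_mul]
  exact Submodule.pow_mem_pow _ hz.mem j

theorem IsNormalMod.pow_left {V : Submodule F A} {J : ℕ → Submodule F A} {z : A} {d : ℕ}
    (hJ : IsGradedIdeal V J) (hz : IsNormalMod V J z d) (j : ℕ) :
    ∀ x ∈ V, ∃ y ∈ V, x * z ^ j - z ^ j * y ∈ J (j * d + 1) := by
  induction j with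
  | zero => exact fun x hx => ⟨x, hx, by simp⟩
  | succ j ih =>
    intro x hx
    obtain ⟨y, hy, h1⟩ := ih x hx
    obtain ⟨w, hw, h2⟩ := hz.left y hy
    refine ⟨w, hw, ?_⟩
    rw [show x * z ^ (j + 1) - z ^ (j + 1) * w =
      (x * z ^ j - z ^ j * y) * z + z ^ j * (y * z - z * w) by rw [pow_succ]; noncomm_ring]
    rw [show (j + 1) * d + 1 = j * d + 1 + d by ring]
    refine add_mem (right_mul_pow_le hJ.right _ _ (Submodule.mul_mem_mul h1 hz.mem)) ?_
    rw [show j * d + 1 + d = j * d + (d + 1) by ring]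
    exact hJ.pow_mul_le _ _ (Submodule.mul_mem_mul (hz.pow_mem j) h2)

theorem RightGN.stabilizes {V : Submodule F A} {J : ℕ → Submodule F A} (hV : V.FG)
    (h : RightGN V J) (K : ℕ → ℕ → Submodule F A) (hmono : ∀ n, Monotone fun j => K j n)
    (hJK : ∀ j n, J n ≤ K j n) (hKV : ∀ j n, K j n ≤ V ^ n)
    (hKr : ∀ j n, K j n * V ≤ K j (n + 1)) :
    ∃ j₀ N, (∀ j n, K j n ≤ K j₀ n) ∧
      ∀ j ≤ j₀, ∀ n, N ≤ n → K j (n + 1) ≤ K j n * V ⊔ J (n + 1) := by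
  set U : ℕ → Submodule F A := fun n => ⨆ j, K j n with hU
  have hUle : ∀ n, U n ≤ V ^ n := fun n => iSup_le fun j => hKV j n
  have hKU : ∀ j n, K j n ≤ U n := fun j n => le_iSup (fun j => K j n) j
  obtain ⟨N, hN⟩ := h U (fun n => (hJK 0 n).trans (hKU 0 n)) hUle (fun n => by
    rw [hU]
    simp only [Submodule.iSup_mul]
    exact iSup_le fun j => (hKr j n).trans (hKU j _))
  have hfin : ∀ n, ∃ j, U n = K j n := by
    intro n
    have hfg : (V ^ n).FG := hV.pow n
    have : (U n).FG := by
      have : FiniteDimensional F (V ^ n : Submodule F A) := Module.Finite.iff_fg.2 hfg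
      have := Submodule.finiteDimensional_of_le (hUle n)
      exact Module.Finite.iff_fg.1 this
    exact this.stabilizes_of_iSup_eq ⟨fun j => K j n, hmono n⟩ rfl
  choose jn hjn using hfin
  set j₀ := (Finset.range (N + 1)).sup jn with hj₀
  have hle : ∀ n, n ≤ N → U n ≤ K j₀ n := fun n hn => by
    rw [hjn n]
    exact hmono n (Finset.le_sup (f := jn) (Finset.mem_range.2 (by omega)))
  have hall : ∀ n, U n ≤ K j₀ n := by
    intro n
    induction n with
    | zero => exact hle 0 (Nat.zero_le _)
    | succ n ih =>
      by_cases hn : n + 1 ≤ N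
      · exact hle _ hn
      · refine (hN n (by omega)).trans (sup_le ?_ (hJK _ _))
        exact (mul_le_mul_left ih _).trans (hKr _ _)
  have hg : ∀ j, ∃ N, ∀ n, N ≤ n → K j (n + 1) ≤ K j n * V ⊔ J (n + 1) := fun j =>
    h (K j) (hJK j) (hKV j) (hKr j)
  choose Nj hNj using hg
  refine ⟨j₀, (Finset.range (j₀ + 1)).sup Nj, fun j n => (hKU j n).trans (hall n), ?_⟩
  intro j hj n hn
  exact hNj j n ((Finset.le_sup (f := Nj) (Finset.mem_range.2 (by omega))).trans hn)

/-- The elements of `V ^ n` which `z ^ j` multiplies into the graded right ideal `I`. -/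
def powColon (V : Submodule F A) (I : ℕ → Submodule F A) (z : A) (d j n : ℕ) :
    Submodule F A :=
  V ^ n ⊓ (I (n + j * d)).comap (LinearMap.mulRight F (z ^ j))

theorem mul_mul_pow_mem {V : Submodule F A} {I J : ℕ → Submodule F A} {z : A} {d : ℕ}
    (hJ : IsGradedIdeal V J) (hz : IsNormalMod V J z d) {j n : ℕ} {x v : A}
    (hx : x ∈ powColon V I z d j n) (hv : v ∈ V) :
    x * v * z ^ j ∈ I (n + j * d) * V ⊔ J (n + j * d + 1) := by
  obtain ⟨y, hy, h⟩ := hz.pow_left hJ j v hv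
  rw [show x * v * z ^ j = x * z ^ j * y + x * (v * z ^ j - z ^ j * y) by noncomm_ring]
  refine add_mem (Submodule.mem_sup_left (Submodule.mul_mem_mul hx.2 hy))
    (Submodule.mem_sup_right ?_)
  rw [add_assoc]
  exact hJ.pow_mul_le _ _ (Submodule.mul_mem_mul hx.1 h)

theorem powColon_mul_le {V : Submodule F A} {I J : ℕ → Submodule F A} {z : A} {d : ℕ}
    (hJ : IsGradedIdeal V J) (hz : IsNormalMod V J z d) (hJI : ∀ n, J n ≤ I n)
    (hI : ∀ n, I n * V ≤ I (n + 1)) (j n : ℕ) :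
    powColon V I z d j n * V ≤ powColon V I z d j (n + 1) := by
  rw [Submodule.mul_le]
  intro x hx v hv
  refine ⟨?_, ?_⟩
  · rw [pow_succ]
    exact Submodule.mul_mem_mul hx.1 hv
  · have h := mul_mul_pow_mem hJ hz hx hv
    rw [show n + 1 + j * d = n + j * d + 1 by ring]
    exact (sup_le (hI _) (hJI _)) h

theorem powColon_le_succ {V : Submodule F A} {I J : ℕ → Submodule F A} {z : A} {d : ℕ}
    (hz : IsNormalMod V J z d) (hI : ∀ n, I n * V ≤ I (n + 1)) (j n : ℕ) :
    powColon V I z d j n ≤ powColon V I z d (j + 1) n := by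
  rintro x ⟨hx, h⟩
  refine ⟨hx, ?_⟩
  change x * z ^ (j + 1) ∈ I (n + (j + 1) * d)
  rw [pow_succ, ← mul_assoc, show n + (j + 1) * d = n + j * d + d by ring]
  exact right_mul_pow_le hI _ _ (Submodule.mul_mem_mul h hz.mem)

theorem addNormal_remainder {V : Submodule F A} {I J : ℕ → Submodule F A} {z : A} {d : ℕ}
    (hJ : IsGradedIdeal V J) (hz : IsNormalMod V J z d) (hJI : ∀ n, J n ≤ I n) {i l : ℕ} {x : A}
    (hx : x ∈ addNormal V J z d l) (hxI : x * z ^ i ∈ I (l + i * d)) :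
    x * z ^ i ∈ J (l + i * d) ∨ ∃ l', l' + d = l ∧ ∃ b ∈ powColon V I z d (i + 1) l',
      x * z ^ i - b * z ^ (i + 1) ∈ J (l + i * d) := by
  rcases mem_addNormal.1 hx with h | ⟨l', rfl, b, hb, h⟩
  · exact Or.inl (right_mul_pow_le hJ.right _ _ (Submodule.mul_mem_mul h (hz.pow_mem i)))
  · have key : x * z ^ i - b * z ^ (i + 1) ∈ J (l' + d + i * d) := by
      rw [show x * z ^ i - b * z ^ (i + 1) = (x - b * z) * z ^ i by rw [pow_succ']; noncomm_ring]
      exact right_mul_pow_le hJ.right _ _ (Submodule.mul_mem_mul h (hz.pow_mem i))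
    refine Or.inr ⟨l', rfl, b, ⟨hb, ?_⟩, key⟩
    change b * z ^ (i + 1) ∈ I (l' + (i + 1) * d)
    rw [show l' + (i + 1) * d = l' + d + i * d by ring,
      show b * z ^ (i + 1) = x * z ^ i - (x * z ^ i - b * z ^ (i + 1)) by abel]
    exact sub_mem hxI (hJI _ key)

theorem RightGN.of_addNormal {V : Submodule F A} {J : ℕ → Submodule F A} {z : A} {d : ℕ}
    (hV : V.FG) (hJ : IsGradedIdeal V J) (hz : IsNormalMod V J z d) (hd : 0 < d)
    (h : RightGN V (addNormal V J z d)) : RightGN V J := by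
  intro I hJI hIV hI
  have hJ' := addNormal_isGradedIdeal hJ hz
  obtain ⟨j₀, N, hstab, hgen⟩ := h.stabilizes hV
    (fun j n => powColon V I z d j n ⊔ addNormal V J z d n)
    (fun n => monotone_nat_of_le_succ fun j => sup_le_sup_right (powColon_le_succ hz hI j n) _)
    (fun j n => le_sup_right) (fun j n => sup_le inf_le_left (hJ'.le n))
    (fun j n => by
      rw [Submodule.sup_mul]
      exact sup_le_sup (powColon_mul_le hJ hz hJI hI j n) (hJ'.right n))
  have main : ∀ l i m c, (j₀ + 1 ≤ i ∨ N + 1 + (j₀ + 1 - i) * d ≤ l) → m + 1 = l + i * d →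
      c ∈ powColon V I z d i l → c * z ^ i ∈ I m * V ⊔ J (m + 1) := by
    intro l
    induction l using Nat.strong_induction_on with
    | _ l ih =>
    intro i m c hli hm hc
    have hT : I m * V ⊔ J (m + 1) ≤ I (l + i * d) := by
      rw [← hm]
      exact sup_le (hI m) (hJI _)
    suffices hdec : ∃ c₁, c₁ * z ^ i ∈ I m * V ⊔ J (m + 1) ∧ c - c₁ ∈ addNormal V J z d l by
      obtain ⟨c₁, h1, h2⟩ := hdec
      have h3 : (c - c₁) * z ^ i ∈ I (l + i * d) := by
        rw [sub_mul]
        exact sub_mem hc.2 (hT h1)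
      have h4 : (c - c₁) * z ^ i ∈ I m * V ⊔ J (m + 1) := by
        rcases addNormal_remainder hJ hz hJI h2 h3 with h5 | ⟨l', hl', b, hb, h5⟩
        · exact Submodule.mem_sup_right (hm ▸ h5)
        · have h6 := ih l' (by omega) (i + 1) m b ?_ (by rw [hm, ← hl']; ring) hb
          · rw [show (c - c₁) * z ^ i = b * z ^ (i + 1) +
              ((c - c₁) * z ^ i - b * z ^ (i + 1)) by abel]
            exact add_mem h6 (Submodule.mem_sup_right (hm ▸ h5))
          · rcases hli with hi | hl
            · exact Or.inl (by omega)
            · by_cases hij : j₀ ≤ i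
              · exact Or.inl (by omega)
              · right
                rw [show j₀ + 1 - i = j₀ + 1 - (i + 1) + 1 by omega, add_mul, one_mul] at hl
                omega
      rw [show c * z ^ i = c₁ * z ^ i + (c - c₁) * z ^ i by noncomm_ring]
      exact add_mem h1 h4
    by_cases hi : j₀ + 1 ≤ i
    · obtain ⟨i', rfl⟩ : ∃ i', i = i' + 1 := ⟨i - 1, by omega⟩
      have hmono : Monotone fun j => powColon V I z d j l :=
        monotone_nat_of_le_succ fun j => powColon_le_succ hz hI j l
      have h1 := hstab (i' + 1) l (Submodule.mem_sup_left hc)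
      have h2 : c ∈ powColon V I z d i' l ⊔ addNormal V J z d l :=
        sup_le_sup_right (hmono (show j₀ ≤ i' by omega)) _ h1
      obtain ⟨c₁, h3, w, hw, rfl⟩ := Submodule.mem_sup.1 h2
      refine ⟨c₁, Submodule.mem_sup_left ?_, by simpa using hw⟩
      obtain ⟨d', rfl⟩ : ∃ d', d = d' + 1 := ⟨d - 1, by omega⟩
      have h4 : c₁ * z ^ (i' + 1) ∈ I (l + i' * (d' + 1)) * V ^ (d' + 1) := by
        rw [pow_succ z, ← mul_assoc]
        exact Submodule.mul_mem_mul h3.2 hz.mem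
      rw [pow_succ V, ← mul_assoc] at h4
      have h5 := mul_le_mul_left (right_mul_pow_le hI (l + i' * (d' + 1)) d') V h4
      rwa [show l + i' * (d' + 1) + d' = m by
        have : (i' + 1) * (d' + 1) = i' * (d' + 1) + d' + 1 := by ring
        omega] at h5
    · obtain ⟨l', rfl⟩ : ∃ l', l = l' + 1 := ⟨l - 1, by omega⟩
      have h1 := hgen i (by omega) l' (by omega) (Submodule.mem_sup_left hc)
      rw [Submodule.sup_mul, sup_assoc] at h1
      obtain ⟨c₁, h2, w, hw, rfl⟩ := Submodule.mem_sup.1 h1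
      refine ⟨c₁, ?_, by simpa using (sup_le (hJ'.right l') le_rfl) hw⟩
      have hm' : m = l' + i * d := by omega
      have h3 : powColon V I z d i l' * V ≤
          (I m * V ⊔ J (m + 1)).comap (LinearMap.mulRight F (z ^ i)) := by
        rw [Submodule.mul_le, hm']
        exact fun x hx v hv => mul_mul_pow_mem hJ hz hx hv
      exact h3 h2
  refine ⟨N + 1 + (j₀ + 1) * d, fun n hn => ?_⟩
  intro c hc
  have := main (n + 1) 0 n c (Or.inr (by simp; omega)) (by simp)
    ⟨hIV _ hc, by simpa using hc⟩
  simpa using this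

/-- The span of the powers `V ^ i` with `i < n`. -/
def powFil (V : Submodule F A) : ℕ → Submodule F A
  | 0 => ⊥
  | n + 1 => powFil V n ⊔ V ^ n

theorem powFil_mono (V : Submodule F A) : Monotone (powFil V) :=
  monotone_nat_of_le_succ fun _ => le_sup_left

theorem powFil_mul_le (V : Submodule F A) (n : ℕ) : powFil V n * V ≤ powFil V (n + 1) := by
  induction n with
  | zero => simp [powFil]
  | succ n ih =>
    rw [powFil, Submodule.sup_mul, ← pow_succ]
    exact sup_le_sup_right ih _

theorem exists_mem_powFil {V : Submodule F A} (hV : ⨆ n, V ^ n = ⊤) (x : A) :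
    ∃ n, x ∈ powFil V n := by
  have h : (⨆ n, V ^ n) ≤ ⨆ n, powFil V n :=
    iSup_le fun n => le_sup_right.trans (le_iSup (powFil V) (n + 1))
  rw [hV] at h
  exact (Submodule.mem_iSup_of_directed _ (powFil_mono V).directed_le).1 (h trivial)

theorem powFil_fg {V : Submodule F A} (hV : V.FG) (n : ℕ) : (powFil V n).FG := by
  induction n with
  | zero => exact Submodule.fg_bot
  | succ n ih => exact ih.sup (hV.pow n)

/-- A right ideal, as a subspace. -/
def rightIdealSubspace (F : Type*) {A : Type*} [Field F] [Ring A] [Algebra F A]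
    (a : Ideal Aᵐᵒᵖ) : Submodule F A where
  carrier := {x | MulOpposite.op x ∈ a}
  add_mem' := fun hx hy => a.add_mem hx hy
  zero_mem' := a.zero_mem
  smul_mem' := fun c x hx => by
    have := a.mul_mem_left (MulOpposite.op (algebraMap F A c)) hx
    rwa [← MulOpposite.op_mul, ← Algebra.commutes, ← Algebra.smul_def] at this

theorem rightIdealSubspace_mul_le (a : Ideal Aᵐᵒᵖ) (V : Submodule F A) :
    rightIdealSubspace F a * V ≤ rightIdealSubspace F a := by
  rw [Submodule.mul_le]
  intro x hx v _
  exact a.mul_mem_left (MulOpposite.op v) hx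

theorem isNoetherianRing_op_of_rightGN {V : Submodule F A} (hV : V.FG) (hV' : ⨆ n, V ^ n = ⊤)
    (h : RightGN V fun _ => ⊥) : IsNoetherianRing Aᵐᵒᵖ := by
  refine ⟨fun a => ?_⟩
  obtain ⟨N, hN⟩ := h (fun n => V ^ n ⊓ (rightIdealSubspace F a ⊔ powFil V n))
    (fun _ => bot_le) (fun _ => inf_le_left) (fun n => by
      refine le_inf ?_ ?_
      · rw [pow_succ]
        exact mul_le_mul_left inf_le_left V
      · refine (mul_le_mul_left inf_le_right V).trans ?_
        rw [Submodule.sup_mul]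
        exact sup_le_sup (rightIdealSubspace_mul_le a V) (powFil_mul_le V n))
  have hfg : (powFil V (N + 1) ⊓ rightIdealSubspace F a).FG := by
    have : FiniteDimensional F (powFil V (N + 1)) := Module.Finite.iff_fg.2 (powFil_fg hV _)
    have := Submodule.finiteDimensional_of_le
      (inf_le_left : powFil V (N + 1) ⊓ rightIdealSubspace F a ≤ powFil V (N + 1))
    exact Module.Finite.iff_fg.1 this
  obtain ⟨S, hS⟩ := hfg
  set b : Ideal Aᵐᵒᵖ := Ideal.span (MulOpposite.op '' (S : Set A)) with hb
  have hWb : powFil V (N + 1) ⊓ rightIdealSubspace F a ≤ rightIdealSubspace F b := by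
    rw [← hS, Submodule.span_le]
    exact fun x hx => Ideal.subset_span ⟨x, hx, rfl⟩
  have hba : b ≤ a := by
    rw [hb, Ideal.span_le]
    rintro _ ⟨x, hx, rfl⟩
    have : x ∈ powFil V (N + 1) ⊓ rightIdealSubspace F a := hS ▸ Submodule.subset_span hx
    exact this.2
  have main : ∀ n, rightIdealSubspace F a ⊓ powFil V n ≤ rightIdealSubspace F b := by
    intro n
    induction n with
    | zero => simp [powFil]
    | succ n ih =>
      by_cases hn : n + 1 ≤ N + 1
      · rw [inf_comm]
        exact (inf_le_inf_right _ (powFil_mono V hn)).trans hWb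
      · obtain ⟨n, rfl⟩ : ∃ n', n = n' + 1 := ⟨n - 1, by omega⟩
        have hle : V ^ n ⊓ (rightIdealSubspace F a ⊔ powFil V n) ≤
            rightIdealSubspace F b ⊔ powFil V n := by
          rintro v ⟨hv, hv'⟩
          obtain ⟨x, hx, f, hf, rfl⟩ := Submodule.mem_sup.1 hv'
          refine Submodule.add_mem_sup (ih ⟨hx, ?_⟩) hf
          rw [show x = x + f - f by abel]
          exact sub_mem (Submodule.mem_sup_right hv) (Submodule.mem_sup_left hf)
        rintro s ⟨hs, hs'⟩
        obtain ⟨f, hf, v, hv, rfl⟩ := Submodule.mem_sup.1 hs'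
        have h1 : v ∈ V ^ (n + 1) ⊓ (rightIdealSubspace F a ⊔ powFil V (n + 1)) := by
          refine ⟨hv, ?_⟩
          rw [show v = f + v + -f by abel]
          exact Submodule.add_mem_sup hs (neg_mem hf)
        have h2 := hN n (by omega) h1
        rw [sup_bot_eq] at h2
        have h3 := mul_le_mul_left hle V h2
        rw [Submodule.sup_mul] at h3
        obtain ⟨y, hy, g, hg, rfl⟩ := Submodule.mem_sup.1
          (sup_le_sup (rightIdealSubspace_mul_le b V) (powFil_mul_le V n) h3)
        have h4 : f + g ∈ rightIdealSubspace F b := by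
          refine ih ⟨?_, add_mem hf hg⟩
          rw [show f + g = f + (y + g) - y by abel]
          exact sub_mem hs (hba hy)
        rw [show f + (y + g) = y + (f + g) by abel]
        exact add_mem hy h4
  rw [show a = b from le_antisymm (fun x hx => ?_) hba]
  · exact ⟨S.map ⟨_, MulOpposite.op_injective⟩, by rw [Finset.coe_map]; rfl⟩
  · obtain ⟨n, hn⟩ := exists_mem_powFil hV' x.unop
    exact main n ⟨hx, hn⟩

end GradedNoetherian

section Growth

variable {F K : Type*} [Field F] [Field K] [Algebra F K]

/-- No nontrivial relation `p(x) f + q(x) g = 0` with polynomials `p, q` over `F`. -/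
def PolyIndep (F : Type*) {K : Type*} [Field F] [Field K] [Algebra F K] (x f g : K) : Prop :=
  ∀ p q : Polynomial F, p.aeval x * f + q.aeval x * g = 0 → p = 0 ∧ q = 0

theorem PolyIndep.mul_left {x f g h : K} (H : PolyIndep F x f g) (hh : h ≠ 0) :
    PolyIndep F x (h * f) (h * g) := fun p q hpq =>
  H p q (mul_left_cancel₀ hh (by rw [mul_zero, ← hpq]; ring))

/-- `U + x U`. -/
def adjoinStep (x : K) (U : Submodule F K) : Submodule F K :=
  U ⊔ U.map (LinearMap.mulLeft F x)

theorem le_adjoinStep (x : K) (U : Submodule F K) : U ≤ adjoinStep x U := le_sup_left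

theorem mul_mem_adjoinStep (x : K) {U : Submodule F K} {u : K} (hu : u ∈ U) :
    x * u ∈ adjoinStep x U := Submodule.mem_sup_right ⟨u, hu, rfl⟩

theorem adjoinStep_mono (x : K) {U W : Submodule F K} (h : U ≤ W) :
    adjoinStep x U ≤ adjoinStep x W := sup_le_sup h (Submodule.map_mono h)

instance adjoinStep_finite (x : K) (U : Submodule F K) [FiniteDimensional F U] :
    FiniteDimensional F (adjoinStep x U) := by
  unfold adjoinStep
  infer_instance

/-- Iterates of `adjoinStep x`. -/
def iterStep (x : K) (U : Submodule F K) : ℕ → Submodule F K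
  | 0 => U
  | n + 1 => adjoinStep x (iterStep x U n)

instance iterStep_finite (x : K) (U : Submodule F K) [FiniteDimensional F U] (n : ℕ) :
    FiniteDimensional F (iterStep x U n) := by
  induction n with
  | zero => assumption
  | succ n ih =>
    rw [iterStep]
    infer_instance

theorem finrank_map_mulLeft {x : K} (hx : x ≠ 0) (U : Submodule F K) :
    Module.finrank F (U.map (LinearMap.mulLeft F x)) = Module.finrank F U :=
  (LinearEquiv.finrank_eq (Submodule.equivMapOfInjective _
    (fun _ _ h => mul_left_cancel₀ hx h) U)).symm

theorem finrank_adjoinStep_adjoinStep {x : K} (hx : x ≠ 0) (U : Submodule F K)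
    [FiniteDimensional F U] :
    Module.finrank F (adjoinStep x (adjoinStep x U)) + Module.finrank F U ≤
      2 * Module.finrank F (adjoinStep x U) := by
  have h := Submodule.finrank_sup_add_finrank_inf_eq (adjoinStep x U)
    ((adjoinStep x U).map (LinearMap.mulLeft F x))
  rw [finrank_map_mulLeft hx] at h
  have h2 : Module.finrank F U ≤ Module.finrank F
      (adjoinStep x U ⊓ (adjoinStep x U).map (LinearMap.mulLeft F x) : Submodule F K) := by
    rw [← finrank_map_mulLeft hx U]
    exact Submodule.finrank_mono
      (le_inf le_sup_right (Submodule.map_mono (le_adjoinStep x U)))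
  change Module.finrank F (adjoinStep x (adjoinStep x U)) + _ = _ at h
  omega

theorem two_mul_le_finrank_iterate {x f g : K} (H : PolyIndep F x f g) {U : Submodule F K}
    [FiniteDimensional F U] (hf : f ∈ U) (hg : g ∈ U) (n : ℕ) :
    2 * (n + 1) ≤ Module.finrank F (iterStep x U n) := by
  have hmem : ∀ n : ℕ, ∀ u ∈ U, ∀ i ≤ n, x ^ i * u ∈ iterStep x U n := by
    intro n u hu
    induction n with
    | zero => intro i hi; simpa [Nat.le_zero.1 hi, iterStep] using hu
    | succ n ih =>
      intro i hi
      rcases Nat.lt_or_ge n i with h | h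
      · obtain rfl : i = n + 1 := by omega
        rw [pow_succ', mul_assoc]
        exact mul_mem_adjoinStep x (ih n le_rfl)
      · exact le_adjoinStep x _ (ih i h)
  let φ : (Polynomial.degreeLT F (n + 1) × Polynomial.degreeLT F (n + 1)) →ₗ[F] K :=
    LinearMap.coprod
      ((LinearMap.mulRight F f ∘ₗ (Polynomial.aeval x).toLinearMap).domRestrict _)
      ((LinearMap.mulRight F g ∘ₗ (Polynomial.aeval x).toLinearMap).domRestrict _)
  have hφ : ∀ p, φ p = (p.1 : Polynomial F).aeval x * f + (p.2 : Polynomial F).aeval x * g :=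
    fun p => rfl
  have hinj : Function.Injective φ := by
    rw [← LinearMap.ker_eq_bot, LinearMap.ker_eq_bot']
    intro p hp
    obtain ⟨h1, h2⟩ := H _ _ ((hφ p).symm.trans hp)
    exact Prod.ext (Subtype.ext h1) (Subtype.ext h2)
  have hval : ∀ p ∈ Polynomial.degreeLT F (n + 1), ∀ u ∈ U,
      Polynomial.aeval x p * u ∈ iterStep x U n := by
    intro p hp u hu
    rw [Polynomial.aeval_eq_sum_range' (n := n + 1), Finset.sum_mul]
    · refine Submodule.sum_mem _ fun i hi => ?_
      rw [smul_mul_assoc]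
      exact Submodule.smul_mem _ _ (hmem n u hu i (by simpa [Nat.lt_succ_iff] using hi))
    · by_cases h0 : p = 0
      · simp [h0]
      · exact (Polynomial.natDegree_lt_iff_degree_lt h0).2 (Polynomial.mem_degreeLT.1 hp)
  have hrange : LinearMap.range φ ≤ iterStep x U n := by
    rintro _ ⟨p, rfl⟩
    rw [hφ]
    exact add_mem (hval _ p.1.2 f hf) (hval _ p.2.2 g hg)
  have h1 := Submodule.finrank_mono hrange
  have hd : Module.finrank F (Polynomial.degreeLT F (n + 1)) = n + 1 := by
    rw [(Polynomial.degreeLTEquiv F (n + 1)).finrank_eq, Module.finrank_fin_fun]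
  have hfin : FiniteDimensional F (Polynomial.degreeLT F (n + 1)) :=
    (Polynomial.degreeLTEquiv F (n + 1)).symm.finiteDimensional
  rw [LinearMap.finrank_range_of_inj hinj, Module.finrank_prod, hd] at h1
  omega

theorem finrank_adjoinStep_ge {x f g : K} (hx : x ≠ 0) (H : PolyIndep F x f g)
    {U : Submodule F K} [FiniteDimensional F U] (hf : f ∈ U) (hg : g ∈ U) :
    Module.finrank F U + 2 ≤ Module.finrank F (adjoinStep x U) := by
  by_contra! hlt
  set d : ℕ → ℕ := fun n => Module.finrank F (iterStep x U n) with hd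
  have h0 : d 0 = Module.finrank F U := rfl
  have h1 : d 1 < d 0 + 2 := hlt
  have hstep : ∀ n, d (n + 1) ≤ d n + 1 := by
    intro n
    induction n with
    | zero => exact Nat.lt_succ_iff.1 h1
    | succ n ih =>
      have h : d (n + 1 + 1) + d n ≤ 2 * d (n + 1) := by
        exact finrank_adjoinStep_adjoinStep hx _
      omega
  have hbound : ∀ n, d n ≤ d 0 + n := by
    intro n
    induction n with
    | zero => rfl
    | succ n ih => have := hstep n; omega
  have h2 : 2 * (d 0 + 1) ≤ d (d 0) := two_mul_le_finrank_iterate H hf hg (d 0)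
  have h3 := hbound (d 0)
  omega

/-- The span of the products of distinct elements of `x a, …, x (a + n - 1)`. -/
def window (F : Type*) {K : Type*} [Field F] [Field K] [Algebra F K] (x : ℤ → K) (a : ℤ) :
    ℕ → Submodule F K
  | 0 => 1
  | n + 1 => adjoinStep (x (a + n)) (window F x a n)

theorem one_mem_window (x : ℤ → K) (a : ℤ) (n : ℕ) : (1 : K) ∈ window F x a n := by
  induction n with
  | zero => exact Submodule.one_le.1 le_rfl
  | succ n ih => exact le_adjoinStep _ _ ih

instance window_finite (x : ℤ → K) (a : ℤ) (n : ℕ) : FiniteDimensional F (window F x a n) := by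
  induction n with
  | zero =>
    rw [window, Submodule.one_eq_span]
    infer_instance
  | succ n ih =>
    rw [window]
    infer_instance

theorem finrank_window {x : ℤ → K} (h : ∀ j, PolyIndep F (x (j + 1)) 1 (x j))
    (h0 : ∀ j, x j ≠ 0) (ht : ∀ j, Transcendental F (x j)) (a : ℤ) (n : ℕ) :
    2 * n ≤ Module.finrank F (window F x a n) := by
  induction n with
  | zero => simp
  | succ n ih =>
    cases n with
    | zero =>
      have h1 : x (a + 0) ∈ window F x a 1 := by
        have := mul_mem_adjoinStep (F := F) (x (a + 0)) (one_mem_window x a 0)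
        simpa [window] using this
      have hli : LinearIndependent F ![1, x (a + 0)] := by
        rw [LinearIndependent.pair_iff]
        intro s t hst
        have h3 : (Polynomial.C s + Polynomial.C t * Polynomial.X : Polynomial F) = 0 :=
          (transcendental_iff.1 (ht (a + 0))) _
            (by simpa [Algebra.smul_def] using hst)
        have hs := congrArg (fun p => p.coeff 0) h3
        have htt := congrArg (fun p => p.coeff 1) h3
        simp at hs htt
        exact ⟨hs, htt⟩
      have hle : Submodule.span F (Set.range ![1, x (a + 0)]) ≤ window F x a 1 := by
        rw [Submodule.span_le]
        rintro _ ⟨i, rfl⟩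
        fin_cases i
        · exact one_mem_window x a 1
        · exact h1
      have := Submodule.finrank_mono hle
      rw [finrank_span_eq_card hli] at this
      simpa using this
    | succ n =>
      have hmem : x (a + n) ∈ window F x a (n + 1) := by
        have := mul_mem_adjoinStep (F := F) (x (a + n)) (one_mem_window x a n)
        simpa [window] using this
      have h1 := finrank_adjoinStep_ge (h0 _) (h (a + n)) (one_mem_window x a (n + 1)) hmem
      have h2 : adjoinStep (x (a + n + 1)) (window F x a (n + 1)) = window F x a (n + 2) := by
        rw [window.eq_def F x a (n + 2)]
        push_cast
        rw [add_assoc]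
      rw [h2] at h1
      change _ ≤ Module.finrank F (window F x a (n + 2))
      omega

end Growth

section Orbits

/-- A sequence of points on the biquadratic curve
`e a² b² - a² - b² + 2 c a b + e = 0`, obtained by iterating its translation, whose consecutive
members generate a quadratic extension of a rational function field over `F`. -/
structure CurveOrbit (F : Type*) {K : Type*} [Field F] [Field K] [Algebra F K] (e c : K)
    (x : ℤ → K) : Prop where
  curve : ∀ j, e * x j ^ 2 * x (j + 1) ^ 2 - x j ^ 2 - x (j + 1) ^ 2 + 2 * c * x j * x (j + 1)
    + e = 0
  rel₁ : ∀ j, (e ^ 2 - 1) * (x j + x (j + 2)) + 2 * e * c * x j * x (j + 1) * x (j + 2)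
    + 2 * c * x (j + 1) = 0
  rel₂ : ∀ j, (e ^ 2 - 1) * (x j * x (j + 1) + x (j + 1) * x (j + 2)) + 2 * e * c
    + 2 * c * x j * x (j + 2) = 0
  transc : ∀ j, Transcendental F (x j)
  indep : ∀ j, PolyIndep F (x j) 1 (x (j + 1))
  indep' : ∀ j, PolyIndep F (x (j + 1)) 1 (x j)

variable {F K : Type*} [Field F] [Field K] [Algebra F K]

theorem polyIndep_of_curve [IsAlgClosed F] (h2 : (2 : F) ≠ 0) {e c : F} (he : e ≠ 0)
    (hc1 : c ^ 2 ≠ (1 + e) ^ 2) (hc2 : c ^ 2 ≠ (1 - e) ^ 2) {a b : K} (ha : Transcendental F a)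
    (hab : algebraMap F K e * a ^ 2 * b ^ 2 - a ^ 2 - b ^ 2 + 2 * algebraMap F K c * a * b
      + algebraMap F K e = 0) : PolyIndep F a 1 b := by
  open Polynomial in
  classical
  intro p q hpq
  obtain ⟨B, hB⟩ : ∃ B, B = 1 + e ^ 2 - c ^ 2 := ⟨_, rfl⟩
  set D : F[X] := C e * X ^ 4 - C B * X ^ 2 + C e with hD
  have hinj := (transcendental_iff_injective.1 ha)
  have hsq : ((C e * X ^ 2 - 1) * p - C c * X * q) ^ 2 = q ^ 2 * D := by
    apply hinj
    have hqb : aeval a p = - (aeval a q * b) := by linear_combination hpq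
    simp only [hD, hB, map_mul, map_pow, map_sub, map_add, aeval_C, aeval_X, map_one, hqb]
    linear_combination (aeval a q) ^ 2 * (algebraMap F K e * a ^ 2 - 1) * hab
  have hDdeg : D.natDegree = 4 := by
    rw [hD]
    compute_degree!
  have hD0 : D ≠ 0 := fun h => by simp [h] at hDdeg
  obtain ⟨r, hr⟩ := IsAlgClosed.exists_root D (by
    rw [degree_eq_natDegree hD0, hDdeg]; norm_num)
  have hr' : e * r ^ 4 - B * r ^ 2 + e = 0 := by
    simpa [hD, IsRoot] using hr
  have hmult : D.rootMultiplicity r = 1 := by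
    have h1 : 0 < D.rootMultiplicity r := (rootMultiplicity_pos hD0).2 hr
    have h3 : ¬ 1 < D.rootMultiplicity r := by
      rw [one_lt_rootMultiplicity_iff_isRoot hD0]
      rintro ⟨-, h⟩
      have h4 : e * ((3 + 1) * r ^ 3) - B * ((1 + 1) * r) = 0 := by
        simpa [hD, IsRoot] using h
      have hr0 : r ≠ 0 := by
        rintro rfl
        exact he (by simpa using hr')
      have h5 : 2 * e * r ^ 2 = B :=
        mul_left_cancel₀ (mul_ne_zero h2 hr0) (by linear_combination h4)
      have h6 : (c ^ 2 - (1 + e) ^ 2) * (c ^ 2 - (1 - e) ^ 2) = 0 := by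
        rw [show (c ^ 2 - (1 + e) ^ 2) * (c ^ 2 - (1 - e) ^ 2) = B ^ 2 - 4 * e ^ 2 by
          rw [hB]; ring]
        linear_combination (-4 * e) * hr' + (2 * e * r ^ 2 - B) * h5
      rcases mul_eq_zero.1 h6 with h | h
      · exact hc1 (sub_eq_zero.1 h)
      · exact hc2 (sub_eq_zero.1 h)
    omega
  have hq : q = 0 := by
    by_contra hq
    have hne : q ^ 2 * D ≠ 0 := mul_ne_zero (pow_ne_zero _ hq) hD0
    have h3 := congrArg (rootMultiplicity r) hsq
    rw [rootMultiplicity_mul hne, hmult] at h3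
    rw [← count_roots, ← count_roots, roots_pow, roots_pow, Multiset.count_nsmul,
      Multiset.count_nsmul] at h3
    omega
  refine ⟨hinj ?_, hq⟩
  simpa [hq] using hpq

theorem transcendental_of_curve [IsAlgClosed F] {e c : F} (h2 : (2 : F) ≠ 0) (hc : c ≠ 0)
    {a b : K} (ha : Transcendental F a)
    (hab : algebraMap F K e * a ^ 2 * b ^ 2 - a ^ 2 - b ^ 2 + 2 * algebraMap F K c * a * b
      + algebraMap F K e = 0) : Transcendental F b := by
  open Polynomial in
  intro hb
  obtain ⟨b, rfl⟩ : ∃ b₀, algebraMap F K b₀ = b := by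
    have hi : IsIntegral F b := hb.isIntegral
    exact minpoly.mem_range_of_degree_eq_one F b
      (IsAlgClosed.degree_eq_one_of_irreducible F (minpoly.irreducible hi))
  have h : (C (e * b ^ 2 - 1) * X ^ 2 + C (2 * c * b) * X + C (e - b ^ 2) : F[X]) = 0 := by
    apply (transcendental_iff.1 ha)
    simp only [map_mul, map_pow, map_sub, map_add, aeval_C, aeval_X, map_one, map_ofNat]
    linear_combination hab
  have hq : ∀ u v w : F, (C u * X ^ 2 + C v * X + C w : F[X]) = 0 → u = 0 ∧ v = 0 := by
    intro u v w h
    have h3 := congrArg (fun p => p.coeff 2) h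
    have h4 := congrArg (fun p => p.coeff 1) h
    simp [coeff_C] at h3 h4
    exact ⟨h3, h4⟩
  obtain ⟨h3, h4⟩ := hq _ _ _ h
  have hb0 : b = 0 := by simpa [h2, hc] using h4
  simp [hb0] at h3

/-- Pairs of points on the curve with transcendental coordinates. -/
abbrev CurvePair (F : Type*) {K : Type*} [Field F] [Field K] [Algebra F K] (e c : K) : Type _ :=
  {p : K × K // (e * p.1 ^ 2 * p.2 ^ 2 - p.1 ^ 2 - p.2 ^ 2 + 2 * c * p.1 * p.2 + e = 0) ∧
    Transcendental F p.1 ∧ Transcendental F p.2}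

theorem curve_coeff_ne_zero {e : F} {b : K} (hb : Transcendental F b) :
    algebraMap F K e * b ^ 2 - 1 ≠ 0 := by
  open Polynomial in
  intro h
  have h3 : (C e * X ^ 2 - 1 : F[X]) = 0 := by
    apply (transcendental_iff.1 hb)
    simpa using h
  simpa using congrArg (fun p => p.coeff 0) h3

theorem curve_vieta {e c a b : K} (hb : e * b ^ 2 - 1 ≠ 0)
    (hab : e * a ^ 2 * b ^ 2 - a ^ 2 - b ^ 2 + 2 * c * a * b + e = 0) :
    e * b ^ 2 * (-a - 2 * c * b / (e * b ^ 2 - 1)) ^ 2 - b ^ 2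
      - (-a - 2 * c * b / (e * b ^ 2 - 1)) ^ 2
      + 2 * c * b * (-a - 2 * c * b / (e * b ^ 2 - 1)) + e = 0 := by
  have hw : 2 * c * b / (e * b ^ 2 - 1) * (e * b ^ 2 - 1) = 2 * c * b := div_mul_cancel₀ _ hb
  linear_combination hab + (2 * a + 2 * c * b / (e * b ^ 2 - 1)) * hw

/-- The translation of the curve. -/
def curveShift [IsAlgClosed F] {e c : F} (h2 : (2 : F) ≠ 0) (hc : c ≠ 0) :
    Equiv.Perm (CurvePair F (algebraMap F K e) (algebraMap F K c)) where
  toFun p := ⟨(p.1.2, -p.1.1 - 2 * algebraMap F K c * p.1.2 / (algebraMap F K e * p.1.2 ^ 2 - 1)),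
    by
      have h := curve_vieta (curve_coeff_ne_zero p.2.2.2) p.2.1
      exact ⟨h, p.2.2.2, transcendental_of_curve h2 hc p.2.2.2 h⟩⟩
  invFun p := ⟨(-p.1.2 - 2 * algebraMap F K c * p.1.1 / (algebraMap F K e * p.1.1 ^ 2 - 1), p.1.1),
    by
      have h := curve_vieta (c := algebraMap F K c) (curve_coeff_ne_zero (e := e) p.2.2.1)
        (a := p.1.2) (by linear_combination p.2.1)
      exact ⟨by linear_combination h, transcendental_of_curve h2 hc p.2.2.1 h, p.2.2.1⟩⟩
  left_inv p := by
    ext <;> simp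
  right_inv p := by
    ext <;> simp

theorem exists_curveOrbit (F : Type*) [Field F] [IsAlgClosed F] (h2 : (2 : F) ≠ 0) {e c : F}
    (he : e ≠ 0) (hc : c ≠ 0) (hc1 : c ^ 2 ≠ (1 + e) ^ 2) (hc2 : c ^ 2 ≠ (1 - e) ^ 2) :
    ∃ x : ℤ → AlgebraicClosure (RatFunc F),
      CurveOrbit F (algebraMap F _ e) (algebraMap F _ c) x := by
  set K := AlgebraicClosure (RatFunc F)
  obtain ⟨a, ha⟩ : ∃ a : K, Transcendental F a :=
    ⟨algebraMap (RatFunc F) K RatFunc.X, by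
      have := (RatFunc.transcendental_X (K := F))
      rwa [transcendental_algebraMap_iff (algebraMap (RatFunc F) K).injective]⟩
  obtain ⟨b, hb⟩ : ∃ b : K, algebraMap F K e * a ^ 2 * b ^ 2 - a ^ 2 - b ^ 2
      + 2 * algebraMap F K c * a * b + algebraMap F K e = 0 := by
    open Polynomial in
    set P : K[X] := C (algebraMap F K e * a ^ 2 - 1) * X ^ 2 + C (2 * algebraMap F K c * a) * X
      + C (algebraMap F K e - a ^ 2) with hP
    obtain ⟨b, hb⟩ := IsAlgClosed.exists_root P (by
      rw [degree_quadratic (curve_coeff_ne_zero ha)]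
      norm_num)
    refine ⟨b, ?_⟩
    have : (algebraMap F K e * a ^ 2 - 1) * b ^ 2 + 2 * algebraMap F K c * a * b +
        (algebraMap F K e - a ^ 2) = 0 := by simpa [hP, IsRoot] using hb
    linear_combination this
  let p₀ : CurvePair F (algebraMap F K e) (algebraMap F K c) :=
    ⟨(a, b), hb, ha, transcendental_of_curve h2 hc ha hb⟩
  set T : Equiv.Perm (CurvePair F (algebraMap F K e) (algebraMap F K c)) := curveShift h2 hc
  set x : ℤ → K := fun j => ((T ^ j) p₀).1.1 with hx
  have hsucc : ∀ j : ℤ, (T ^ (j + 1)) p₀ = T ((T ^ j) p₀) := fun j => by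
    rw [add_comm, zpow_one_add]
    rfl
  have hx1 : ∀ j, ((T ^ j) p₀).1.2 = x (j + 1) := fun j => by
    rw [hx]
    simp only [hsucc]
    rfl
  have hx2 : ∀ j, x (j + 2) = -x j - 2 * algebraMap F K c * x (j + 1) /
      (algebraMap F K e * x (j + 1) ^ 2 - 1) := fun j => by
    rw [show j + 2 = j + 1 + 1 by ring, ← hx1 (j + 1), hsucc, ← hx1 j]
    rfl
  have htr : ∀ j, Transcendental F (x j) := fun j => ((T ^ j) p₀).2.2.1
  have hcurve : ∀ j, algebraMap F K e * x j ^ 2 * x (j + 1) ^ 2 - x j ^ 2 - x (j + 1) ^ 2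
      + 2 * algebraMap F K c * x j * x (j + 1) + algebraMap F K e = 0 := fun j => by
    rw [← hx1 j]
    exact ((T ^ j) p₀).2.1
  refine ⟨x, hcurve, fun j => ?_, fun j => ?_, htr,
    fun j => polyIndep_of_curve h2 he hc1 hc2 (htr j) (hcurve j),
    fun j => polyIndep_of_curve h2 he hc1 hc2 (htr (j + 1))
      (by linear_combination hcurve j)⟩
  · have h := curve_coeff_ne_zero (e := e) (htr (j + 1))
    have hw := div_mul_cancel₀ (2 * algebraMap F K c * x (j + 1)) h
    rw [hx2 j]
    refine mul_left_cancel₀ h ?_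
    linear_combination (-2 * algebraMap F K c * algebraMap F K e * x (j + 1)) * hcurve j -
      (algebraMap F K e ^ 2 - 1 + 2 * algebraMap F K e * algebraMap F K c * x j * x (j + 1)) * hw
  · have h := curve_coeff_ne_zero (e := e) (htr (j + 1))
    have hw := div_mul_cancel₀ (2 * algebraMap F K c * x (j + 1)) h
    rw [hx2 j]
    refine mul_left_cancel₀ h ?_
    linear_combination (-2 * algebraMap F K c) * hcurve j -
      ((algebraMap F K e ^ 2 - 1) * x (j + 1) + 2 * algebraMap F K c * x j) * hw

end Orbits

section WordFunctionals

variable {F : Type*} [Field F]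

/-- Functions on words of length `m` in two letters which vanish on the multiples of the two
cubic forms and of the quartic form attached to the parameters `e`, `c`. -/
structure WordAdmissible (e c : F) (m : ℕ) (ω : List Bool → F) : Prop where
  cubic : ∀ p s, p.length + 3 + s.length = m → ∀ b : Bool,
    (e ^ 2 - 1) * (ω (p ++ b :: (!b) :: (!b) :: s) + ω (p ++ (!b) :: (!b) :: b :: s))
      + 2 * e * c * ω (p ++ b :: b :: b :: s) + 2 * c * ω (p ++ (!b) :: b :: (!b) :: s) = 0
  quartic : ∀ p s, p.length + 4 + s.length = m → ∀ b : Bool,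
    2 * e * c * (4 * c ^ 2 - (e ^ 2 - 1) ^ 2) *
        (ω (p ++ b :: b :: b :: b :: s) + ω (p ++ (!b) :: (!b) :: (!b) :: (!b) :: s))
      - (e ^ 2 - 1) * (4 * c ^ 2 * e ^ 2 - (e ^ 2 - 1) ^ 2) *
        (ω (p ++ b :: b :: (!b) :: (!b) :: s) + ω (p ++ (!b) :: (!b) :: b :: b :: s))
      + 2 * c * (4 * c ^ 2 * e ^ 2 - (e ^ 2 - 1) ^ 2) *
        (ω (p ++ b :: (!b) :: b :: (!b) :: s) + ω (p ++ (!b) :: b :: (!b) :: b :: s))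
      - (e ^ 2 - 1) * (4 * c ^ 2 - (e ^ 2 - 1) ^ 2) *
        (ω (p ++ b :: (!b) :: (!b) :: b :: s) + ω (p ++ (!b) :: b :: b :: (!b) :: s)) = 0

/-- The value of a word on a sequence of vectors. -/
def wordEval (X : ℕ → Bool → F) : List Bool → F
  | [] => 1
  | b :: w => X 0 b * wordEval (fun i => X (i + 1)) w

theorem wordEval_append (X : ℕ → Bool → F) (w s : List Bool) :
    wordEval X (w ++ s) = wordEval X w * wordEval (fun i => X (w.length + i)) s := by
  induction w generalizing X with
  | nil => simp [wordEval]
  | cons b w ih =>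
    simp only [List.cons_append, wordEval, ih, List.length_cons, mul_assoc]
    congr! 5
    omega

/-- The parity of the number of occurrences of `true`. -/
def wordParity : List Bool → Bool
  | [] => false
  | b :: w => xor b (wordParity w)

theorem wordParity_append (w s : List Bool) :
    wordParity (w ++ s) = xor (wordParity w) (wordParity s) := by
  induction w with
  | nil => simp [wordParity]
  | cons b w ih => simp [wordParity, ih]

theorem WordAdmissible.cons {e c : F} {m : ℕ} {ω : List Bool → F}
    (h : WordAdmissible e c (m + 1) ω) (b : Bool) : WordAdmissible e c m fun w => ω (b :: w) where
  cubic p s hps := h.cubic (b :: p) s (by simp; omega)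
  quartic p s hps := h.quartic (b :: p) s (by simp; omega)

theorem WordAdmissible.concat {e c : F} {m : ℕ} {ω : List Bool → F}
    (h : WordAdmissible e c (m + 1) ω) (b : Bool) :
    WordAdmissible e c m fun w => ω (w ++ [b]) where
  cubic p s hps := by simpa using h.cubic p (s ++ [b]) (by simp; omega)
  quartic p s hps := by simpa using h.quartic p (s ++ [b]) (by simp; omega)

/-- The trilinear form whose vanishing defines the next vector of a sequence. -/
def cubicForm (e c : F) (x y z : Bool → F) (b : Bool) : F :=
  (e ^ 2 - 1) * (x b * y (!b) * z (!b) + x (!b) * y (!b) * z b)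
    + 2 * e * c * (x b * y b * z b) + 2 * c * (x (!b) * y b * z (!b))

/-- Nonvanishing and non-degeneracy conditions on the parameters of the curve. -/
structure GoodParams (e c : F) : Prop where
  two_ne : (2 : F) ≠ 0
  e_ne : e ≠ 0
  c_ne : c ≠ 0
  sq_ne : e ^ 2 ≠ 1
  c_ne₁ : c ^ 2 ≠ (1 + e) ^ 2
  c_ne₂ : c ^ 2 ≠ (1 - e) ^ 2

theorem exists_kernel_vector {e c : F} (h : GoodParams e c) {x y : Bool → F} (hx : x ≠ 0)
    (hy : y ≠ 0) : ∃ z : Bool → F, z ≠ 0 ∧ ∀ z', (∀ b, cubicForm e c x y z' b = 0) →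
      ∃ t : F, z' = t • z := by
  have hE : e ^ 2 - 1 ≠ 0 := sub_ne_zero.2 h.sq_ne
  have line : ∀ a b : F, ¬(a = 0 ∧ b = 0) → ∃ z : Bool → F, z ≠ 0 ∧ ∀ z' : Bool → F,
      a * z' false + b * z' true = 0 → ∃ t : F, z' = t • z := by
    intro a b hab
    refine ⟨fun i => if i then a else -b, fun h0 => ?_, fun z' hz' => ?_⟩
    · have h1 := congrFun h0 true
      have h2 := congrFun h0 false
      simp at h1 h2
      exact hab ⟨h1, h2⟩
    · by_cases ha : a = 0
      · subst ha
        have hb : b ≠ 0 := fun hb => hab ⟨rfl, hb⟩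
        have ht : z' true = 0 := by simpa [hb] using hz'
        refine ⟨-z' false / b, ?_⟩
        ext i
        cases i
        · simp
          field_simp
        · simp [ht]
      · refine ⟨z' true / a, ?_⟩
        ext i
        cases i
        · simp
          field_simp
          linear_combination hz'
        · simp
          field_simp
  have rows : ∀ z b, cubicForm e c x y z b =
      ((e ^ 2 - 1) * (x (!b) * y (!b)) + 2 * e * c * (x b * y b)) * z b +
        ((e ^ 2 - 1) * (x b * y (!b)) + 2 * c * (x (!b) * y b)) * z (!b) := fun z b => by
    rw [cubicForm]
    ring
  by_cases h1 : (e ^ 2 - 1) * (x true * y true) + 2 * e * c * (x false * y false) = 0 ∧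
      (e ^ 2 - 1) * (x false * y true) + 2 * c * (x true * y false) = 0
  · by_cases h2 : (e ^ 2 - 1) * (x true * y false) + 2 * c * (x false * y true) = 0 ∧
        (e ^ 2 - 1) * (x false * y false) + 2 * e * c * (x true * y true) = 0
    · exfalso
      obtain ⟨h3, h4⟩ := h1
      obtain ⟨h5, h6⟩ := h2
      have hx' : x false ≠ 0 ∨ x true ≠ 0 := by
        by_contra! hn
        exact hx (by ext i; cases i <;> simp [hn])
      have hy' : y false ≠ 0 ∨ y true ≠ 0 := by
        by_contra! hn
        exact hy (by ext i; cases i <;> simp [hn])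
      have hec := mul_ne_zero (mul_ne_zero h.two_ne h.e_ne) h.c_ne
      have hc := mul_ne_zero h.two_ne h.c_ne
      by_cases a0 : x false = 0
      · simp [a0, hE, hc] at h3 h4 hx' hy'; tauto
      by_cases a1 : y false = 0
      · simp [a1, hE] at h3 h4 hx' hy'; tauto
      have d1 : ((e ^ 2 - 1) ^ 2 - (2 * e * c) ^ 2) * (x false * y false) = 0 := by
        linear_combination (e ^ 2 - 1) * h6 - 2 * e * c * h3
      have d2 : ((e ^ 2 - 1) ^ 2 - (2 * c) ^ 2) * (x true * y false) = 0 := by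
        linear_combination (e ^ 2 - 1) * h5 - 2 * c * h4
      have b0 : x true ≠ 0 := by
        intro b0
        simp [b0, hec, a0, a1] at h3
      have d3 := (mul_eq_zero.1 d1).resolve_right (mul_ne_zero a0 a1)
      have d4 := (mul_eq_zero.1 d2).resolve_right (mul_ne_zero b0 a1)
      have d5 : (2 * c) ^ 2 * (e ^ 2 - 1) = 0 := by linear_combination d4 - d3
      exact mul_ne_zero (pow_ne_zero 2 hc) hE d5
    · obtain ⟨z, hz, hz'⟩ := line _ _ h2
      exact ⟨z, hz, fun z' h0 => hz' z' (by
        have := h0 true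
        rw [rows, Bool.not_true] at this
        linear_combination this)⟩
  · obtain ⟨z, hz, hz'⟩ := line _ _ h1
    exact ⟨z, hz, fun z' h0 => hz' z' (by
      have := h0 false
      rwa [rows, Bool.not_false] at this)⟩

theorem exists_vector_sequence {e c : F} (h : GoodParams e c) {x₂ x₃ : Bool → F} (h₂ : x₂ ≠ 0)
    (h₃ : x₃ ≠ 0) (x₀ x₁ : Bool → F) (h₀ : x₀ ≠ 0) (h₁ : x₁ ≠ 0) :
    ∃ X : ℕ → Bool → F, X 0 = x₀ ∧ X 1 = x₁ ∧ X 2 = x₂ ∧ X 3 = x₃ ∧ (∀ n, X n ≠ 0) ∧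
      ∀ n, 2 ≤ n → ∀ z, (∀ b, cubicForm e c (X n) (X (n + 1)) z b = 0) →
        ∃ t : F, z = t • X (n + 2) := by
  choose! nxt hnxt using fun p : (Bool → F) × (Bool → F) => fun hp : p.1 ≠ 0 ∧ p.2 ≠ 0 =>
    exists_kernel_vector h hp.1 hp.2
  let S : ℕ → (Bool → F) × (Bool → F) := fun n =>
    Nat.rec (x₂, x₃) (fun _ p => (p.2, nxt p)) n
  have hS : ∀ n, (S n).1 ≠ 0 ∧ (S n).2 ≠ 0 := by
    intro n
    induction n with
    | zero => exact ⟨h₂, h₃⟩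
    | succ n ih => exact ⟨ih.2, (hnxt (S n) ih).1⟩
  refine ⟨fun n => match n with | 0 => x₀ | 1 => x₁ | n + 2 => (S n).1, rfl, rfl, rfl, rfl,
    fun n => ?_, fun n hn => ?_⟩
  · match n with
    | 0 => exact h₀
    | 1 => exact h₁
    | n + 2 => exact (hS n).1
  · obtain ⟨n, rfl⟩ : ∃ n', n = n' + 2 := ⟨n - 2, by omega⟩
    exact (hnxt (S n) (hS n)).2

/-- The fourth vector of the start sequence, up to scalars, is determined by a linear form. -/
theorem eq_smul_of_linear {a b : F} (hab : ¬(a = 0 ∧ b = 0)) {z x : Bool → F}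
    (hz : a * z false + b * z true = 0) (hx0 : x false = -b) (hx1 : x true = a) :
    ∃ t : F, z = t • x := by
  by_cases ha : a = 0
  · subst ha
    have hb : b ≠ 0 := fun hb => hab ⟨rfl, hb⟩
    have ht : z true = 0 := by simpa [hb] using hz
    refine ⟨-z false / b, ?_⟩
    ext i
    cases i
    · simp only [Pi.smul_apply, smul_eq_mul, hx0]
      field_simp
    · simp [ht, hx1]
  · refine ⟨z true / a, ?_⟩
    ext i
    cases i
    · simp only [Pi.smul_apply, smul_eq_mul, hx0]
      field_simp
      linear_combination hz
    · simp only [Pi.smul_apply, smul_eq_mul, hx1]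
      field_simp

theorem exists_parity_extension {X : ℕ → Bool → F} {m : ℕ}
    {ω : List Bool → F} {t : Bool → Bool → F}
    (ht : ∀ z w, w.length = m → ω (w ++ [z]) = t z (wordParity w) * wordEval X w)
    (hline : ∀ π : Bool, ∃ s : F, (fun z => t z (xor π z)) = s • X m) :
    ∃ t : Bool → F, ∀ w, w.length = m + 1 → ω w = t (wordParity w) * wordEval X w := by
  choose s hs using hline
  refine ⟨s, fun w hw => ?_⟩
  obtain ⟨w, z, rfl⟩ : ∃ w' z, w = w' ++ [z] := by
    rcases List.eq_nil_or_concat w with rfl | h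
    · simp at hw
    · obtain ⟨w', z, rfl⟩ := h
      exact ⟨w', z, by simp⟩
  have hw' : w.length = m := by simpa using hw
  have h1 := congrFun (hs (xor (wordParity w) z)) z
  simp only [Bool.xor_assoc, Bool.xor_self, Bool.xor_false, Pi.smul_apply, smul_eq_mul] at h1
  rw [ht z w hw', h1, wordParity_append, wordEval_append, hw']
  simp [wordParity, wordEval]
  ring

theorem eval_last_three {X : ℕ → Bool → F} {m : ℕ} {ω : List Bool → F} {t : Bool → Bool → F}
    (ht : ∀ z w, w.length = m + 2 → ω (w ++ [z]) = t z (wordParity w) * wordEval X w)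
    (p : List Bool) (hp : p.length = m) (x y z : Bool) :
    ω (p ++ [x, y, z]) = wordEval X p *
      (X m x * X (m + 1) y * t z (xor (wordParity p) (xor x y))) := by
  have := ht z (p ++ [x, y]) (by simp [hp])
  rw [wordParity_append, wordEval_append] at this
  simp only [List.append_assoc, List.cons_append, List.nil_append, hp] at this
  rw [this]
  simp [wordParity, wordEval]
  ring

theorem exists_wordEval_ne_zero {X : ℕ → Bool → F} (hX : ∀ n, X n ≠ 0) (h0 : X 0 false ≠ 0)
    (h1 : ∀ b, X 1 b ≠ 0) (m : ℕ) (b : Bool) :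
    ∃ w, w.length = m + 1 ∧ wordParity (false :: w) = b ∧ wordEval X (false :: w) ≠ 0 := by
  induction m generalizing b with
  | zero =>
    exact ⟨[b], rfl, by simp [wordParity], by simp [wordEval, h0, h1]⟩
  | succ m ih =>
    obtain ⟨z, hz⟩ := Function.ne_iff.1 (hX (m + 2))
    obtain ⟨w, hw, hp, he⟩ := ih (xor b z)
    refine ⟨w ++ [z], by simp [hw], ?_, ?_⟩
    · rw [← List.cons_append, wordParity_append, hp]
      simp [wordParity]
    · rw [← List.cons_append, wordEval_append]
      refine mul_ne_zero he ?_
      simpa [wordEval, hw] using hz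

/-- The functionals vanishing on words which start with `true` are spanned by evaluations, one
for each parity. -/
theorem exists_start_sequence [IsAlgClosed F] {e c : F} (h : GoodParams e c) :
    ∃ X : ℕ → Bool → F, (∀ n, X n ≠ 0) ∧ X 0 false ≠ 0 ∧ (∀ b, X 1 b ≠ 0) ∧
      ∀ m, 3 ≤ m → ∀ ω, WordAdmissible e c m ω → (∀ w, w.length + 1 = m → ω (true :: w) = 0) →
        ∃ t : Bool → F, ∀ w, w.length = m → ω w = t (wordParity w) * wordEval X w := by
  have hE : e ^ 2 - 1 ≠ 0 := sub_ne_zero.2 h.sq_ne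
  have h2 := h.two_ne
  have he := h.e_ne
  have hc := h.c_ne
  obtain ⟨r, hr⟩ : ∃ r, e * r ^ 2 = 1 := by
    obtain ⟨r, hr⟩ := IsAlgClosed.exists_pow_nat_eq e⁻¹ (n := 2) (by norm_num)
    exact ⟨r, by rw [hr, mul_inv_cancel₀ he]⟩
  have hr0 : r ≠ 0 := by
    rintro rfl
    simp at hr
  set g := 4 * c ^ 2 - (e ^ 2 - 1) ^ 2 with hg
  set l := 4 * c ^ 2 * e ^ 2 - (e ^ 2 - 1) ^ 2 with hl
  have hgl : ¬(g = 0 ∧ l * r = 0) := by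
    rintro ⟨h3, h4⟩
    have h5 : l = 0 := (mul_eq_zero.1 h4).resolve_right hr0
    have h6 : (2 * c) ^ 2 * (e ^ 2 - 1) = 0 := by
      rw [hg] at h3
      rw [hl] at h5
      linear_combination h5 - h3
    exact mul_ne_zero (pow_ne_zero 2 (mul_ne_zero h2 hc)) hE h6
  obtain ⟨X, X0, X1, X2, X3, hX, hker⟩ := exists_vector_sequence h
    (x₂ := fun b => if b then 2 * c else -((e ^ 2 - 1) * r))
    (x₃ := fun b => if b then g else -(l * r))
    (fun h0 => mul_ne_zero h2 hc (by simpa using congrFun h0 true))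
    (fun h0 => hgl ⟨by simpa using congrFun h0 true, by simpa using congrFun h0 false⟩)
    (fun b => if b then 0 else 1) (fun b => if b then 1 else r)
    (fun h0 => one_ne_zero (α := F) (by simpa using congrFun h0 false))
    (fun h0 => one_ne_zero (α := F) (by simpa using congrFun h0 true))
  have hX1 : ∀ b, X 1 b ≠ 0 := fun b => by rw [X1]; cases b <;> simp [hr0]
  have hX0 : X 0 false ≠ 0 := by simp [X0]
  refine ⟨X, hX, hX0, hX1, fun m hm => ?_⟩
  induction m, hm using Nat.le_induction with
  | base =>
    intro ω hω ht
    refine ⟨fun b => if b then ω [false, false, true] / (2 * c * r) else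
      ω [false, true, true] / (2 * c), fun w hw => ?_⟩
    obtain ⟨x, y, z, rfl⟩ := List.length_eq_three.1 hw
    cases x
    · have h3 := hω.cubic [] [] rfl false
      have h4 := hω.cubic [] [] rfl true
      simp only [List.nil_append, Bool.not_false, Bool.not_true] at h3 h4
      rw [ht _ (by rfl), ht _ (by rfl)] at h3 h4
      cases y <;> cases z <;> simp [wordParity, wordEval, X0, X1, X2] <;> field_simp
      · refine mul_left_cancel₀ he ?_
        linear_combination h3 + (e ^ 2 - 1) * ω [false, true, true] * hr
      · linear_combination h4
    · rw [ht _ rfl]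
      simp [wordEval, X0]
  | succ m hm ih =>
    intro ω hω ht
    choose t htt using fun z => ih _ (hω.concat z) (fun w hw => by
      simpa using ht (w ++ [z]) (by simp; omega))
    refine exists_parity_extension (t := t) htt fun π => ?_
    obtain ⟨m, rfl⟩ : ∃ m', m = m' + 2 := ⟨m - 2, by omega⟩
    have h3 := eval_last_three htt
    by_cases hm1 : m = 1
    · subst hm1
      rw [X3]
      refine eq_smul_of_linear hgl ?_ (by simp) (by simp)
      cases π
      · have h4 := hω.quartic [] [] rfl false
        simp only [List.nil_append, Bool.not_false] at h4
        rw [ht _ (by rfl), ht _ (by rfl), ht _ (by rfl), ht _ (by rfl)] at h4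
        have h5 := h3 [false] rfl
        simp only [List.cons_append, List.nil_append] at h5
        rw [h5, h5, h5, h5] at h4
        simp [wordParity, wordEval, X0, X1, X2] at h4 ⊢
        refine mul_left_cancel₀ (mul_ne_zero (mul_ne_zero h2 h2) (mul_ne_zero hc hE)) ?_
        linear_combination -h4 - 2 * c * (e ^ 2 - 1) * g * t false false * hr
      · have h4 := hω.cubic [false] [] rfl true
        simp only [Bool.not_true] at h4
        rw [h3 _ rfl, h3 _ rfl, h3 _ rfl, h3 _ rfl] at h4
        simp [wordParity, wordEval, X0, X1, X2] at h4 ⊢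
        refine mul_left_cancel₀ hr0 ?_
        linear_combination h4 + (t true false) * 4 * c ^ 2 * e * hr
    · refine hker m (by omega) _ fun b => ?_
      obtain ⟨w, hw, hp, hne⟩ := exists_wordEval_ne_zero hX hX0 hX1 (m - 2) (xor π b)
      have hl : (false :: w).length = m := by simp; omega
      have h4 := hω.cubic (false :: w) [] (by simp; omega) b
      rw [h3 _ hl, h3 _ hl, h3 _ hl, h3 _ hl, hp] at h4
      refine mul_left_cancel₀ hne ?_
      rw [cubicForm, mul_zero, ← h4]
      cases b <;> cases π <;> simp <;> ring

theorem exists_test_words [IsAlgClosed F] {e c : F} (h : GoodParams e c) (m : ℕ) :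
    ∃ S : Finset (List Bool), S.card ≤ 2 * (m + 1) ∧ (∀ w ∈ S, w.length = m + 1) ∧
      ∀ ω, WordAdmissible e c (m + 1) ω → (∀ w ∈ S, ω w = 0) →
        ∀ w, w.length = m + 1 → ω w = 0 := by
  obtain ⟨X, hX, h0, h1, hev⟩ := exists_start_sequence h
  have step : ∀ m, ∃ T : Finset (List Bool), T.card ≤ 2 ∧ (∀ w ∈ T, w.length = m + 2) ∧
      ∀ ω, WordAdmissible e c (m + 2) ω → (∀ w, w.length = m + 1 → ω (true :: w) = 0) →
        (∀ w ∈ T, ω w = 0) → ∀ w, w.length = m + 2 → ω w = 0 := by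
    intro m
    cases m with
    | zero =>
      refine ⟨{[false, false], [false, true]}, Finset.card_le_two, by simp, ?_⟩
      intro ω _ ht hT w hw
      obtain ⟨a, b, rfl⟩ := List.length_eq_two.1 hw
      cases a
      · cases b
        · exact hT _ (by simp)
        · exact hT _ (by simp)
      · exact ht [b] rfl
    | succ m =>
      choose w hw hp hne using exists_wordEval_ne_zero hX h0 h1 (m + 1)
      refine ⟨{false :: w false, false :: w true}, Finset.card_le_two, by simp [hw], ?_⟩
      intro ω hω ht hT
      obtain ⟨t, ht'⟩ := hev (m + 3) (by omega) ω hω (fun w hw => ht w (by omega))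
      have hb : ∀ b, t b = 0 := by
        intro b
        have h2 := ht' (false :: w b) (by simp [hw])
        rw [hp, hT _ (by cases b <;> simp)] at h2
        exact (mul_eq_zero.1 h2.symm).resolve_right (hne b)
      intro w hw
      rw [ht' w hw, hb, zero_mul]
  induction m with
  | zero =>
    refine ⟨{[false], [true]}, Finset.card_le_two, by simp, ?_⟩
    intro ω _ hS w hw
    obtain ⟨a, rfl⟩ := List.length_eq_one_iff.1 hw
    cases a
    · exact hS _ (by simp)
    · exact hS _ (by simp)
  | succ m ih =>
    obtain ⟨S, hS, hSl, hS'⟩ := ih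
    obtain ⟨T, hT, hTl, hT'⟩ := step m
    refine ⟨S.image (List.cons true) ∪ T, ?_, ?_, ?_⟩
    · have := Finset.card_union_le (S.image (List.cons true)) T
      have := Finset.card_image_le (s := S) (f := List.cons true)
      omega
    · intro w hw
      rcases Finset.mem_union.1 hw with hw | hw
      · obtain ⟨w', hw', rfl⟩ := Finset.mem_image.1 hw
        simp [hSl w' hw']
      · exact hTl w hw
    · intro ω hω h0
      refine hT' ω hω (hS' _ (hω.cons true) fun w hw => ?_) fun w hw => ?_
      · exact h0 _ (Finset.mem_union_left _ (Finset.mem_image_of_mem _ hw))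
      · exact h0 _ (Finset.mem_union_right _ hw)

end WordFunctionals

section WordAlgebra

variable {F A : Type*} [Field F] [Ring A] [Algebra F A]

/-- The combination of the values of a function on words of length three given by the cubic
form attached to the letter `b`. -/
def cubicComb {M : Type*} [AddCommGroup M] [Module F M] (e c : F) (f : Bool → Bool → Bool → M)
    (b : Bool) : M :=
  (e ^ 2 - 1) • (f b (!b) (!b) + f (!b) (!b) b) + (2 * e * c) • f b b b
    + (2 * c) • f (!b) b (!b)

/-- The product of the letter `x` and the cubic form attached to `b`. -/
def leftCubic (e c : F) (a : Bool → Bool → A) (x b : Bool) : A :=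
  cubicComb e c (fun y z w => a x y * a z w) b

/-- The product of the cubic form attached to `b` and the letter `y`. -/
def rightCubic (e c : F) (a : Bool → Bool → A) (b y : Bool) : A :=
  cubicComb e c (fun x z w => a x z * a w y) b

/-- The quadratic relations between the products of two letters. -/
structure WordRel (e c : F) (a : Bool → Bool → A) : Prop where
  left : ∀ b, leftCubic e c a b (!b) = 0
  right : ∀ b, rightCubic e c a b (!b) = 0
  left_eq : leftCubic e c a false false = leftCubic e c a true true
  right_eq : rightCubic e c a false false = rightCubic e c a true true

/-- The first central quadratic element. -/
def centralOne (e c : F) (a : Bool → Bool → A) : A := leftCubic e c a false false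

/-- The second central quadratic element. -/
def centralTwo (e c : F) (a : Bool → Bool → A) : A :=
  (2 * e * c * (4 * c ^ 2 - (e ^ 2 - 1) ^ 2)) •
      (a false false * a false false + a true true * a true true)
    - ((e ^ 2 - 1) * (4 * c ^ 2 * e ^ 2 - (e ^ 2 - 1) ^ 2)) •
      (a false false * a true true + a true true * a false false)
    + (2 * c * (4 * c ^ 2 * e ^ 2 - (e ^ 2 - 1) ^ 2)) •
      (a false true * a false true + a true false * a true false)
    - ((e ^ 2 - 1) * (4 * c ^ 2 - (e ^ 2 - 1) ^ 2)) •
      (a false true * a true false + a true false * a false true)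

variable {e c : F} {a : Bool → Bool → A}

theorem WordRel.leftCubic_eq (h : WordRel e c a) (x b : Bool) :
    leftCubic e c a x b = if x = b then centralOne e c a else 0 := by
  have h1 := h.left true
  have h2 := h.left false
  have h3 := h.left_eq
  cases x <;> cases b <;> simp_all [centralOne]

theorem WordRel.rightCubic_eq (h : WordRel e c a) (h2 : (2 : F) ≠ 0) (b y : Bool) :
    rightCubic e c a b y = if b = y then centralOne e c a else 0 := by
  have key : rightCubic e c a false false = leftCubic e c a false false := by
    have h4 : (2 : F) • (rightCubic e c a false false - leftCubic e c a false false) = 0 := by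
      have h5 : rightCubic e c a false false + rightCubic e c a true true =
          leftCubic e c a false false + leftCubic e c a true true := by
        simp only [rightCubic, leftCubic, cubicComb, Bool.not_false, Bool.not_true]
        module
      rw [← h.right_eq, ← h.left_eq, ← two_smul F, ← two_smul F] at h5
      rw [smul_sub, h5, sub_self]
    exact sub_eq_zero.1 ((smul_eq_zero.1 h4).resolve_left h2)
  have h1 := h.right true
  have h2 := h.right false
  have h3 := h.right_eq
  cases b <;> cases y <;> simp_all [centralOne]

theorem leftCubic_add_comm_diag (b : Bool) :
    a b b * (leftCubic e c a b b + leftCubic e c a (!b) (!b)) -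
        (leftCubic e c a b b + leftCubic e c a (!b) (!b)) * a b b =
      a b b * (rightCubic e c a (!b) (!b) - rightCubic e c a b b)
        - (2 : F) • (a b (!b) * rightCubic e c a (!b) b)
        + (2 : F) • (leftCubic e c a b (!b) * a (!b) b)
        - (leftCubic e c a (!b) (!b) - leftCubic e c a b b) * a b b := by
  simp only [rightCubic, leftCubic, cubicComb, Bool.not_not, mul_add, add_mul, mul_sub, sub_mul,
    smul_mul_assoc, mul_smul_comm, mul_assoc]
  module

theorem leftCubic_add_comm_off (b : Bool) :
    a (!b) b * (leftCubic e c a b b + leftCubic e c a (!b) (!b)) -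
        (leftCubic e c a b b + leftCubic e c a (!b) (!b)) * a (!b) b =
      a (!b) b * (rightCubic e c a (!b) (!b) - rightCubic e c a b b)
        - (2 : F) • (a (!b) (!b) * rightCubic e c a (!b) b)
        + (leftCubic e c a (!b) (!b) - leftCubic e c a b b) * a (!b) b
        + (2 : F) • (leftCubic e c a (!b) b * a b b) := by
  simp only [rightCubic, leftCubic, cubicComb, Bool.not_not, mul_add, add_mul, mul_sub, sub_mul,
    smul_mul_assoc, mul_smul_comm, mul_assoc]
  module

theorem WordRel.centralOne_comm (h : WordRel e c a) (h2 : (2 : F) ≠ 0) (x y : Bool) :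
    a x y * centralOne e c a = centralOne e c a * a x y := by
  have key : (2 : F) • (a x y * centralOne e c a - centralOne e c a * a x y) = 0 := by
    rcases Bool.eq_or_eq_not x y with rfl | rfl
    · have := leftCubic_add_comm_diag (e := e) (c := c) (a := a) x
      simp [h.leftCubic_eq, h.rightCubic_eq h2] at this
      rw [smul_sub, two_smul, two_smul, ← mul_add, ← add_mul, this]
    · have := leftCubic_add_comm_off (e := e) (c := c) (a := a) y
      simp [h.leftCubic_eq, h.rightCubic_eq h2] at this
      rw [smul_sub, two_smul, two_smul, ← mul_add, ← add_mul, this]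
  exact sub_eq_zero.1 ((smul_eq_zero.1 key).resolve_left h2)

/-- The multiples of the cubic forms in the commutator of a letter with the quartic form, after
multiplication by `x` on the left. -/
def leftFiller (e c : F) (a : Bool → Bool → A) (x b : Bool) : A :=
  ((e ^ 2 - 1) ^ 2 + 4 * c ^ 2) • (a x b * leftCubic e c a (!b) (!b)
      - leftCubic e c a x (!b) * a (!b) b)
    + (4 * c * (e ^ 2 - 1)) • (a x (!b) * leftCubic e c a b (!b)
      - leftCubic e c a x (!b) * a b (!b))
    + (4 * c * e * (e ^ 2 - 1)) • (a x (!b) * leftCubic e c a (!b) b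
      - leftCubic e c a x b * a (!b) (!b))
    + ((e ^ 2 - 1) ^ 2 + 4 * e ^ 2 * c ^ 2) • (a x b * leftCubic e c a b b
      - leftCubic e c a x b * a b b)

/-- The multiples of the cubic forms in the commutator of a letter with the quartic form, after
multiplication by `y` on the right. -/
def rightFiller (e c : F) (a : Bool → Bool → A) (b y : Bool) : A :=
  ((e ^ 2 - 1) ^ 2 + 4 * c ^ 2) • (a b (!b) * rightCubic e c a (!b) y
      - rightCubic e c a (!b) (!b) * a b y)
    + (4 * c * (e ^ 2 - 1)) • (a (!b) b * rightCubic e c a (!b) y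
      - rightCubic e c a (!b) b * a (!b) y)
    + (4 * c * e * (e ^ 2 - 1)) • (a (!b) (!b) * rightCubic e c a b y
      - rightCubic e c a b (!b) * a (!b) y)
    + ((e ^ 2 - 1) ^ 2 + 4 * e ^ 2 * c ^ 2) • (a b b * rightCubic e c a b y
      - rightCubic e c a b b * a b y)

/-- The quartic form with the letters `x` and `y` on its two sides. -/
def middleQuartic (e c : F) (a : Bool → Bool → A) (x y : Bool) : A :=
  (2 * e * c * (4 * c ^ 2 - (e ^ 2 - 1) ^ 2)) •
      (a x false * a false false * a false y + a x true * a true true * a true y)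
    - ((e ^ 2 - 1) * (4 * c ^ 2 * e ^ 2 - (e ^ 2 - 1) ^ 2)) •
      (a x false * a false true * a true y + a x true * a true false * a false y)
    + (2 * c * (4 * c ^ 2 * e ^ 2 - (e ^ 2 - 1) ^ 2)) •
      (a x false * a true false * a true y + a x true * a false true * a false y)
    - ((e ^ 2 - 1) * (4 * c ^ 2 - (e ^ 2 - 1) ^ 2)) •
      (a x false * a true true * a false y + a x true * a false false * a true y)

theorem mul_centralTwo_sub (x y : Bool) :
    a x y * centralTwo e c a - middleQuartic e c a x y = leftFiller e c a x y := by
  cases y <;>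
  simp only [leftFiller, middleQuartic, centralTwo, leftCubic, cubicComb, Bool.not_false,
    Bool.not_true, mul_add, add_mul, mul_sub, sub_mul, smul_mul_assoc, mul_smul_comm, mul_assoc] <;>
  module

theorem middleQuartic_sub (x y : Bool) :
    middleQuartic e c a x y - centralTwo e c a * a x y = rightFiller e c a x y := by
  cases x <;>
  simp only [rightFiller, middleQuartic, centralTwo, rightCubic, cubicComb, Bool.not_false,
    Bool.not_true, mul_add, add_mul, mul_sub, sub_mul, smul_mul_assoc, mul_smul_comm, mul_assoc] <;>
  module

theorem WordRel.centralTwo_comm (h : WordRel e c a) (h2 : (2 : F) ≠ 0) (x y : Bool) :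
    a x y * centralTwo e c a = centralTwo e c a * a x y := by
  have h3 := mul_centralTwo_sub (e := e) (c := c) (a := a) x y
  have h4 := middleQuartic_sub (e := e) (c := c) (a := a) x y
  have h5 : a x y * centralTwo e c a - centralTwo e c a * a x y =
      leftFiller e c a x y + rightFiller e c a x y := by
    rw [← h3, ← h4]
    abel
  rw [← sub_eq_zero, h5]
  rcases Bool.eq_or_eq_not x y with rfl | rfl <;>
  simp [leftFiller, rightFiller, h.leftCubic_eq, h.rightCubic_eq h2, h.centralOne_comm h2] <;>
  abel

/-- The span of the products of two letters. -/
def letterSpan (F : Type*) {A : Type*} [Field F] [Ring A] [Algebra F A] (a : Bool → Bool → A) :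
    Submodule F A :=
  Submodule.span F (Set.range fun p : Bool × Bool => a p.1 p.2)

theorem mem_letterSpan (a : Bool → Bool → A) (x y : Bool) : a x y ∈ letterSpan F a :=
  Submodule.subset_span ⟨(x, y), rfl⟩

theorem letterSpan_fg (a : Bool → Bool → A) : (letterSpan F a).FG :=
  Submodule.fg_span (Set.finite_range _)

theorem letterSpan_comm {z : A} (hz : ∀ x y, a x y * z = z * a x y) :
    ∀ v ∈ letterSpan F a, v * z = z * v := by
  intro v hv
  refine Submodule.span_induction ?_ (by simp) ?_ ?_ hv
  · rintro _ ⟨p, rfl⟩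
    exact hz _ _
  · intro x y _ _ hx hy
    rw [add_mul, mul_add, hx, hy]
  · intro t x _ hx
    rw [smul_mul_assoc, mul_smul_comm, hx]

theorem letter_mul_letter_mem (a : Bool → Bool → A) (x y z w : Bool) :
    a x y * a z w ∈ letterSpan F a ^ 2 := by
  rw [pow_two]
  exact Submodule.mul_mem_mul (mem_letterSpan a _ _) (mem_letterSpan a _ _)

theorem centralOne_mem : centralOne e c a ∈ letterSpan F a ^ 2 := by
  have h := letter_mul_letter_mem (F := F) a
  unfold centralOne leftCubic cubicComb
  exact add_mem (add_mem (Submodule.smul_mem _ _ (add_mem (h _ _ _ _) (h _ _ _ _)))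
    (Submodule.smul_mem _ _ (h _ _ _ _))) (Submodule.smul_mem _ _ (h _ _ _ _))

theorem centralTwo_mem : centralTwo e c a ∈ letterSpan F a ^ 2 := by
  have h := letter_mul_letter_mem (F := F) a
  unfold centralTwo
  exact sub_mem (add_mem (sub_mem (Submodule.smul_mem _ _ (add_mem (h _ _ _ _) (h _ _ _ _)))
    (Submodule.smul_mem _ _ (add_mem (h _ _ _ _) (h _ _ _ _))))
    (Submodule.smul_mem _ _ (add_mem (h _ _ _ _) (h _ _ _ _))))
    (Submodule.smul_mem _ _ (add_mem (h _ _ _ _) (h _ _ _ _)))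

theorem isNormalMod_of_comm {V : Submodule F A} {J : ℕ → Submodule F A} {z : A} {d : ℕ}
    (hm : z ∈ V ^ d) (hz : ∀ v ∈ V, v * z = z * v) : IsNormalMod V J z d where
  mem := hm
  left x hx := ⟨x, hx, by rw [hz x hx, sub_self]; exact zero_mem _⟩
  right x hx := ⟨x, hx, by rw [hz x hx, sub_self]; exact zero_mem _⟩

theorem isGradedIdeal_bot (V : Submodule F A) : IsGradedIdeal V fun _ => ⊥ where
  le _ := bot_le
  left _ := by simp
  right _ := by simp

/-- The graded ideal generated by the first central element. -/
def centralIdealOne (e c : F) (a : Bool → Bool → A) : ℕ → Submodule F A :=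
  addNormal (letterSpan F a) (fun _ => ⊥) (centralOne e c a) 2

/-- The graded ideal generated by the two central elements. -/
def centralIdeal (e c : F) (a : Bool → Bool → A) : ℕ → Submodule F A :=
  addNormal (letterSpan F a) (centralIdealOne e c a) (centralTwo e c a) 2

theorem WordRel.isNormalMod_one (h : WordRel e c a) (h2 : (2 : F) ≠ 0)
    (J : ℕ → Submodule F A) : IsNormalMod (letterSpan F a) J (centralOne e c a) 2 :=
  isNormalMod_of_comm centralOne_mem (letterSpan_comm (h.centralOne_comm h2))

theorem WordRel.isNormalMod_two (h : WordRel e c a) (h2 : (2 : F) ≠ 0)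
    (J : ℕ → Submodule F A) : IsNormalMod (letterSpan F a) J (centralTwo e c a) 2 :=
  isNormalMod_of_comm centralTwo_mem (letterSpan_comm (h.centralTwo_comm h2))

theorem WordRel.isGradedIdeal_one (h : WordRel e c a) (h2 : (2 : F) ≠ 0) :
    IsGradedIdeal (letterSpan F a) (centralIdealOne e c a) :=
  addNormal_isGradedIdeal (isGradedIdeal_bot _) (h.isNormalMod_one h2 _)

theorem WordRel.isGradedIdeal (h : WordRel e c a) (h2 : (2 : F) ≠ 0) :
    IsGradedIdeal (letterSpan F a) (centralIdeal e c a) :=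
  addNormal_isGradedIdeal (h.isGradedIdeal_one h2) (h.isNormalMod_two h2 _)

theorem one_mem_pow_zero (V : Submodule F A) : (1 : A) ∈ V ^ 0 := by
  rw [pow_zero]
  exact Submodule.one_le.1 le_rfl

theorem centralOne_mem_centralIdeal : centralOne e c a ∈ centralIdeal e c a 2 :=
  mem_addNormal.2 (Or.inl (mem_addNormal.2 (Or.inr ⟨0, rfl, 1, one_mem_pow_zero _, by simp⟩)))

theorem centralTwo_mem_centralIdeal :
    centralTwo e c a ∈ centralIdeal e c a 2 :=
  mem_addNormal.2 (Or.inr ⟨0, rfl, 1, one_mem_pow_zero _, by simp⟩)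

theorem WordRel.leftCubic_mem (h : WordRel e c a) (x b : Bool) :
    leftCubic e c a x b ∈ centralIdeal e c a 2 := by
  rw [h.leftCubic_eq]
  split_ifs
  exacts [centralOne_mem_centralIdeal, zero_mem _]

theorem WordRel.rightCubic_mem (h : WordRel e c a) (h2 : (2 : F) ≠ 0) (x b : Bool) :
    rightCubic e c a x b ∈ centralIdeal e c a 2 := by
  rw [h.rightCubic_eq h2]
  split_ifs
  exacts [centralOne_mem_centralIdeal, zero_mem _]

theorem WordRel.middleQuartic_mem (h : WordRel e c a) (h2 : (2 : F) ≠ 0) (x y : Bool) :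
    middleQuartic e c a x y ∈ centralIdeal e c a 3 := by
  have hJ := h.isGradedIdeal h2
  have h3 := mul_centralTwo_sub (e := e) (c := c) (a := a) x y
  rw [sub_eq_iff_eq_add] at h3
  have hl : ∀ {u v j}, j ∈ centralIdeal e c a 2 → a u v * j ∈ centralIdeal e c a 3 :=
    fun hj => hJ.left 2 (Submodule.mul_mem_mul (mem_letterSpan a _ _) hj)
  have hr : ∀ {u v j}, j ∈ centralIdeal e c a 2 → j * a u v ∈ centralIdeal e c a 3 :=
    fun hj => hJ.right 2 (Submodule.mul_mem_mul hj (mem_letterSpan a _ _))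
  have h4 : leftFiller e c a x y ∈ centralIdeal e c a 3 := by
    unfold leftFiller
    have hc := h.leftCubic_mem
    exact add_mem (add_mem (add_mem
      (Submodule.smul_mem _ _ (sub_mem (hl (hc _ _)) (hr (hc _ _))))
      (Submodule.smul_mem _ _ (sub_mem (hl (hc _ _)) (hr (hc _ _)))))
      (Submodule.smul_mem _ _ (sub_mem (hl (hc _ _)) (hr (hc _ _)))))
      (Submodule.smul_mem _ _ (sub_mem (hl (hc _ _)) (hr (hc _ _))))
  have h5 : middleQuartic e c a x y = a x y * centralTwo e c a - leftFiller e c a x y := by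
    rw [h3]
    abel
  rw [h5]
  exact sub_mem (hl centralTwo_mem_centralIdeal) h4

/-- The product of the letters of a word of even length, grouped in pairs. -/
def wordProd (a : Bool → Bool → A) : List Bool → A
  | [] => 1
  | [_] => 1
  | x :: y :: w => a x y * wordProd a w

theorem wordProd_append (a : Bool → Bool → A) (n : ℕ) :
    ∀ w s : List Bool, w.length = 2 * n → wordProd a (w ++ s) = wordProd a w * wordProd a s := by
  induction n with
  | zero =>
    intro w s hw
    rw [List.length_eq_zero_iff.1 hw]
    simp [wordProd]
  | succ n ih =>
    intro w s hw
    match w, hw with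
    | x :: y :: w, hw =>
      rw [List.cons_append, List.cons_append, wordProd, wordProd, ih w s (by simp at hw; omega),
        mul_assoc]

theorem wordProd_mem (a : Bool → Bool → A) (n : ℕ) :
    ∀ w : List Bool, w.length = 2 * n → wordProd a w ∈ letterSpan F a ^ n := by
  induction n with
  | zero =>
    intro w hw
    rw [List.length_eq_zero_iff.1 hw]
    exact one_mem_pow_zero _
  | succ n ih =>
    intro w hw
    match w, hw with
    | x :: y :: w, hw =>
      rw [wordProd, pow_succ']
      exact Submodule.mul_mem_mul (mem_letterSpan a _ _) (ih w (by simp at hw; omega))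

theorem letterSpan_pow_le (a : Bool → Bool → A) (n : ℕ) :
    letterSpan F a ^ n ≤ Submodule.span F (wordProd a '' {w | w.length = 2 * n}) := by
  induction n with
  | zero =>
    rw [pow_zero, Submodule.one_eq_span, Submodule.span_le]
    rintro _ rfl
    exact Submodule.subset_span ⟨[], rfl, rfl⟩
  | succ n ih =>
    rw [pow_succ']
    refine (mul_le_mul_right ih _).trans ?_
    rw [letterSpan, Submodule.span_mul_span, Submodule.span_le]
    rintro _ ⟨_, ⟨p, rfl⟩, _, ⟨w, hw, rfl⟩, rfl⟩
    exact Submodule.subset_span ⟨p.1 :: p.2 :: w, by simp at hw ⊢; omega, rfl⟩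

theorem IsGradedIdeal.mul_mul_mem {V : Submodule F A} {J : ℕ → Submodule F A}
    (hJ : IsGradedIdeal V J) {l m n : ℕ} {x y z : A} (hx : x ∈ V ^ l) (hy : y ∈ J m)
    (hz : z ∈ V ^ n) : x * y * z ∈ J (l + m + n) :=
  right_mul_pow_le hJ.right _ _ (Submodule.mul_mem_mul
    (hJ.pow_mul_le _ _ (Submodule.mul_mem_mul hx hy)) hz)

theorem WordRel.wordAdmissible (h : WordRel e c a) (h2 : (2 : F) ≠ 0) (n : ℕ) (φ : A →ₗ[F] F)
    (hφ : ∀ x ∈ centralIdeal e c a n, φ x = 0) :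
    WordAdmissible e c (2 * n) fun w => φ (wordProd a w) where
  cubic p s hps b := by
    have hJ := h.isGradedIdeal h2
    rcases Nat.even_or_odd' p.length with ⟨i, hi | hi⟩
    · obtain ⟨y, s, rfl⟩ : ∃ y s', s = y :: s' := List.exists_cons_of_length_pos (by omega)
      have hl : s.length = 2 * (n - i - 2) := by simp at hps; omega
      have key := hJ.mul_mul_mem (wordProd_mem a i p hi) (h.rightCubic_mem h2 b y)
        (wordProd_mem a _ s hl)
      have h3 := hφ _ (by convert key using 2; simp at hps; omega)
      simp only [wordProd_append a i p _ hi, wordProd]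
      simp only [rightCubic, cubicComb, mul_add, add_mul, sub_mul, smul_mul_assoc,
        mul_smul_comm, mul_assoc, map_add, map_smul, smul_add, smul_eq_mul] at h3 ⊢
      linear_combination h3
    · obtain ⟨p, x, rfl⟩ : ∃ p' x, p = p' ++ [x] := by
        rcases List.eq_nil_or_concat p with rfl | h
        · simp at hi
        · obtain ⟨p', x, h⟩ := h
          exact ⟨p', x, by simpa using h⟩
      have hi' : p.length = 2 * i := by simpa using hi
      have hl : s.length = 2 * (n - i - 2) := by simp at hps; omega
      have key := hJ.mul_mul_mem (wordProd_mem a i p hi') (h.leftCubic_mem x b)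
        (wordProd_mem a _ s hl)
      have h3 := hφ _ (by convert key using 2; simp at hps; omega)
      simp only [List.append_assoc, wordProd_append a i p _ hi', wordProd, List.cons_append,
        List.nil_append]
      simp only [leftCubic, cubicComb, mul_add, add_mul, sub_mul, smul_mul_assoc,
        mul_smul_comm, mul_assoc, map_add, map_smul, smul_add, smul_eq_mul] at h3 ⊢
      linear_combination h3
  quartic p s hps b := by
    have hJ := h.isGradedIdeal h2
    rcases Nat.even_or_odd' p.length with ⟨i, hi | hi⟩
    · have hl : s.length = 2 * (n - i - 2) := by omega
      have key := hJ.mul_mul_mem (wordProd_mem a i p hi)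
        (centralTwo_mem_centralIdeal (e := e) (c := c)) (wordProd_mem a _ s hl)
      have h3 := hφ _ (by convert key using 2; omega)
      simp only [wordProd_append a i p _ hi, wordProd]
      simp only [centralTwo, mul_add, add_mul, mul_sub, sub_mul, smul_mul_assoc,
        mul_smul_comm, mul_assoc, map_add, map_sub, map_smul, smul_add, smul_eq_mul] at h3 ⊢
      cases b <;> simp only [Bool.not_true, Bool.not_false] <;> linear_combination h3
    · obtain ⟨y, s, rfl⟩ : ∃ y s', s = y :: s' := List.exists_cons_of_length_pos (by omega)
      obtain ⟨p, x, rfl⟩ : ∃ p' x, p = p' ++ [x] := by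
        rcases List.eq_nil_or_concat p with rfl | h
        · simp at hi
        · obtain ⟨p', x, h⟩ := h
          exact ⟨p', x, by simpa using h⟩
      have hi' : p.length = 2 * i := by simpa using hi
      have hl : s.length = 2 * (n - i - 3) := by simp at hps; omega
      have key := hJ.mul_mul_mem (wordProd_mem a i p hi') (h.middleQuartic_mem h2 x y)
        (wordProd_mem a _ s hl)
      have h3 := hφ _ (by convert key using 2; simp at hps; omega)
      simp only [List.append_assoc, wordProd_append a i p _ hi', wordProd, List.cons_append,
        List.nil_append]
      simp only [middleQuartic, mul_add, add_mul, mul_sub, sub_mul, smul_mul_assoc,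
        mul_smul_comm, mul_assoc, map_add, map_sub, map_smul, smul_add, smul_eq_mul] at h3 ⊢
      cases b <;> simp only [Bool.not_true, Bool.not_false] <;> linear_combination h3

theorem WordRel.exists_span_sup [IsAlgClosed F] (h : WordRel e c a) (hp : GoodParams e c)
    {n : ℕ} (hn : 0 < n) : ∃ S : Finset A, S.card ≤ 4 * n ∧
      letterSpan F a ^ n ≤ Submodule.span F (S : Set A) ⊔ centralIdeal e c a n := by
  classical
  obtain ⟨S, hcard, hlen, hS⟩ := exists_test_words hp (2 * n - 1)
  refine ⟨S.image (wordProd a), Finset.card_image_le.trans (by omega), ?_⟩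
  refine (letterSpan_pow_le a n).trans ?_
  rw [Submodule.span_le]
  rintro _ ⟨w, hw, rfl⟩
  by_contra hcon
  obtain ⟨φ, hφ, hle⟩ := Submodule.exists_le_ker_of_notMem hcon
  refine hφ (hS (fun w => φ (wordProd a w)) ?_ (fun w hw => ?_) w ?_)
  · rw [show 2 * n - 1 + 1 = 2 * n by omega]
    exact h.wordAdmissible hp.two_ne n φ fun x hx => hle (Submodule.mem_sup_right hx)
  · exact hle (Submodule.mem_sup_left (Submodule.subset_span
      (Finset.mem_coe.2 (Finset.mem_image_of_mem _ hw))))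
  · simp at hw
    omega

/-- A linear map which kills the graded ideal and has a large image is injective modulo it. -/
theorem WordRel.mem_centralIdeal_of_map_eq_zero [IsAlgClosed F] (h : WordRel e c a)
    (hp : GoodParams e c) {M : Type*} [AddCommGroup M] [Module F M] (ψ : A →ₗ[F] M) {n : ℕ}
    (hn : 0 < n) (hψ : ∀ x ∈ centralIdeal e c a n, ψ x = 0)
    (hd : 4 * n ≤ Module.finrank F ((letterSpan F a ^ n).map ψ)) {x : A}
    (hx : x ∈ letterSpan F a ^ n) (h0 : ψ x = 0) : x ∈ centralIdeal e c a n := by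
  obtain ⟨S, hcard, hS⟩ := h.exists_span_sup hp hn
  set D := Submodule.span F (S : Set A) with hD
  have hfin : FiniteDimensional F D := FiniteDimensional.span_finset F S
  have hDle : Module.finrank F D ≤ 4 * n := (finrank_span_finset_le_card S).trans hcard
  have hmap : (letterSpan F a ^ n).map ψ ≤ LinearMap.range (ψ.domRestrict D) := by
    rintro _ ⟨y, hy, rfl⟩
    obtain ⟨d, hd, j, hj, rfl⟩ := Submodule.mem_sup.1 (hS hy)
    exact ⟨⟨d, hd⟩, by simp [hψ j hj]⟩
  have hrank := LinearMap.finrank_range_add_finrank_ker (ψ.domRestrict D)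
  have hker : LinearMap.ker (ψ.domRestrict D) = ⊥ := by
    have := Submodule.finrank_mono hmap
    exact Submodule.finrank_eq_zero.1 (by omega)
  obtain ⟨d, hd, j, hj, rfl⟩ := Submodule.mem_sup.1 (hS hx)
  have h1 : (⟨d, hd⟩ : D) ∈ LinearMap.ker (ψ.domRestrict D) := by
    simpa [hψ j hj] using h0
  rw [hker, Submodule.mem_bot, Submodule.mk_eq_zero] at h1
  rw [h1, zero_add]
  exact hj

theorem WordRel.finrank_map_le [IsAlgClosed F] (h : WordRel e c a)
    (hp : GoodParams e c) {M : Type*} [AddCommGroup M] [Module F M] (ψ : A →ₗ[F] M) {n : ℕ}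
    (hn : 0 < n) (hψ : ∀ x ∈ centralIdeal e c a n, ψ x = 0) :
    Module.finrank F ((letterSpan F a ^ n).map ψ) ≤ 4 * n := by
  obtain ⟨S, hcard, hS⟩ := h.exists_span_sup hp hn
  have hfin : FiniteDimensional F (Submodule.span F (S : Set A)) :=
    FiniteDimensional.span_finset F S
  have hmap : (letterSpan F a ^ n).map ψ ≤ (Submodule.span F (S : Set A)).map ψ := by
    rintro _ ⟨y, hy, rfl⟩
    obtain ⟨d, hd, j, hj, rfl⟩ := Submodule.mem_sup.1 (hS hy)
    exact ⟨d, hd, by simp [hψ j hj]⟩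
  exact (Submodule.finrank_mono hmap).trans ((Submodule.finrank_map_le ψ _).trans
    ((finrank_span_finset_le_card S).trans hcard))

end WordAlgebra

theorem exists_eventually_eq_of_step {D : ℕ → ℕ} {r : ℕ} (h1 : ∀ n, r < n → D n + 4 ≤ D (n + 1))
    (h2 : ∀ n, 0 < n → D n ≤ 4 * n) : ∃ N, r < N ∧ ∀ n, N ≤ n → D (n + 1) ≤ D n + 4 := by
  classical
  have hex : ∃ m, ∃ n, r < n ∧ 4 * n - D n = m := ⟨_, r + 1, by omega, rfl⟩
  obtain ⟨N, hN, hm⟩ := Nat.find_spec hex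
  refine ⟨N, hN, fun n hn => ?_⟩
  have hle : 4 * n - D n ≤ Nat.find hex := by
    induction n, hn using Nat.le_induction with
    | base => exact hm.le
    | succ n hn ih =>
      have := h1 n (by omega)
      omega
  have hge := Nat.find_min' hex ⟨n + 1, by omega, rfl⟩
  have h3 := h2 (n + 1) (by omega)
  have h4 := h2 n (by omega)
  omega

section CurveEvaluation

variable {F A K : Type*} [Field F] [Ring A] [Algebra F A] [Field K] [Algebra F K]

/-- The value of a letter at the point `t` of the affine line. -/
def letterVal (t : K) : Bool → K
  | false => t
  | true => 1

/-- Compatible evaluations of the words along the orbit `x`, one for each starting point. -/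
structure IsWordEval (a : Bool → Bool → A) (x : ℤ → K) (ev : ℤ → A →ₗ[F] K) : Prop where
  one : ∀ t, ev t 1 = 1
  letter_mul : ∀ t p q b, ev t (a p q * b) =
    letterVal (x (2 * t)) p * letterVal (x (2 * t + 1)) q * ev (t + 1) b

variable {a : Bool → Bool → A} {x : ℤ → K} {ev : ℤ → A →ₗ[F] K}

theorem IsWordEval.letter (h : IsWordEval a x ev) (t : ℤ) (p q : Bool) :
    ev t (a p q) = letterVal (x (2 * t)) p * letterVal (x (2 * t + 1)) q := by
  have := h.letter_mul t p q 1
  rwa [mul_one, h.one, mul_one] at this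

theorem IsWordEval.mul_of_mem (h : IsWordEval a x ev) (t : ℤ) {v : A} (hv : v ∈ letterSpan F a)
    (b : A) : ev t (v * b) = ev t v * ev (t + 1) b := by
  refine Submodule.span_induction ?_ (by simp) ?_ ?_ hv
  · rintro _ ⟨p, rfl⟩
    rw [h.letter_mul, h.letter]
  · intro y z _ _ hy hz
    rw [add_mul, map_add, hy, hz, map_add, add_mul]
  · intro r y _ hy
    rw [smul_mul_assoc, map_smul, hy, map_smul, smul_mul_assoc]

theorem IsWordEval.mul (h : IsWordEval a x ev) (n : ℕ) : ∀ (t : ℤ) {v : A}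
    (_ : v ∈ letterSpan F a ^ n) (b : A), ev t (v * b) = ev t v * ev (t + n) b := by
  induction n with
  | zero =>
    intro t v hv b
    rw [pow_zero] at hv
    obtain ⟨r, rfl⟩ := Submodule.mem_one.1 hv
    simp [Algebra.algebraMap_eq_smul_one, h.one]
  | succ n ih =>
    intro t v hv b
    rw [pow_succ'] at hv
    refine Submodule.mul_induction_on hv (fun y hy z hz => ?_) fun y z hy hz => ?_
    · rw [mul_assoc, h.mul_of_mem t hy, h.mul_of_mem t hy, ih (t + 1) hz, mul_assoc]
      push_cast
      rw [add_assoc t, add_comm 1]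
    · rw [add_mul, map_add, hy, hz, map_add, add_mul]

theorem IsWordEval.map_mul (h : IsWordEval a x ev) (t : ℤ) {n : ℕ} {I : Submodule F A}
    (hI : I ≤ letterSpan F a ^ n) : (I * letterSpan F a).map (ev t) =
      adjoinStep (x (2 * t + 2 * n + 1)) (adjoinStep (x (2 * t + 2 * n)) (I.map (ev t))) := by
  have hval : ∀ b ∈ I, ∀ p q, ev t (b * a p q) = letterVal (x (2 * t + 2 * n)) p *
      letterVal (x (2 * t + 2 * n + 1)) q * ev t b := by
    intro b hb p q
    rw [h.mul n t (hI hb), h.letter, mul_comm, mul_add]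
  have hmem : ∀ b ∈ I, ∀ p q, letterVal (x (2 * t + 2 * n)) p *
      letterVal (x (2 * t + 2 * n + 1)) q * ev t b ∈ (I * letterSpan F a).map (ev t) :=
    fun b hb p q => ⟨b * a p q, Submodule.mul_mem_mul hb (mem_letterSpan a p q), hval b hb p q⟩
  apply le_antisymm
  · rw [Submodule.map_le_iff_le_comap, Submodule.mul_le]
    intro b hb v hv
    refine Submodule.span_induction ?_ (by simp) ?_ ?_ hv
    · rintro _ ⟨⟨p, q⟩, rfl⟩
      rw [Submodule.mem_comap, hval b hb]
      have h1 : ev t b ∈ I.map (ev t) := ⟨b, hb, rfl⟩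
      have h2 : letterVal (x (2 * t + 2 * n)) p * ev t b ∈
          adjoinStep (x (2 * t + 2 * n)) (I.map (ev t)) := by
        cases p
        · exact mul_mem_adjoinStep _ h1
        · simpa [letterVal] using le_adjoinStep _ _ h1
      rw [mul_comm (letterVal _ p), mul_assoc]
      cases q
      · exact mul_mem_adjoinStep _ h2
      · simpa [letterVal] using le_adjoinStep _ _ h2
    · intro y z _ _ hy hz
      rw [mul_add]
      exact add_mem hy hz
    · intro r y _ hy
      rw [mul_smul_comm]
      exact Submodule.smul_mem _ _ hy
  · refine sup_le (sup_le ?_ ?_) ?_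
    · rintro _ ⟨b, hb, rfl⟩
      simpa [letterVal] using hmem b hb true true
    · rintro _ ⟨_, ⟨b, hb, rfl⟩, rfl⟩
      simpa [letterVal] using hmem b hb false true
    · rw [adjoinStep, Submodule.map_sup]
      refine sup_le ?_ ?_
      · rintro _ ⟨_, ⟨b, hb, rfl⟩, rfl⟩
        simpa [letterVal] using hmem b hb true false
      · rintro _ ⟨_, ⟨_, ⟨b, hb, rfl⟩, rfl⟩, rfl⟩
        simpa [letterVal, mul_comm, mul_assoc, mul_left_comm] using hmem b hb false false

theorem IsWordEval.window_le (h : IsWordEval a x ev) (t : ℤ) (n : ℕ) :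
    window F x (2 * t) (2 * n) ≤ (letterSpan F a ^ n).map (ev t) := by
  induction n with
  | zero =>
    rw [mul_zero, window, Submodule.one_eq_span, Submodule.span_le]
    rintro _ rfl
    exact ⟨1, one_mem_pow_zero _, h.one t⟩
  | succ n ih =>
    rw [pow_succ, h.map_mul t le_rfl, mul_add, mul_one, window, window]
    push_cast
    rw [← add_assoc]
    exact adjoinStep_mono _ (adjoinStep_mono _ ih)

instance map_finite (V : Submodule F A) [FiniteDimensional F V] {M : Type*} [AddCommGroup M]
    [Module F M] (ψ : A →ₗ[F] M) : FiniteDimensional F (V.map ψ) := inferInstance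

instance letterSpan_pow_finite (a : Bool → Bool → A) (n : ℕ) :
    FiniteDimensional F (letterSpan F a ^ n : Submodule F A) :=
  Module.Finite.iff_fg.2 ((letterSpan_fg a).pow n)

section Orbit

variable {e c : F}

theorem CurveOrbit.ne_zero (hx : CurveOrbit F (algebraMap F K e) (algebraMap F K c) x) (j : ℤ) :
    x j ≠ 0 := fun h => hx.transc j (h ▸ isAlgebraic_zero)

theorem PolyIndep.add_mul_mul_ne_zero {y z : K} (h : PolyIndep F y 1 z) {r s : F} (hr : r ≠ 0) :
    algebraMap F K r + algebraMap F K s * y * z ≠ 0 := by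
  intro h0
  have := (h (Polynomial.C r) (Polynomial.C s * Polynomial.X) (by simpa using h0)).1
  exact hr (by simpa using this)

theorem quartic_certificate {e c x₀ p q x₃ : K}
    (hD : (e ^ 2 - 1) + 2 * e * c * p * q ≠ 0)
    (h₀ : (e ^ 2 - 1) * (x₀ + q) + 2 * e * c * x₀ * p * q + 2 * c * p = 0)
    (h₃ : (e ^ 2 - 1) * (p + x₃) + 2 * e * c * p * q * x₃ + 2 * c * q = 0)
    (h : e * p ^ 2 * q ^ 2 - p ^ 2 - q ^ 2 + 2 * c * p * q + e = 0) :
    2 * e * c * (4 * c ^ 2 - (e ^ 2 - 1) ^ 2) * (x₀ * p * q * x₃ + 1)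
      - (e ^ 2 - 1) * (4 * c ^ 2 * e ^ 2 - (e ^ 2 - 1) ^ 2) * (x₀ * p + q * x₃)
      + 2 * c * (4 * c ^ 2 * e ^ 2 - (e ^ 2 - 1) ^ 2) * (x₀ * q + p * x₃)
      - (e ^ 2 - 1) * (4 * c ^ 2 - (e ^ 2 - 1) ^ 2) * (x₀ * x₃ + p * q) = 0 := by
  obtain ⟨D, hDe⟩ : ∃ D, D = (e ^ 2 - 1) + 2 * e * c * p * q := ⟨_, rfl⟩
  rw [← hDe] at hD
  have h4 : x₀ * D = -((e ^ 2 - 1) * q + 2 * c * p) := by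
    rw [hDe]
    linear_combination h₀
  have h5 : x₃ * D = -((e ^ 2 - 1) * p + 2 * c * q) := by
    rw [hDe]
    linear_combination h₃
  refine (mul_eq_zero.1 (?_ : D ^ 2 * _ = 0)).resolve_left (pow_ne_zero 2 hD)
  calc _ = 2 * e * c * (4 * c ^ 2 - (e ^ 2 - 1) ^ 2) * ((x₀ * D) * p * q * (x₃ * D) + D ^ 2)
      - (e ^ 2 - 1) * (4 * c ^ 2 * e ^ 2 - (e ^ 2 - 1) ^ 2) *
        ((x₀ * D) * p * D + q * (x₃ * D) * D)
      + 2 * c * (4 * c ^ 2 * e ^ 2 - (e ^ 2 - 1) ^ 2) * ((x₀ * D) * q * D + p * (x₃ * D) * D)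
      - (e ^ 2 - 1) * (4 * c ^ 2 - (e ^ 2 - 1) ^ 2) * ((x₀ * D) * (x₃ * D) + p * q * D ^ 2) := by
        ring
    _ = 0 := by
      rw [h4, h5, hDe]
      linear_combination (4*p*q*e^7*c^2 - 12*p*q*e^5*c^2 - 16*p*q*e^3*c^4 + 12*p*q*e^3*c^2
        + 16*p*q*e*c^4 - 4*p*q*e*c^2 - 2*e^8*c + 8*e^6*c + 8*e^4*c^3 - 12*e^4*c - 16*e^2*c^3
        + 8*e^2*c + 8*c^3 - 2*c) * h

variable (hx : CurveOrbit F (algebraMap F K e) (algebraMap F K c) x)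

include hx

theorem CurveOrbit.quartic (hp : GoodParams e c) (j : ℤ) :
    2 * algebraMap F K e * algebraMap F K c *
        (4 * algebraMap F K c ^ 2 - (algebraMap F K e ^ 2 - 1) ^ 2) *
        (x j * x (j + 1) * x (j + 2) * x (j + 3) + 1)
      - (algebraMap F K e ^ 2 - 1) *
        (4 * algebraMap F K c ^ 2 * algebraMap F K e ^ 2 - (algebraMap F K e ^ 2 - 1) ^ 2) *
        (x j * x (j + 1) + x (j + 2) * x (j + 3))
      + 2 * algebraMap F K c *
        (4 * algebraMap F K c ^ 2 * algebraMap F K e ^ 2 - (algebraMap F K e ^ 2 - 1) ^ 2) *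
        (x j * x (j + 2) + x (j + 1) * x (j + 3))
      - (algebraMap F K e ^ 2 - 1) * (4 * algebraMap F K c ^ 2 - (algebraMap F K e ^ 2 - 1) ^ 2) *
        (x j * x (j + 3) + x (j + 1) * x (j + 2)) = 0 := by
  refine quartic_certificate ?_ (hx.rel₁ j) ?_ ?_
  · have := (hx.indep (j + 1)).add_mul_mul_ne_zero (sub_ne_zero.2 hp.sq_ne) (s := 2 * e * c)
    simpa [add_assoc, map_ofNat] using this
  · have := hx.rel₁ (j + 1)
    rw [show j + 1 + 1 = j + 2 by ring, show j + 1 + 2 = j + 3 by ring] at this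
    exact this
  · have := hx.curve (j + 1)
    rw [show j + 1 + 1 = j + 2 by ring] at this
    exact this

theorem CurveOrbit.eval_centralOne (hev : IsWordEval a x ev) (t : ℤ) :
    ev t (centralOne e c a) = 0 := by
  have h := hx.rel₁ (2 * t + 1)
  simp only [centralOne, leftCubic, cubicComb, Bool.not_false, map_add, map_smul,
    hev.letter_mul, hev.letter, letterVal]
  simp only [Algebra.smul_def, map_sub, map_mul, map_pow, map_one, map_ofNat]
  rw [show 2 * (t + 1) = 2 * t + 1 + 1 by ring, show 2 * t + 1 + 1 + 1 = 2 * t + 1 + 2 by ring]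
  linear_combination x (2 * t) * h

theorem CurveOrbit.eval_centralTwo (hp : GoodParams e c) (hev : IsWordEval a x ev) (t : ℤ) :
    ev t (centralTwo e c a) = 0 := by
  have h := hx.quartic hp (2 * t)
  simp only [centralTwo, map_add, map_sub, map_smul,
    hev.letter_mul, hev.letter, letterVal]
  simp only [Algebra.smul_def, map_sub, map_mul, map_pow, map_one, map_ofNat]
  rw [show 2 * (t + 1) = 2 * t + 2 by ring, show 2 * t + 2 + 1 = 2 * t + 3 by ring]
  linear_combination h

theorem CurveOrbit.eval_centralIdeal (hp : GoodParams e c) (hev : IsWordEval a x ev) (t : ℤ)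
    {n : ℕ} {b : A} (hb : b ∈ centralIdeal e c a n) : ev t b = 0 := by
  have h1 : ∀ m (b : A), b ∈ centralIdealOne e c a m → ev t b = 0 := by
    intro m b hb
    rcases mem_addNormal.1 hb with h | ⟨m, -, y, hy, h⟩
    · rw [(Submodule.mem_bot F).1 h, map_zero]
    · rw [sub_eq_zero.1 ((Submodule.mem_bot F).1 h), hev.mul m t hy, hx.eval_centralOne hev,
        mul_zero]
  rcases mem_addNormal.1 hb with h | ⟨m, -, y, hy, h⟩
  · exact h1 n b h
  · rw [← sub_add_cancel b (y * centralTwo e c a), map_add, h1 n _ h, hev.mul m t hy,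
      hx.eval_centralTwo hp hev, mul_zero, add_zero]

theorem CurveOrbit.le_finrank_map (hev : IsWordEval a x ev) (t : ℤ) (n : ℕ) :
    4 * n ≤ Module.finrank F ((letterSpan F a ^ n).map (ev t)) := by
  have h := finrank_window hx.indep' hx.ne_zero hx.transc (2 * t) (2 * n)
  have := Submodule.finrank_mono (hev.window_le t n)
  omega

theorem CurveOrbit.mem_centralIdeal_iff [IsAlgClosed F] (h : WordRel e c a)
    (hp : GoodParams e c) (hev : IsWordEval a x ev) (t : ℤ) {n : ℕ} {b : A}
    (hb : b ∈ letterSpan F a ^ n) : b ∈ centralIdeal e c a n ↔ ev t b = 0 := by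
  refine ⟨hx.eval_centralIdeal hp hev t, fun h0 => ?_⟩
  rcases Nat.eq_zero_or_pos n with rfl | hn
  · rw [pow_zero] at hb
    obtain ⟨r, rfl⟩ := Submodule.mem_one.1 hb
    rw [Algebra.algebraMap_eq_smul_one, map_smul, hev.one, Algebra.smul_def, mul_one] at h0
    rw [(map_eq_zero (algebraMap F K)).1 h0, map_zero]
    exact zero_mem _
  · exact h.mem_centralIdeal_of_map_eq_zero hp (ev t) hn
      (fun _ => hx.eval_centralIdeal hp hev t) (hx.le_finrank_map hev t n) hb h0

theorem CurveOrbit.finrank_map_add_le (hev : IsWordEval a x ev) {I : ℕ → Submodule F A}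
    (hI : ∀ n, I n * letterSpan F a ≤ I (n + 1)) (hIV : ∀ n, I n ≤ letterSpan F a ^ n)
    {r : ℕ} {f : A} (hf : f ∈ I r) (hf0 : ev 0 f ≠ 0) {n : ℕ} (hn : r < n) :
    Module.finrank F ((I n).map (ev 0)) + 4 ≤
      Module.finrank F ((I n * letterSpan F a).map (ev 0)) := by
  obtain ⟨i, rfl⟩ : ∃ i, n = i + 1 := ⟨n - 1, by omega⟩
  have hstep : ∀ i : ℕ, adjoinStep (x (2 * i + 1)) (adjoinStep (x (2 * i)) ((I i).map (ev 0))) ≤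
      (I (i + 1)).map (ev 0) := by
    intro i
    have h1 := hev.map_mul 0 (hIV i)
    simp only [mul_zero, zero_add] at h1
    rw [← h1]
    exact Submodule.map_mono (hI i)
  have hmem : ∀ j, r ≤ j → ev 0 f ∈ (I j).map (ev 0) := by
    intro j hj
    induction j, hj using Nat.le_induction with
    | base => exact ⟨f, hf, rfl⟩
    | succ j _ ih => exact hstep j (le_adjoinStep _ _ (le_adjoinStep _ _ ih))
  have h1 := hev.map_mul 0 (hIV (i + 1))
  push_cast at h1
  simp only [zero_add] at h1
  rw [h1, show (2 * ((i : ℤ) + 1)) = 2 * i + 1 + 1 by ring]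
  have hfi := hmem i (by omega)
  have hf1 := hmem (i + 1) (by omega)
  have hf2 : ev 0 f * x (2 * i + 1) ∈ (I (i + 1)).map (ev 0) := by
    rw [mul_comm (ev 0 f)]
    exact hstep i (mul_mem_adjoinStep _ (le_adjoinStep _ _ hfi))
  have hf3 : ev 0 f * x (2 * i + 1 + 1) ∈
      adjoinStep (x (2 * i + 1 + 1)) ((I (i + 1)).map (ev 0)) := by
    rw [mul_comm (ev 0 f)]
    exact mul_mem_adjoinStep _ hf1
  have hfin : FiniteDimensional F (I (i + 1)) := Submodule.finiteDimensional_of_le (hIV (i + 1))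
  have h2 := finrank_adjoinStep_ge (hx.ne_zero _) ((hx.indep' (2 * i + 1)).mul_left hf0)
    (by rwa [mul_one]) hf2
  have h3 := finrank_adjoinStep_ge (hx.ne_zero _) ((hx.indep' (2 * i + 1 + 1)).mul_left hf0)
    (by rw [mul_one]; exact le_adjoinStep _ _ hf1) hf3
  omega

theorem CurveOrbit.rightGN_centralIdeal [IsAlgClosed F] (h : WordRel e c a)
    (hp : GoodParams e c) (hev : IsWordEval a x ev) :
    RightGN (letterSpan F a) (centralIdeal e c a) := by
  intro I hJI hIV hI
  by_cases hle : ∀ n, I n ≤ centralIdeal e c a n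
  · exact ⟨0, fun n _ => (hle _).trans le_sup_right⟩
  push Not at hle
  obtain ⟨r, hr⟩ := hle
  obtain ⟨f, hf, hfJ⟩ := SetLike.not_le_iff_exists.1 hr
  have hf0 : ev 0 f ≠ 0 := fun h0 => hfJ ((hx.mem_centralIdeal_iff h hp hev 0 (hIV r hf)).2 h0)
  have hfin : ∀ n, FiniteDimensional F (I n) := fun n => Submodule.finiteDimensional_of_le (hIV n)
  have hD := fun n (hn : r < n) => hx.finrank_map_add_le hev hI hIV hf hf0 hn
  have hmap : ∀ n, (I n * letterSpan F a).map (ev 0) ≤ (I (n + 1)).map (ev 0) :=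
    fun n => Submodule.map_mono (hI n)
  obtain ⟨N, hrN, hN⟩ := exists_eventually_eq_of_step
    (D := fun n => Module.finrank F ((I n).map (ev 0))) (r := r)
    (fun n hn => (hD n hn).trans (Submodule.finrank_mono (hmap n)))
    (fun n hn => (Submodule.finrank_mono (Submodule.map_mono (hIV n))).trans
      (h.finrank_map_le hp (ev 0) hn fun _ => hx.eval_centralIdeal hp hev 0))
  refine ⟨N, fun n hn b hb => ?_⟩
  have heq := Submodule.eq_of_le_of_finrank_le (hmap n)
    ((hN n hn).trans (hD n (by omega)))
  have hb' : ev 0 b ∈ (I n * letterSpan F a).map (ev 0) := by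
    rw [heq]
    exact ⟨b, hb, rfl⟩
  obtain ⟨y, hy, hyb⟩ := hb'
  rw [← add_sub_cancel y b]
  refine Submodule.add_mem_sup hy ?_
  rw [hx.mem_centralIdeal_iff h hp hev 0 (sub_mem (hIV _ hb) (hIV _ (hI n hy))), map_sub, hyb,
    sub_self]

end Orbit

end CurveEvaluation

section PairForms

variable {K : Type*} [Field K]

/-- The value of the first cubic form at three points. -/
def cubicVal₁ (e c x y z : K) : K := (e ^ 2 - 1) * (x + z) + 2 * e * c * x * y * z + 2 * c * y

/-- The value of the second cubic form at three points. -/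
def cubicVal₂ (e c x y z : K) : K :=
  (e ^ 2 - 1) * (x * y + y * z) + 2 * e * c + 2 * c * x * z

/-- The value of the quartic form at four points. -/
def quarticVal (e c x₀ x₁ x₂ x₃ : K) : K :=
  2 * e * c * (4 * c ^ 2 - (e ^ 2 - 1) ^ 2) * (x₀ * x₁ * x₂ * x₃ + 1)
    - (e ^ 2 - 1) * (4 * c ^ 2 * e ^ 2 - (e ^ 2 - 1) ^ 2) * (x₀ * x₁ + x₂ * x₃)
    + 2 * c * (4 * c ^ 2 * e ^ 2 - (e ^ 2 - 1) ^ 2) * (x₀ * x₂ + x₁ * x₃)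
    - (e ^ 2 - 1) * (4 * c ^ 2 - (e ^ 2 - 1) ^ 2) * (x₀ * x₃ + x₁ * x₂)

/-- The symmetric form of bidegree `(1, 1)` in two points `(p, q)` and `(P, Q)` of the curve. -/
def pairForm (e c p q P Q : K) : K :=
  4 * c * e * (e ^ 2 - 1) * (1 + p * q * P * Q)
    + ((e ^ 2 - 1) ^ 2 + 4 * e ^ 2 * c ^ 2) * (p * q + P * Q)
    - 4 * c * (e ^ 2 - 1) * (p * P + q * Q)
    - ((e ^ 2 - 1) ^ 2 + 4 * c ^ 2) * (p * Q + q * P)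

variable {e c p q w S P Q : K}

theorem cubicVal₂_of_next {x y z u : K} (h₁ : cubicVal₁ e c y z u = 0)
    (h₂ : cubicVal₂ e c y z u = 0) : cubicVal₂ e c x y z = -u * cubicVal₁ e c x y z := by
  simp only [cubicVal₁, cubicVal₂] at *
  linear_combination x * h₁ + h₂

theorem cubicVal₂_of_prev {x y z u : K} (h₁ : cubicVal₁ e c u x y = 0)
    (h₂ : cubicVal₂ e c u x y = 0) : cubicVal₂ e c x y z = -u * cubicVal₁ e c x y z := by
  simp only [cubicVal₁, cubicVal₂] at *
  linear_combination z * h₁ + h₂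

theorem cubicVal₁_mul_sub (h₁ : cubicVal₁ e c p q w = 0) (h₂ : cubicVal₂ e c p q w = 0)
    (h₃ : cubicVal₁ e c S P Q = 0) (h₄ : cubicVal₂ e c S P Q = 0) :
    cubicVal₁ e c w S P * (q - Q) + cubicVal₁ e c q w S * (p - P) = 0 := by
  simp only [cubicVal₁, cubicVal₂] at *
  linear_combination h₂ - h₄ + S * h₁ - w * h₃

theorem sub_mul_quarticVal (hp : (e ^ 2 - 1) + 2 * e * c * p * q ≠ 0)
    (hP : (e ^ 2 - 1) + 2 * e * c * P * Q ≠ 0) (h₁ : cubicVal₁ e c p q w = 0)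
    (h₂ : cubicVal₁ e c S P Q = 0)
    (h₃ : e * p ^ 2 * q ^ 2 - p ^ 2 - q ^ 2 + 2 * c * p * q + e = 0)
    (h₄ : e * P ^ 2 * Q ^ 2 - P ^ 2 - Q ^ 2 + 2 * c * P * Q + e = 0) :
    (p - P) * quarticVal e c q w S P = cubicVal₁ e c w S P * pairForm e c p q P Q := by
  have hw : w = -((e ^ 2 - 1) * p + 2 * c * q) / ((e ^ 2 - 1) + 2 * e * c * p * q) := by
    rw [eq_div_iff hp]
    unfold cubicVal₁ at h₁
    linear_combination h₁
  have hS : S = -((e ^ 2 - 1) * Q + 2 * c * P) / ((e ^ 2 - 1) + 2 * e * c * P * Q) := by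
    rw [eq_div_iff hP]
    unfold cubicVal₁ at h₂
    linear_combination h₂
  clear h₁ h₂
  set X := (e ^ 2 - 1) + 2 * e * c * p * q with hX
  set Y := (e ^ 2 - 1) + 2 * e * c * P * Q with hY
  subst hw hS
  unfold quarticVal cubicVal₁ pairForm
  field_simp
  rw [hX, hY]
  linear_combination
    (-16 * P ^ 3 * Q ^ 2 * c ^ 3 * (e ^ 2 - 1) ^ 2 * e ^ 2
      - 16 * P ^ 2 * Q * c ^ 4 * (e ^ 2 - 1) ^ 2 * e - 8 * P ^ 2 * Q * c ^ 2 * (e ^ 2 - 1) ^ 3 * e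
      + 16 * P * Q ^ 2 * c ^ 3 * (e ^ 2 - 1) ^ 2 * e - 8 * P * c ^ 3 * (e ^ 2 - 1) ^ 3
      + 8 * Q * c ^ 2 * (e ^ 2 - 1) ^ 3) * h₃ +
    (16 * p ^ 2 * q * c ^ 4 * (e ^ 2 - 1) * e + 4 * p ^ 2 * q * c ^ 2 * (e ^ 2 - 1) ^ 3 * e
      - 16 * p ^ 2 * P * c ^ 3 * (e ^ 2 - 1) ^ 2 * e + 16 * p * q ^ 2 * c ^ 3 * (e ^ 2 - 1) ^ 2 * e
      + (16 * e ^ 3 - 32 * e) * p * q * P * c ^ 4 * (e ^ 2 - 1)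
      - 12 * p * q * P * c ^ 2 * (e ^ 2 - 1) ^ 3 * e + 8 * p * c ^ 3 * (e ^ 2 - 1) ^ 2
      + 2 * p * c * (e ^ 2 - 1) ^ 4 - 16 * q ^ 2 * P * c ^ 3 * (e ^ 2 - 1) ^ 2 * e
      + 8 * q * c ^ 2 * (e ^ 2 - 1) ^ 3 + 8 * P * c ^ 3 * (e ^ 2 - 1) ^ 2 * e ^ 2
      - 2 * P * c * (e ^ 2 - 1) ^ 4) * h₄

end PairForms

section PairOperators

/-- Two sequences of points on the curve, in general position with respect to each other. -/
structure OrbitPair {L : Type*} [Field L] (e c : L) (X Y : ℤ → L) : Prop where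
  rel₁_fst : ∀ j, cubicVal₁ e c (X j) (X (j + 1)) (X (j + 2)) = 0
  rel₂_fst : ∀ j, cubicVal₂ e c (X j) (X (j + 1)) (X (j + 2)) = 0
  rel₁_snd : ∀ j, cubicVal₁ e c (Y j) (Y (j + 1)) (Y (j + 2)) = 0
  rel₂_snd : ∀ j, cubicVal₂ e c (Y j) (Y (j + 1)) (Y (j + 2)) = 0
  curve_fst : ∀ j, e * X j ^ 2 * X (j + 1) ^ 2 - X j ^ 2 - X (j + 1) ^ 2
    + 2 * c * X j * X (j + 1) + e = 0
  curve_snd : ∀ j, e * Y j ^ 2 * Y (j + 1) ^ 2 - Y j ^ 2 - Y (j + 1) ^ 2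
    + 2 * c * Y j * Y (j + 1) + e = 0
  den_fst : ∀ j, (e ^ 2 - 1) + 2 * e * c * X j * X (j + 1) ≠ 0
  den_snd : ∀ j, (e ^ 2 - 1) + 2 * e * c * Y j * Y (j + 1) ≠ 0
  sub_ne : ∀ i j, X i - Y j ≠ 0
  fst_ne : ∀ i j, cubicVal₁ e c (X i) (Y j) (Y (j + 1)) ≠ 0
  snd_ne : ∀ i j, cubicVal₁ e c (Y i) (X j) (X (j + 1)) ≠ 0

variable {F L : Type*} [Field F] [Field L] [Algebra F L]

/-- The mixed value of the first cubic form met when stepping along the first sequence first. -/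
def mixFst (e c : L) (X Y : ℤ → L) (t : ℤ) : L :=
  cubicVal₁ e c (X (2 * t + 1)) (Y (-2 * t - 2)) (Y (-2 * t - 1))

/-- The mixed value of the first cubic form met when stepping along the second sequence first. -/
def mixSnd (e c : L) (X Y : ℤ → L) (t : ℤ) : L :=
  cubicVal₁ e c (Y (-2 * t + 1)) (X (2 * t - 2)) (X (2 * t - 1))

/-- The weights making the operators attached to a pair of sequences satisfy the quadratic
relations. -/
def pairWeight (e c : L) (X Y : ℤ → L) : ℕ → ℤ → L
  | 0, _ => 1
  | j + 1, t => -(pairWeight e c X Y j (t + 1) * mixFst e c X Y (t + 1)) / mixSnd e c X Y (t + 1)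

/-- The letters acting on functions of a position `t` and a number `j` of steps along the second
sequence. -/
def pairOp (F : Type*) [Field F] [Algebra F L] (e c : L) (X Y : ℤ → L) (p q : Bool) :
    Module.End F (ℤ → ℕ → L) where
  toFun f t j := pairWeight e c X Y j t *
      (letterVal (X (2 * t)) p * letterVal (X (2 * t + 1)) q) * f (t + 1) j
    + letterVal (Y (-2 * t)) p * letterVal (Y (-2 * t + 1)) q * f (t - 1) (j + 1)
  map_add' f g := by
    ext t j
    simp only [Pi.add_apply]
    ring
  map_smul' r f := by
    ext t j
    simp only [Pi.smul_apply, mul_smul_comm, smul_add, RingHom.id_apply]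

variable {e c : L} {X Y : ℤ → L}

theorem pairOp_apply (p q : Bool) (f : ℤ → ℕ → L) (t : ℤ) (j : ℕ) :
    pairOp F e c X Y p q f t j = pairWeight e c X Y j t *
      (letterVal (X (2 * t)) p * letterVal (X (2 * t + 1)) q) * f (t + 1) j
    + letterVal (Y (-2 * t)) p * letterVal (Y (-2 * t + 1)) q * f (t - 1) (j + 1) := rfl

theorem pairOp_mul_apply (p q r s : Bool) (f : ℤ → ℕ → L) (t : ℤ) (j : ℕ) :
    (pairOp F e c X Y p q * pairOp F e c X Y r s) f t j =
      pairWeight e c X Y j t * pairWeight e c X Y j (t + 1) *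
        (letterVal (X (2 * t)) p * letterVal (X (2 * t + 1)) q *
          letterVal (X (2 * t + 2)) r * letterVal (X (2 * t + 3)) s) * f (t + 2) j
      + (pairWeight e c X Y j t *
          (letterVal (X (2 * t)) p * letterVal (X (2 * t + 1)) q *
            letterVal (Y (-2 * t - 2)) r * letterVal (Y (-2 * t - 1)) s)
        + pairWeight e c X Y (j + 1) (t - 1) *
          (letterVal (Y (-2 * t)) p * letterVal (Y (-2 * t + 1)) q *
            letterVal (X (2 * t - 2)) r * letterVal (X (2 * t - 1)) s)) * f t (j + 1)
      + letterVal (Y (-2 * t)) p * letterVal (Y (-2 * t + 1)) q *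
          letterVal (Y (-2 * t + 2)) r * letterVal (Y (-2 * t + 3)) s * f (t - 2) (j + 2) := by
  simp only [Module.End.mul_apply, pairOp_apply]
  rw [show 2 * (t + 1) = 2 * t + 2 by ring, show 2 * t + 2 + 1 = 2 * t + 3 by ring,
    show -2 * (t + 1) = -2 * t - 2 by ring, show -2 * t - 2 + 1 = -2 * t - 1 by ring,
    show 2 * (t - 1) = 2 * t - 2 by ring, show 2 * t - 2 + 1 = 2 * t - 1 by ring,
    show -2 * (t - 1) = -2 * t + 2 by ring, show -2 * t + 2 + 1 = -2 * t + 3 by ring,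
    show t + 1 - 1 = t by ring, show t - 1 + 1 = t by ring, show t + 1 + 1 = t + 2 by ring,
    show t - 1 - 1 = t - 2 by ring]
  ring

/-- The values of the two cubic forms. -/
def cubicVal (e c : L) : Bool → L → L → L → L
  | false => cubicVal₁ e c
  | true => cubicVal₂ e c

theorem leftCubic_pairOp_apply {e c : F} (p b : Bool) (f : ℤ → ℕ → L) (t : ℤ) (j : ℕ) :
    leftCubic e c (pairOp F (algebraMap F L e) (algebraMap F L c) X Y) p b f t j =
      pairWeight (algebraMap F L e) (algebraMap F L c) X Y j t *
        pairWeight (algebraMap F L e) (algebraMap F L c) X Y j (t + 1) *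
        letterVal (X (2 * t)) p * cubicVal (algebraMap F L e) (algebraMap F L c) b
          (X (2 * t + 1)) (X (2 * t + 2)) (X (2 * t + 3)) * f (t + 2) j
      + (pairWeight (algebraMap F L e) (algebraMap F L c) X Y j t * letterVal (X (2 * t)) p *
          cubicVal (algebraMap F L e) (algebraMap F L c) b
            (X (2 * t + 1)) (Y (-2 * t - 2)) (Y (-2 * t - 1))
        + pairWeight (algebraMap F L e) (algebraMap F L c) X Y (j + 1) (t - 1) *
          letterVal (Y (-2 * t)) p * cubicVal (algebraMap F L e) (algebraMap F L c) b
            (Y (-2 * t + 1)) (X (2 * t - 2)) (X (2 * t - 1))) * f t (j + 1)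
      + letterVal (Y (-2 * t)) p * cubicVal (algebraMap F L e) (algebraMap F L c) b
          (Y (-2 * t + 1)) (Y (-2 * t + 2)) (Y (-2 * t + 3)) * f (t - 2) (j + 2) := by
  simp only [leftCubic, cubicComb, LinearMap.add_apply, LinearMap.smul_apply, Pi.add_apply,
    Pi.smul_apply, pairOp_mul_apply]
  simp only [Algebra.smul_def, map_mul, map_sub, map_pow, map_one, map_ofNat]
  cases p <;> cases b <;>
    simp only [letterVal, cubicVal, cubicVal₁, cubicVal₂, Bool.not_false, Bool.not_true] <;> ring

theorem rightCubic_pairOp_apply {e c : F} (b q : Bool) (f : ℤ → ℕ → L) (t : ℤ) (j : ℕ) :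
    rightCubic e c (pairOp F (algebraMap F L e) (algebraMap F L c) X Y) b q f t j =
      pairWeight (algebraMap F L e) (algebraMap F L c) X Y j t *
        pairWeight (algebraMap F L e) (algebraMap F L c) X Y j (t + 1) *
        letterVal (X (2 * t + 3)) q * cubicVal (algebraMap F L e) (algebraMap F L c) b
          (X (2 * t)) (X (2 * t + 1)) (X (2 * t + 2)) * f (t + 2) j
      + (pairWeight (algebraMap F L e) (algebraMap F L c) X Y j t *
          letterVal (Y (-2 * t - 1)) q * cubicVal (algebraMap F L e) (algebraMap F L c) b
            (X (2 * t)) (X (2 * t + 1)) (Y (-2 * t - 2))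
        + pairWeight (algebraMap F L e) (algebraMap F L c) X Y (j + 1) (t - 1) *
          letterVal (X (2 * t - 1)) q * cubicVal (algebraMap F L e) (algebraMap F L c) b
            (Y (-2 * t)) (Y (-2 * t + 1)) (X (2 * t - 2))) * f t (j + 1)
      + letterVal (Y (-2 * t + 3)) q * cubicVal (algebraMap F L e) (algebraMap F L c) b
          (Y (-2 * t)) (Y (-2 * t + 1)) (Y (-2 * t + 2)) * f (t - 2) (j + 2) := by
  simp only [rightCubic, cubicComb, LinearMap.add_apply, LinearMap.smul_apply, Pi.add_apply,
    Pi.smul_apply, pairOp_mul_apply]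
  simp only [Algebra.smul_def, map_mul, map_sub, map_pow, map_one, map_ofNat]
  cases q <;> cases b <;>
    simp only [letterVal, cubicVal, cubicVal₁, cubicVal₂, Bool.not_false, Bool.not_true] <;> ring

variable (h : OrbitPair e c X Y)

include h

theorem OrbitPair.mixFst_ne (t : ℤ) : mixFst e c X Y t ≠ 0 := by
  have := h.fst_ne (2 * t + 1) (-2 * t - 2)
  rwa [show -2 * t - 2 + 1 = -2 * t - 1 by ring] at this

theorem OrbitPair.mixSnd_ne (t : ℤ) : mixSnd e c X Y t ≠ 0 := by
  have := h.snd_ne (-2 * t + 1) (2 * t - 2)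
  rwa [show 2 * t - 2 + 1 = 2 * t - 1 by ring] at this

theorem OrbitPair.pairWeight_ne (j : ℕ) : ∀ t : ℤ, pairWeight e c X Y j t ≠ 0 := by
  induction j with
  | zero => exact fun _ => one_ne_zero
  | succ j ih =>
    exact fun t => div_ne_zero (neg_ne_zero.2 (mul_ne_zero (ih _) (h.mixFst_ne _))) (h.mixSnd_ne _)

theorem OrbitPair.pairWeight_succ (j : ℕ) (t : ℤ) :
    pairWeight e c X Y (j + 1) (t - 1) * mixSnd e c X Y t =
      -(pairWeight e c X Y j t * mixFst e c X Y t) := by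
  rw [pairWeight, sub_add_cancel, div_mul_cancel₀ _ (h.mixSnd_ne t)]

theorem OrbitPair.cubicVal_fst (b : Bool) {i j l : ℤ} (hj : j = i + 1) (hl : l = i + 2) :
    cubicVal e c b (X i) (X j) (X l) = 0 := by
  subst hj hl
  cases b
  exacts [h.rel₁_fst i, h.rel₂_fst i]

theorem OrbitPair.cubicVal_snd (b : Bool) {i j l : ℤ} (hj : j = i + 1) (hl : l = i + 2) :
    cubicVal e c b (Y i) (Y j) (Y l) = 0 := by
  subst hj hl
  cases b
  exacts [h.rel₁_snd i, h.rel₂_snd i]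

theorem OrbitPair.mix_cross (t : ℤ) :
    cubicVal₁ e c (X (2 * t)) (X (2 * t + 1)) (Y (-2 * t - 2)) * mixSnd e c X Y t =
      mixFst e c X Y t * cubicVal₁ e c (Y (-2 * t)) (Y (-2 * t + 1)) (X (2 * t - 2)) := by
  have h1 := cubicVal₁_mul_sub
    (h.cubicVal_fst false (show 2 * t = (2 * t - 1) + 1 by ring)
      (show 2 * t + 1 = (2 * t - 1) + 2 by ring))
    (h.cubicVal_fst true (show 2 * t = (2 * t - 1) + 1 by ring)
      (show 2 * t + 1 = (2 * t - 1) + 2 by ring))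
    (h.cubicVal_snd false (show -2 * t - 1 = (-2 * t - 2) + 1 by ring)
      (show -2 * t = (-2 * t - 2) + 2 by ring))
    (h.cubicVal_snd true (show -2 * t - 1 = (-2 * t - 2) + 1 by ring)
      (show -2 * t = (-2 * t - 2) + 2 by ring))
  have h2 := cubicVal₁_mul_sub
    (h.cubicVal_snd false (show -2 * t = (-2 * t - 1) + 1 by ring)
      (show -2 * t + 1 = (-2 * t - 1) + 2 by ring))
    (h.cubicVal_snd true (show -2 * t = (-2 * t - 1) + 1 by ring)
      (show -2 * t + 1 = (-2 * t - 1) + 2 by ring))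
    (h.cubicVal_fst false (show 2 * t - 1 = (2 * t - 2) + 1 by ring)
      (show 2 * t = (2 * t - 2) + 2 by ring))
    (h.cubicVal_fst true (show 2 * t - 1 = (2 * t - 2) + 1 by ring)
      (show 2 * t = (2 * t - 2) + 2 by ring))
  refine mul_left_cancel₀ (mul_ne_zero (h.sub_ne (2 * t) (-2 * t))
    (h.sub_ne (2 * t - 1) (-2 * t - 1))) ?_
  rw [mixFst, mixSnd]
  linear_combination (X (2 * t) - Y (-2 * t)) *
      cubicVal₁ e c (Y (-2 * t + 1)) (X (2 * t - 2)) (X (2 * t - 1)) * h1 +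
    (X (2 * t) - Y (-2 * t)) *
      cubicVal₁ e c (X (2 * t + 1)) (Y (-2 * t - 2)) (Y (-2 * t - 1)) * h2

end PairOperators

section PairCentral

variable {F L : Type*} [Field F] [Field L] [Algebra F L]

/-- The factor by which the first central element acts. -/
def pairFactor (e c : L) (X Y : ℤ → L) (j : ℕ) (t : ℤ) : L :=
  pairWeight e c X Y j t * mixFst e c X Y t * (X (2 * t) - Y (-2 * t))

/-- The ratio of the factors by which the two central elements act. -/
def pairRatio (e c : L) (X Y : ℤ → L) (t : ℤ) : L :=
  2 * pairForm e c (X (2 * t - 1)) (X (2 * t)) (Y (-2 * t - 1)) (Y (-2 * t)) /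
    ((X (2 * t - 1) - Y (-2 * t - 1)) * (X (2 * t) - Y (-2 * t)))

theorem centralTwo_pairOp_apply {X Y : ℤ → L} {e c : F} (f : ℤ → ℕ → L) (t : ℤ) (j : ℕ) :
    centralTwo e c (pairOp F (algebraMap F L e) (algebraMap F L c) X Y) f t j =
      pairWeight (algebraMap F L e) (algebraMap F L c) X Y j t *
        pairWeight (algebraMap F L e) (algebraMap F L c) X Y j (t + 1) *
        quarticVal (algebraMap F L e) (algebraMap F L c) (X (2 * t)) (X (2 * t + 1))
          (X (2 * t + 2)) (X (2 * t + 3)) * f (t + 2) j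
      + (pairWeight (algebraMap F L e) (algebraMap F L c) X Y j t *
          quarticVal (algebraMap F L e) (algebraMap F L c) (X (2 * t)) (X (2 * t + 1))
            (Y (-2 * t - 2)) (Y (-2 * t - 1))
        + pairWeight (algebraMap F L e) (algebraMap F L c) X Y (j + 1) (t - 1) *
          quarticVal (algebraMap F L e) (algebraMap F L c) (Y (-2 * t)) (Y (-2 * t + 1))
            (X (2 * t - 2)) (X (2 * t - 1))) * f t (j + 1)
      + quarticVal (algebraMap F L e) (algebraMap F L c) (Y (-2 * t)) (Y (-2 * t + 1))
          (Y (-2 * t + 2)) (Y (-2 * t + 3)) * f (t - 2) (j + 2) := by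
  simp only [centralTwo, LinearMap.add_apply, LinearMap.sub_apply, LinearMap.smul_apply,
    Pi.add_apply, Pi.sub_apply, Pi.smul_apply, pairOp_mul_apply, letterVal]
  simp only [Algebra.smul_def, map_mul, map_sub, map_pow, map_one, map_ofNat, quarticVal]
  ring

section General

variable {e c : L} {X Y : ℤ → L} (h : OrbitPair e c X Y)

include h

theorem OrbitPair.quartic_fst (j : ℤ) :
    quarticVal e c (X j) (X (j + 1)) (X (j + 2)) (X (j + 3)) = 0 := by
  refine quartic_certificate ?_ (h.rel₁_fst j) ?_ ?_
  · have := h.den_fst (j + 1)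
    rwa [show j + 1 + 1 = j + 2 by ring] at this
  · exact h.cubicVal_fst false (by ring) (by ring)
  · have := h.curve_fst (j + 1)
    rwa [show j + 1 + 1 = j + 2 by ring] at this

theorem OrbitPair.quartic_snd (j : ℤ) :
    quarticVal e c (Y j) (Y (j + 1)) (Y (j + 2)) (Y (j + 3)) = 0 := by
  refine quartic_certificate ?_ (h.rel₁_snd j) ?_ ?_
  · have := h.den_snd (j + 1)
    rwa [show j + 1 + 1 = j + 2 by ring] at this
  · exact h.cubicVal_snd false (by ring) (by ring)
  · have := h.curve_snd (j + 1)
    rwa [show j + 1 + 1 = j + 2 by ring] at this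

theorem OrbitPair.pairFactor_ne (j : ℕ) (t : ℤ) : pairFactor e c X Y j t ≠ 0 :=
  mul_ne_zero (mul_ne_zero (h.pairWeight_ne j t) (h.mixFst_ne t)) (h.sub_ne _ _)

theorem OrbitPair.quartic_mix (j : ℕ) (t : ℤ) :
    pairWeight e c X Y j t *
        quarticVal e c (X (2 * t)) (X (2 * t + 1)) (Y (-2 * t - 2)) (Y (-2 * t - 1))
      + pairWeight e c X Y (j + 1) (t - 1) *
        quarticVal e c (Y (-2 * t)) (Y (-2 * t + 1)) (X (2 * t - 2)) (X (2 * t - 1)) =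
      pairRatio e c X Y t * pairFactor e c X Y j t := by
  have d1 := h.den_fst (2 * t - 1)
  have c1 := h.curve_fst (2 * t - 1)
  rw [sub_add_cancel] at d1 c1
  have d2 := h.den_snd (-2 * t - 1)
  have c2 := h.curve_snd (-2 * t - 1)
  rw [sub_add_cancel] at d2 c2
  have s1 := h.sub_ne (2 * t - 1) (-2 * t - 1)
  have s2 := h.sub_ne (2 * t) (-2 * t)
  have q1 := sub_mul_quarticVal d1 d2
    (h.cubicVal_fst false (show 2 * t = (2 * t - 1) + 1 by ring)
      (show 2 * t + 1 = (2 * t - 1) + 2 by ring))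
    (h.cubicVal_snd false (show -2 * t - 1 = (-2 * t - 2) + 1 by ring)
      (show -2 * t = (-2 * t - 2) + 2 by ring)) c1 c2
  have q2 := sub_mul_quarticVal d2 d1
    (h.cubicVal_snd false (show -2 * t = (-2 * t - 1) + 1 by ring)
      (show -2 * t + 1 = (-2 * t - 1) + 2 by ring))
    (h.cubicVal_fst false (show 2 * t - 1 = (2 * t - 2) + 1 by ring)
      (show 2 * t = (2 * t - 2) + 2 by ring)) c2 c1
  have hw := h.pairWeight_succ j t
  have hs : pairForm e c (Y (-2 * t - 1)) (Y (-2 * t)) (X (2 * t - 1)) (X (2 * t)) =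
      pairForm e c (X (2 * t - 1)) (X (2 * t)) (Y (-2 * t - 1)) (Y (-2 * t)) := by
    unfold pairForm
    ring
  rw [hs] at q2
  rw [pairRatio, div_mul_eq_mul_div, eq_div_iff (mul_ne_zero s1 s2), pairFactor]
  rw [mixFst] at *
  rw [mixSnd] at hw
  linear_combination pairWeight e c X Y j t * (X (2 * t) - Y (-2 * t)) * q1
    - pairWeight e c X Y (j + 1) (t - 1) * (X (2 * t) - Y (-2 * t)) * q2
    - (X (2 * t) - Y (-2 * t)) *
      pairForm e c (X (2 * t - 1)) (X (2 * t)) (Y (-2 * t - 1)) (Y (-2 * t)) * hw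

end General

variable {e c : F} {X Y : ℤ → L} (h : OrbitPair (algebraMap F L e) (algebraMap F L c) X Y)

include h

theorem OrbitPair.leftCubic_apply (p b : Bool) (f : ℤ → ℕ → L) (t : ℤ) (j : ℕ) :
    leftCubic e c (pairOp F (algebraMap F L e) (algebraMap F L c) X Y) p b f t j =
      if p = b then
        pairFactor (algebraMap F L e) (algebraMap F L c) X Y j t * f t (j + 1) else 0 := by
  rw [leftCubic_pairOp_apply, h.cubicVal_fst b (by ring) (by ring),
    h.cubicVal_snd b (by ring) (by ring)]
  have hw := h.pairWeight_succ j t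
  rw [mixSnd] at hw
  cases b
  · simp only [cubicVal, pairFactor]
    rw [mixFst] at *
    cases p <;> simp only [letterVal, if_true, reduceCtorEq, if_false]
    · linear_combination Y (-2 * t) * f t (j + 1) * hw
    · linear_combination f t (j + 1) * hw
  · simp only [cubicVal, pairFactor]
    rw [cubicVal₂_of_next (h.cubicVal_snd false (show -2 * t - 1 = (-2 * t - 2) + 1 by ring)
        (show -2 * t = (-2 * t - 2) + 2 by ring))
        (h.cubicVal_snd true (show -2 * t - 1 = (-2 * t - 2) + 1 by ring)
        (show -2 * t = (-2 * t - 2) + 2 by ring)),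
      cubicVal₂_of_next (h.cubicVal_fst false (show 2 * t - 1 = (2 * t - 2) + 1 by ring)
        (show 2 * t = (2 * t - 2) + 2 by ring))
        (h.cubicVal_fst true (show 2 * t - 1 = (2 * t - 2) + 1 by ring)
        (show 2 * t = (2 * t - 2) + 2 by ring))]
    rw [mixFst] at *
    cases p <;> simp only [letterVal, if_true, reduceCtorEq, if_false]
    · linear_combination -X (2 * t) * Y (-2 * t) * f t (j + 1) * hw
    · linear_combination -X (2 * t) * f t (j + 1) * hw

theorem OrbitPair.rightCubic_apply (b q : Bool) (f : ℤ → ℕ → L) (t : ℤ) (j : ℕ) :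
    rightCubic e c (pairOp F (algebraMap F L e) (algebraMap F L c) X Y) b q f t j =
      if b = q then pairWeight (algebraMap F L e) (algebraMap F L c) X Y j t *
        cubicVal₁ (algebraMap F L e) (algebraMap F L c) (X (2 * t)) (X (2 * t + 1))
          (Y (-2 * t - 2)) * (Y (-2 * t - 1) - X (2 * t - 1)) * f t (j + 1) else 0 := by
  rw [rightCubic_pairOp_apply, h.cubicVal_fst b (by ring) (by ring),
    h.cubicVal_snd b (by ring) (by ring)]
  have hw : pairWeight (algebraMap F L e) (algebraMap F L c) X Y (j + 1) (t - 1) *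
      cubicVal₁ (algebraMap F L e) (algebraMap F L c) (Y (-2 * t)) (Y (-2 * t + 1))
        (X (2 * t - 2)) = -(pairWeight (algebraMap F L e) (algebraMap F L c) X Y j t *
      cubicVal₁ (algebraMap F L e) (algebraMap F L c) (X (2 * t)) (X (2 * t + 1))
        (Y (-2 * t - 2))) := by
    refine mul_left_cancel₀ (h.mixSnd_ne t) ?_
    have h1 := h.pairWeight_succ j t
    have h2 := h.mix_cross t
    linear_combination cubicVal₁ (algebraMap F L e) (algebraMap F L c) (Y (-2 * t))
      (Y (-2 * t + 1)) (X (2 * t - 2)) * h1 +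
      pairWeight (algebraMap F L e) (algebraMap F L c) X Y j t * h2
  cases b
  · simp only [cubicVal]
    cases q <;> simp only [letterVal, if_true, reduceCtorEq, if_false]
    · linear_combination X (2 * t - 1) * f t (j + 1) * hw
    · linear_combination f t (j + 1) * hw
  · simp only [cubicVal]
    rw [cubicVal₂_of_prev (h.cubicVal_fst false (show 2 * t = (2 * t - 1) + 1 by ring)
        (show 2 * t + 1 = (2 * t - 1) + 2 by ring))
        (h.cubicVal_fst true (show 2 * t = (2 * t - 1) + 1 by ring)
        (show 2 * t + 1 = (2 * t - 1) + 2 by ring)),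
      cubicVal₂_of_prev (h.cubicVal_snd false (show -2 * t = (-2 * t - 1) + 1 by ring)
        (show -2 * t + 1 = (-2 * t - 1) + 2 by ring))
        (h.cubicVal_snd true (show -2 * t = (-2 * t - 1) + 1 by ring)
        (show -2 * t + 1 = (-2 * t - 1) + 2 by ring))]
    cases q <;> simp only [letterVal, if_true, reduceCtorEq, if_false]
    · linear_combination -X (2 * t - 1) * Y (-2 * t - 1) * f t (j + 1) * hw
    · linear_combination -Y (-2 * t - 1) * f t (j + 1) * hw

theorem OrbitPair.wordRel :
    WordRel e c (pairOp F (algebraMap F L e) (algebraMap F L c) X Y) where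
  left b := by
    ext f t j
    rw [h.leftCubic_apply, if_neg (by simp)]
    rfl
  right b := by
    ext f t j
    rw [h.rightCubic_apply, if_neg (by simp)]
    rfl
  left_eq := by
    ext f t j
    rw [h.leftCubic_apply, h.leftCubic_apply, if_pos rfl, if_pos rfl]
  right_eq := by
    ext f t j
    rw [h.rightCubic_apply, h.rightCubic_apply, if_pos rfl, if_pos rfl]

theorem OrbitPair.centralOne_apply (f : ℤ → ℕ → L) (t : ℤ) (j : ℕ) :
    centralOne e c (pairOp F (algebraMap F L e) (algebraMap F L c) X Y) f t j =
      pairFactor (algebraMap F L e) (algebraMap F L c) X Y j t * f t (j + 1) := by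
  rw [centralOne, h.leftCubic_apply, if_pos rfl]

theorem OrbitPair.centralTwo_apply (f : ℤ → ℕ → L) (t : ℤ) (j : ℕ) :
    centralTwo e c (pairOp F (algebraMap F L e) (algebraMap F L c) X Y) f t j =
      pairRatio (algebraMap F L e) (algebraMap F L c) X Y t *
        pairFactor (algebraMap F L e) (algebraMap F L c) X Y j t * f t (j + 1) := by
  have h2 := h.quartic_snd (-2 * t)
  rw [centralTwo_pairOp_apply, h.quartic_fst, h2, h.quartic_mix]
  ring

end PairCentral

section OrbitPairs

theorem PolyIndep.affine {F K : Type*} [Field F] [Field K] [Algebra F K] {x f g : K}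
    (h : PolyIndep F x f g) {r₀ r₁ s₀ s₁ : F}
    (h0 : (algebraMap F K r₀ + algebraMap F K r₁ * x) * f +
      (algebraMap F K s₀ + algebraMap F K s₁ * x) * g = 0) :
    r₀ = 0 ∧ r₁ = 0 ∧ s₀ = 0 ∧ s₁ = 0 := by
  have key : ∀ r s : F, Polynomial.C r + Polynomial.C s * Polynomial.X = 0 → r = 0 ∧ s = 0 := by
    intro r s hrs
    constructor
    · simpa only [Polynomial.coeff_add, Polynomial.coeff_C_zero, Polynomial.coeff_C_mul,
        Polynomial.coeff_X_zero, mul_zero, add_zero, Polynomial.coeff_zero] using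
        congrArg (Polynomial.coeff · 0) hrs
    · simpa only [Polynomial.coeff_add, Polynomial.coeff_C_succ, Polynomial.coeff_C_mul,
        Polynomial.coeff_X_one, mul_one, zero_add, Polynomial.coeff_zero] using
        congrArg (Polynomial.coeff · (0 + 1)) hrs
  obtain ⟨h1, h2⟩ := h (Polynomial.C r₀ + Polynomial.C r₁ * Polynomial.X)
    (Polynomial.C s₀ + Polynomial.C s₁ * Polynomial.X)
    (by simpa only [map_add, map_mul, Polynomial.aeval_C, Polynomial.aeval_X] using h0)
  exact ⟨(key _ _ h1).1, (key _ _ h1).2, (key _ _ h2).1, (key _ _ h2).2⟩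

variable {F K L : Type*} [Field F] [Field K] [Algebra F K] [Field L] [Algebra K L] [Algebra F L]
  [IsScalarTower F K L] {e c : F} {x : ℤ → K} {y : ℤ → L}

theorem CurveOrbit.den_ne (hx : CurveOrbit F (algebraMap F K e) (algebraMap F K c) x)
    (hp : GoodParams e c) (j : ℤ) : (algebraMap F K e ^ 2 - 1) +
      2 * algebraMap F K e * algebraMap F K c * x j * x (j + 1) ≠ 0 := by
  have := (hx.indep j).add_mul_mul_ne_zero (sub_ne_zero.2 hp.sq_ne) (s := 2 * e * c)
  simpa [map_ofNat] using this

theorem CurveOrbit.orbitPair (hx : CurveOrbit F (algebraMap F K e) (algebraMap F K c) x)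
    (hy : CurveOrbit K (algebraMap F L e) (algebraMap F L c) y) (hp : GoodParams e c) :
    OrbitPair (algebraMap F L e) (algebraMap F L c) (fun j => algebraMap K L (x j)) y := by
  have he : algebraMap F L e = algebraMap K L (algebraMap F K e) :=
    IsScalarTower.algebraMap_apply F K L e
  have hc : algebraMap F L c = algebraMap K L (algebraMap F K c) :=
    IsScalarTower.algebraMap_apply F K L c
  have hE : algebraMap F K e ^ 2 - 1 ≠ 0 := by
    rw [← map_pow, ← map_one (algebraMap F K), ← map_sub]
    exact (map_ne_zero _).2 (sub_ne_zero.2 hp.sq_ne)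
  constructor
  · intro j
    rw [cubicVal₁, he, hc]
    simpa [map_ofNat] using congrArg (algebraMap K L) (hx.rel₁ j)
  · intro j
    rw [cubicVal₂, he, hc]
    simpa [map_ofNat] using congrArg (algebraMap K L) (hx.rel₂ j)
  · exact hy.rel₁
  · exact hy.rel₂
  · intro j
    rw [he, hc]
    simpa [map_ofNat] using congrArg (algebraMap K L) (hx.curve j)
  · exact hy.curve
  · intro j
    have := (map_ne_zero (algebraMap K L)).2 (hx.den_ne hp j)
    rw [he, hc]
    simpa [map_ofNat] using this
  · intro j
    have := (hy.indep j).add_mul_mul_ne_zero hE (s := 2 * algebraMap F K e * algebraMap F K c)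
    rw [he, hc]
    simpa [map_ofNat] using this
  · intro i j h
    exact hy.transc j (sub_eq_zero.1 h ▸ isAlgebraic_algebraMap (x i))
  · intro i j h
    refine hE ((hy.indep j).affine (r₀ := (algebraMap F K e ^ 2 - 1) * x i)
      (r₁ := 2 * algebraMap F K c) (s₀ := algebraMap F K e ^ 2 - 1)
      (s₁ := 2 * algebraMap F K e * algebraMap F K c * x i) ?_).2.2.1
    rw [cubicVal₁, he, hc] at h
    simp only [map_mul, map_sub, map_pow, map_one, map_ofNat]
    linear_combination h
  · intro i j h
    refine hx.den_ne hp j ((hy.indep i).affine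
      (r₀ := (algebraMap F K e ^ 2 - 1) * x (j + 1) + 2 * algebraMap F K c * x j)
      (r₁ := (algebraMap F K e ^ 2 - 1) + 2 * algebraMap F K e * algebraMap F K c * x j *
        x (j + 1)) (s₀ := 0) (s₁ := 0) ?_).2.1
    rw [cubicVal₁, he, hc] at h
    simp only [map_add, map_mul, map_sub, map_pow, map_one, map_ofNat, map_zero]
    linear_combination h

theorem CurveOrbit.pairRatio_ne (hx : CurveOrbit F (algebraMap F K e) (algebraMap F K c) x)
    (hy : CurveOrbit K (algebraMap F L e) (algebraMap F L c) y) (hp : GoodParams e c) (r : K) :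
    pairRatio (algebraMap F L e) (algebraMap F L c) (fun j => algebraMap K L (x j)) y 0 ≠
      algebraMap K L r := by
  have he : algebraMap F L e = algebraMap K L (algebraMap F K e) :=
    IsScalarTower.algebraMap_apply F K L e
  have hc : algebraMap F L c = algebraMap K L (algebraMap F K c) :=
    IsScalarTower.algebraMap_apply F K L c
  have hpair := hx.orbitPair hy hp
  have s1 := hpair.sub_ne (-1) (-1)
  have s2 := hpair.sub_ne 0 0
  intro h
  rw [pairRatio] at h
  norm_num at h
  rw [div_eq_iff (mul_ne_zero s1 s2), pairForm, he, hc] at h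
  set E := algebraMap F K e
  set C := algebraMap F K c
  obtain ⟨-, -, h2, h3⟩ := (hy.indep' (-1)).affine
    (r₀ := 2 * (4 * C * E * (E ^ 2 - 1) + ((E ^ 2 - 1) ^ 2 + 4 * E ^ 2 * C ^ 2) *
        (x (-1) * x 0)) - r * x (-1) * x 0)
    (r₁ := 2 * (-(4 * C * (E ^ 2 - 1) * x 0) -
        ((E ^ 2 - 1) ^ 2 + 4 * C ^ 2) * x (-1)) + r * x (-1))
    (s₀ := 2 * (-(4 * C * (E ^ 2 - 1) * x (-1)) -
        ((E ^ 2 - 1) ^ 2 + 4 * C ^ 2) * x 0) + r * x 0)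
    (s₁ := 2 * (4 * C * E * (E ^ 2 - 1) * (x (-1) * x 0) +
        ((E ^ 2 - 1) ^ 2 + 4 * E ^ 2 * C ^ 2)) - r) (by
      simp only [map_add, map_mul, map_sub, map_pow, map_one, map_ofNat, map_neg]
      norm_num
      linear_combination h)
  have h4 := (hx.indep' (-1) (Polynomial.C (8 * c ^ 2 * (e ^ 2 - 1)) * Polynomial.X)
    (Polynomial.C (8 * c * (e ^ 2 - 1)) *
      (Polynomial.C e * Polynomial.X ^ 2 - 1)) (by
      simp only [map_mul, Polynomial.aeval_C, Polynomial.aeval_X, map_sub, map_pow,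
        map_one, map_ofNat]
      norm_num
      linear_combination h2 + x 0 * h3)).1
  have h8 : (8 : F) ≠ 0 := by
    rw [show (8 : F) = 2 ^ 3 by norm_num]
    exact pow_ne_zero _ hp.two_ne
  have h5 := (mul_eq_zero.1 h4).resolve_right Polynomial.X_ne_zero
  exact mul_ne_zero (mul_ne_zero h8 (pow_ne_zero _ hp.c_ne)) (sub_ne_zero.2 hp.sq_ne)
    (Polynomial.C_eq_zero.1 h5)

theorem CurveOrbit.transcendental_pairRatio [IsAlgClosed K]
    (hx : CurveOrbit F (algebraMap F K e) (algebraMap F K c) x)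
    (hy : CurveOrbit K (algebraMap F L e) (algebraMap F L c) y) (hp : GoodParams e c) :
    Transcendental K
      (pairRatio (algebraMap F L e) (algebraMap F L c) (fun j => algebraMap K L (x j)) y 0) := by
  intro h
  have hxi := h.isIntegral
  obtain ⟨r, hr⟩ := minpoly.mem_range_of_degree_eq_one K _
    (IsAlgClosed.degree_eq_one_of_irreducible K (minpoly.irreducible hxi))
  exact hx.pairRatio_ne hy hp r hr.symm

end OrbitPairs

section SingleOperators

variable {F A K : Type*} [Field F] [Ring A] [Algebra F A] [Field K] [Algebra F K]

/-- The letters acting on functions along a single orbit. -/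
def orbitOp (F : Type*) {K : Type*} [Field F] [Field K] [Algebra F K] (x : ℤ → K) (p q : Bool) :
    Module.End F (ℤ → K) where
  toFun f t := letterVal (x (2 * t)) p * letterVal (x (2 * t + 1)) q * f (t + 1)
  map_add' f g := by
    ext t
    simp only [Pi.add_apply]
    ring
  map_smul' r f := by
    ext t
    simp only [Pi.smul_apply, mul_smul_comm, RingHom.id_apply]

theorem orbitOp_apply (x : ℤ → K) (p q : Bool) (f : ℤ → K) (t : ℤ) : orbitOp F x p q f t =
    letterVal (x (2 * t)) p * letterVal (x (2 * t + 1)) q * f (t + 1) := rfl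

theorem leftCubic_orbitOp_apply {e c : F} {x : ℤ → K} (p b : Bool) (f : ℤ → K) (t : ℤ) :
    leftCubic e c (orbitOp F x) p b f t = letterVal (x (2 * t)) p *
      cubicVal (algebraMap F K e) (algebraMap F K c) b
        (x (2 * t + 1)) (x (2 * t + 2)) (x (2 * t + 3)) * f (t + 2) := by
  simp only [leftCubic, cubicComb, LinearMap.add_apply, LinearMap.smul_apply, Pi.add_apply,
    Pi.smul_apply, Module.End.mul_apply, orbitOp_apply]
  simp only [Algebra.smul_def, map_mul, map_sub, map_pow, map_one, map_ofNat]
  rw [show 2 * (t + 1) = 2 * t + 2 by ring, show 2 * t + 2 + 1 = 2 * t + 3 by ring,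
    show t + 1 + 1 = t + 2 by ring]
  cases p <;> cases b <;>
    simp only [letterVal, cubicVal, cubicVal₁, cubicVal₂, Bool.not_false, Bool.not_true] <;> ring

theorem rightCubic_orbitOp_apply {e c : F} {x : ℤ → K} (b q : Bool) (f : ℤ → K) (t : ℤ) :
    rightCubic e c (orbitOp F x) b q f t = letterVal (x (2 * t + 3)) q *
      cubicVal (algebraMap F K e) (algebraMap F K c) b
        (x (2 * t)) (x (2 * t + 1)) (x (2 * t + 2)) * f (t + 2) := by
  simp only [rightCubic, cubicComb, LinearMap.add_apply, LinearMap.smul_apply, Pi.add_apply,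
    Pi.smul_apply, Module.End.mul_apply, orbitOp_apply]
  simp only [Algebra.smul_def, map_mul, map_sub, map_pow, map_one, map_ofNat]
  rw [show 2 * (t + 1) = 2 * t + 2 by ring, show 2 * t + 2 + 1 = 2 * t + 3 by ring,
    show t + 1 + 1 = t + 2 by ring]
  cases q <;> cases b <;>
    simp only [letterVal, cubicVal, cubicVal₁, cubicVal₂, Bool.not_false, Bool.not_true] <;> ring

theorem CurveOrbit.wordRel {e c : F} {x : ℤ → K}
    (hx : CurveOrbit F (algebraMap F K e) (algebraMap F K c) x) :
    WordRel e c (orbitOp F x) := by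
  have h : ∀ b j, cubicVal (algebraMap F K e) (algebraMap F K c) b (x j) (x (j + 1))
      (x (j + 2)) = 0 := by
    intro b j
    cases b
    exacts [hx.rel₁ j, hx.rel₂ j]
  have hl : ∀ p b, leftCubic e c (orbitOp F x) p b = 0 := by
    intro p b
    ext f t
    have := h b (2 * t + 1)
    rw [show 2 * t + 1 + 1 = 2 * t + 2 by ring, show 2 * t + 1 + 2 = 2 * t + 3 by ring] at this
    rw [leftCubic_orbitOp_apply, this, mul_zero, zero_mul]
    rfl
  have hr : ∀ b q, rightCubic e c (orbitOp F x) b q = 0 := by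
    intro b q
    ext f t
    rw [rightCubic_orbitOp_apply, h, mul_zero, zero_mul]
    rfl
  exact ⟨fun b => hl _ _, fun b => hr _ _, by rw [hl, hl], by rw [hr, hr]⟩

theorem exists_isWordEval {a : Bool → Bool → A} {x : ℤ → K} (φ : A →ₐ[F] Module.End F (ℤ → K))
    (hφ : ∀ p q, φ (a p q) = orbitOp F x p q) : ∃ ev : ℤ → A →ₗ[F] K, IsWordEval a x ev := by
  refine ⟨fun t => LinearMap.proj t ∘ₗ LinearMap.applyₗ (fun _ => 1) ∘ₗ φ.toLinearMap,
    fun t => ?_, fun t p q b => ?_⟩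
  · simp
  · simp [hφ, orbitOp_apply]

end SingleOperators

section CentralExpansion

variable {F A : Type*} [Field F] [Ring A] [Algebra F A] {e c : F} {a : Bool → Bool → A}

theorem eq_zero_of_mem_centralIdeal {n : ℕ} (hn : n < 2) {b : A}
    (hb : b ∈ centralIdeal e c a n) : b = 0 := by
  have h1 : ∀ b ∈ centralIdealOne e c a n, b = 0 := by
    intro b hb
    rcases mem_addNormal.1 hb with h | ⟨m, hm, -⟩
    · exact (Submodule.mem_bot F).1 h
    · omega
  rcases mem_addNormal.1 hb with h | ⟨m, hm, -⟩
  · exact h1 b h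
  · omega

theorem exists_of_mem_centralIdeal {n : ℕ} {b : A} (hb : b ∈ centralIdeal e c a (n + 2)) :
    ∃ y ∈ letterSpan F a ^ n, ∃ z ∈ letterSpan F a ^ n,
      b = y * centralOne e c a + z * centralTwo e c a := by
  have h1 : ∀ b ∈ centralIdealOne e c a (n + 2), ∃ y ∈ letterSpan F a ^ n,
      b = y * centralOne e c a := by
    intro b hb
    rcases mem_addNormal.1 hb with h | ⟨m, hm, y, hy, h⟩
    · exact ⟨0, zero_mem _, by rw [zero_mul]; exact (Submodule.mem_bot F).1 h⟩
    · obtain rfl : m = n := by omega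
      exact ⟨y, hy, sub_eq_zero.1 ((Submodule.mem_bot F).1 h)⟩
  rcases mem_addNormal.1 hb with h | ⟨m, hm, z, hz, h⟩
  · obtain ⟨y, hy, rfl⟩ := h1 b h
    exact ⟨y, hy, 0, zero_mem _, by simp⟩
  · obtain rfl : m = n := by omega
    obtain ⟨y, hy, h⟩ := h1 _ h
    exact ⟨y, hy, z, hz, by rw [← h, sub_add_cancel]⟩

/-- An element of degree `2 * m` more than the coefficients, expanded in the monomials of degree
`m` in the two central elements. -/
def centralSum (e c : F) (a : Bool → Bool → A) (m : ℕ) (b : ℕ → A) : A :=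
  ∑ j ∈ Finset.range (m + 1), b j * (centralOne e c a ^ (m - j) * centralTwo e c a ^ j)

theorem commute_of_mem_letterSpan_pow {z : A} (hz : ∀ x y, a x y * z = z * a x y) {n : ℕ} {b : A}
    (hb : b ∈ letterSpan F a ^ n) : Commute b z := by
  have h1 : letterSpan F a ≤ Subalgebra.toSubmodule (Subalgebra.centralizer F {z}) := by
    intro u hu
    refine (Subalgebra.mem_toSubmodule _).2 (Subalgebra.mem_centralizer_iff F |>.2 fun w hw => ?_)
    rw [Set.mem_singleton_iff.1 hw, letterSpan_comm hz u hu]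
  have h2 : ∀ n : ℕ, letterSpan F a ^ n ≤
      Subalgebra.toSubmodule (Subalgebra.centralizer F {z}) := by
    intro n
    induction n with
    | zero =>
      rw [pow_zero, Submodule.one_le]
      exact one_mem (Subalgebra.centralizer F {z})
    | succ n ih =>
      rw [pow_succ]
      exact Submodule.mul_le.2 fun u hu v hv =>
        mul_mem (S := Subalgebra F A) (ih hu) (h1 hv)
  exact (Subalgebra.mem_centralizer_iff F |>.1 (h2 n hb) z rfl).symm

/-- The sequence shifted by one place, starting from zero. -/
def shiftSeq (z : ℕ → A) : ℕ → A
  | 0 => 0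
  | j + 1 => z j

theorem WordRel.centralSum_succ (h : WordRel e c a) (h2 : (2 : F) ≠ 0) {m : ℕ} {b y z : ℕ → A}
    (hb : ∀ j ≤ m, b j = y j * centralOne e c a + z j * centralTwo e c a) (hy : y (m + 1) = 0) :
    centralSum e c a m b =
      centralSum e c a (m + 1) fun j => y j + shiftSeq z j := by
  have hcomm : Commute (centralTwo e c a) (centralOne e c a) :=
    commute_of_mem_letterSpan_pow (h.centralOne_comm h2) centralTwo_mem
  simp only [centralSum, add_mul, Finset.sum_add_distrib]
  rw [Finset.sum_range_succ _ (m + 1), Finset.sum_range_succ' _ (m + 1)]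
  simp only [hy, shiftSeq, zero_mul, add_zero]
  rw [← Finset.sum_add_distrib]
  refine Finset.sum_congr rfl fun j hj => ?_
  have hj : j ≤ m := by simpa [Nat.lt_succ_iff] using hj
  rw [hb j hj, show m + 1 - j = m - j + 1 by omega, show m + 1 - (j + 1) = m - j by omega,
    add_mul, pow_succ', pow_succ']
  congr 1
  · simp only [mul_assoc]
  · rw [mul_assoc, ← mul_assoc (centralTwo e c a), (hcomm.pow_right _).eq]
    simp only [mul_assoc]

theorem WordRel.exists_centralSum (h : WordRel e c a) (h2 : (2 : F) ≠ 0) (n : ℕ) :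
    ∀ (m : ℕ) (b : ℕ → A), (∀ j, b j ∈ letterSpan F a ^ n) → centralSum e c a m b ≠ 0 →
      ∃ l m' b', n + 2 * m = l + 2 * m' ∧ (∀ j, b' j ∈ letterSpan F a ^ l) ∧
        centralSum e c a m b = centralSum e c a m' b' ∧ ∃ j ≤ m', b' j ∉ centralIdeal e c a l := by
  induction n using Nat.strong_induction_on with
  | _ n ih =>
    intro m b hb h0
    by_cases hex : ∃ j ≤ m, b j ∉ centralIdeal e c a n
    · exact ⟨n, m, b, rfl, hb, rfl, hex⟩
    push Not at hex
    rcases lt_or_ge n 2 with hn | hn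
    · refine absurd (Finset.sum_eq_zero fun j hj => ?_) h0
      rw [eq_zero_of_mem_centralIdeal hn (hex j (by simpa [Nat.lt_succ_iff] using hj)), zero_mul]
    obtain ⟨n, rfl⟩ := Nat.exists_eq_add_of_le' hn
    have hyz : ∀ j, ∃ y z : A, y ∈ letterSpan F a ^ n ∧ z ∈ letterSpan F a ^ n ∧
        (j ≤ m → b j = y * centralOne e c a + z * centralTwo e c a) ∧ (m < j → y = 0) := by
      intro j
      rcases le_or_gt j m with hj | hj
      · obtain ⟨y, hy, z, hz, hbj⟩ := exists_of_mem_centralIdeal (hex j hj)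
        exact ⟨y, z, hy, hz, fun _ => hbj, fun hj' => by omega⟩
      · exact ⟨0, 0, zero_mem _, zero_mem _, fun hj' => by omega, fun _ => rfl⟩
    choose y z hy hz hbyz hy0 using hyz
    have hstep := h.centralSum_succ h2 hbyz (hy0 (m + 1) (by omega))
    rw [hstep] at h0
    obtain ⟨l, m', b', hl, hb', hs, hj⟩ := ih n (by omega) (m + 1)
      (fun j => y j + shiftSeq z j) (by
        rintro (_ | j)
        · exact add_mem (hy 0) (zero_mem _)
        · exact add_mem (hy _) (hz j)) h0
    exact ⟨l, m', b', by omega, hb', hstep.trans hs, hj⟩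

end CentralExpansion

section Filtration

variable {F A : Type*} [Field F] [Ring A] [Algebra F A] (V : Submodule F A)

theorem powFil_mul_pow_le (n m : ℕ) : powFil V n * V ^ m ≤ powFil V (n + m) := by
  induction m with
  | zero => rw [pow_zero, mul_one, add_zero]
  | succ m ih =>
    rw [pow_succ, ← mul_assoc, ← add_assoc]
    exact (mul_le_mul_left ih V).trans (powFil_mul_le V (n + m))

theorem pow_le_powFil (n : ℕ) : V ^ n ≤ powFil V (n + 1) := le_sup_right

theorem pow_mul_powFil_le (n m : ℕ) : V ^ n * powFil V m ≤ powFil V (n + m) := by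
  induction m with
  | zero => simp [powFil]
  | succ m ih =>
    rw [powFil, Submodule.mul_sup, ← pow_add]
    exact sup_le (ih.trans (powFil_mono V (by omega))) (pow_le_powFil V (n + m))

theorem powFil_mul_powFil_le (n m : ℕ) : powFil V n * powFil V (m + 1) ≤ powFil V (n + m) := by
  induction m with
  | zero =>
    rw [powFil, Submodule.mul_sup]
    exact sup_le (by simp [powFil]) (powFil_mul_pow_le V n 0)
  | succ m ih =>
    rw [powFil, Submodule.mul_sup]
    exact sup_le (ih.trans (powFil_mono V (by omega))) (powFil_mul_pow_le V n (m + 1))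

/-- The leading part of a nonzero element. -/
theorem exists_leading_part (hV : ⨆ n : ℕ, V ^ n = ⊤) {s : A} (hs : s ≠ 0) :
    ∃ n, ∃ y ∈ V ^ n, y ≠ 0 ∧ s - y ∈ powFil V n := by
  classical
  have hex := exists_mem_powFil hV s
  obtain ⟨n, hn⟩ : ∃ n, Nat.find hex = n + 1 := by
    refine Nat.exists_eq_succ_of_ne_zero fun h0 => hs ?_
    have := Nat.find_spec hex
    rw [h0] at this
    exact (Submodule.mem_bot F).1 this
  have h1 := Nat.find_spec hex
  rw [hn] at h1
  obtain ⟨u, hu, y, hy, rfl⟩ := Submodule.mem_sup.1 h1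
  refine ⟨n, y, hy, ?_, by rwa [add_sub_cancel_right]⟩
  rintro rfl
  exact Nat.find_min hex (m := n) (by omega) (by rwa [add_zero])

/-- A filtered ring has no zero divisors if the products of nonzero homogeneous elements are
detected by linear maps that vanish on the elements of lower degree. -/
theorem mul_ne_zero_of_leading_parts {L : Type*} [AddCommGroup L] [Module F L]
    (hV : ⨆ n : ℕ, V ^ n = ⊤)
    (h : ∀ n m : ℕ, ∀ y ∈ V ^ n, ∀ z ∈ V ^ m, y ≠ 0 → z ≠ 0 →
      ∃ χ : A →ₗ[F] L, (∀ d < n + m, ∀ u ∈ V ^ d, χ u = 0) ∧ χ (y * z) ≠ 0)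
    {s t : A} (hs : s ≠ 0) (ht : t ≠ 0) : s * t ≠ 0 := by
  obtain ⟨n, y, hy, hy0, hsy⟩ := exists_leading_part V hV hs
  obtain ⟨m, z, hz, hz0, htz⟩ := exists_leading_part V hV ht
  obtain ⟨χ, hχ, hne⟩ := h n m y hy z hz hy0 hz0
  have hker : ∀ d ≤ n + m, powFil V d ≤ LinearMap.ker χ := by
    intro d
    induction d with
    | zero => exact fun _ => bot_le
    | succ d ih => exact fun hd => sup_le (ih (by omega)) fun u hu => hχ d (by omega) u hu
  have h1 : s * t = y * z + ((s - y) * t + y * (t - z)) := by noncomm_ring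
  have htm : t ∈ powFil V (m + 1) := by
    rw [← sub_add_cancel t z]
    exact add_mem (powFil_mono V (Nat.le_succ m) htz) (pow_le_powFil V m hz)
  have h2 : (s - y) * t + y * (t - z) ∈ powFil V (n + m) :=
    add_mem (powFil_mul_powFil_le V n m (Submodule.mul_mem_mul hsy htm))
      (pow_mul_powFil_le V n m (Submodule.mul_mem_mul hy htz))
  intro h0
  rw [h0] at h1
  have h3 := congrArg χ h1
  rw [map_zero, map_add, LinearMap.mem_ker.1 (hker _ le_rfl h2), add_zero] at h3
  exact hne h3.symm

end Filtration

section PairRepresentation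

variable {F A K L : Type*} [Field F] [Ring A] [Algebra F A] [Field K] [Algebra F K] [Field L]
  [Algebra F L] [Algebra K L] [IsScalarTower F K L] {a : Bool → Bool → A} {ε κ : L} {x y : ℤ → L}
  {φ : A →ₐ[F] Module.End F (ℤ → ℕ → L)}

theorem map_centralOne {e c : F} {B : Type*} [Ring B] [Algebra F B] (ψ : A →ₐ[F] B) :
    ψ (centralOne e c a) = centralOne e c fun p q => ψ (a p q) := by
  simp only [centralOne, leftCubic, cubicComb, map_add, map_smul, map_mul]

theorem map_centralTwo {e c : F} {B : Type*} [Ring B] [Algebra F B] (ψ : A →ₐ[F] B) :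
    ψ (centralTwo e c a) = centralTwo e c fun p q => ψ (a p q) := by
  simp only [centralTwo, map_add, map_sub, map_smul, map_mul]

section

variable (hφ : ∀ p q, φ (a p q) = pairOp F ε κ x y p q)
include hφ

/-- A property of operators compatible with sums and scalars holds for the letters' span. -/
theorem pairRep_support {M : ℤ} {d : ℕ} : ∀ {f : ℤ → ℕ → L}
    (_ : ∀ (t : ℤ) (j : ℕ), t + 2 * (j : ℤ) ≠ M → f t j = 0) {b : A}
    (_ : b ∈ letterSpan F a ^ d) (t : ℤ) (j : ℕ), t + 2 * (j : ℤ) + d ≠ M → φ b f t j = 0 := by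
  have hletter : ∀ {M : ℤ} {f : ℤ → ℕ → L}
      (_ : ∀ (t : ℤ) (j : ℕ), t + 2 * (j : ℤ) ≠ M → f t j = 0) {b : A} (_ : b ∈ letterSpan F a) (t : ℤ) (j : ℕ), t + 2 * (j : ℤ) + 1 ≠ M → φ b f t j = 0 := by
    intro M f hf b hb t j hM
    refine Submodule.span_induction ?_ (by simp) ?_ ?_ hb
    · rintro _ ⟨p, rfl⟩
      rw [hφ, pairOp_apply, hf (t + 1) j (by omega), hf (t - 1) (j + 1) (by push_cast; omega)]
      simp
    · intro u v _ _ hu hv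
      rw [map_add, LinearMap.add_apply, Pi.add_apply, Pi.add_apply, hu, hv, add_zero]
    · intro r u _ hu
      rw [map_smul, LinearMap.smul_apply, Pi.smul_apply, Pi.smul_apply, hu, smul_zero]
  induction d generalizing M with
  | zero =>
    intro f hf b hb t j hM
    obtain ⟨r, rfl⟩ := Submodule.mem_one.1 (by simpa using hb)
    rw [AlgHom.commutes, Module.algebraMap_end_apply, Pi.smul_apply, Pi.smul_apply,
      hf t j (by simpa using hM), smul_zero]
  | succ d ih =>
    intro f hf b hb t j hM
    rw [pow_succ] at hb
    refine Submodule.mul_induction_on hb ?_ ?_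
    · intro u hu v hv
      rw [map_mul, Module.End.mul_apply]
      exact ih (M := M - 1) (fun t j h => hletter hf hv t j (by omega)) hu t j
        (by push_cast at hM; omega)
    · intro u v hu hv
      rw [map_add, LinearMap.add_apply, Pi.add_apply, Pi.add_apply, hu, hv, add_zero]

theorem pairRep_path {x' : ℤ → K} (hx : ∀ j, x j = algebraMap K L (x' j)) {ev : ℤ → A →ₗ[F] K}
    (hev : IsWordEval a x' ev) {N : ℕ} {d : ℕ} : ∀ {f : ℤ → ℕ → L}
    (_ : ∀ t j, N < j → f t j = 0) {b : A} (_ : b ∈ letterSpan F a ^ d),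
    (∀ t j, N < j → φ b f t j = 0) ∧ ∀ t : ℤ, φ b f t N =
      (∏ i ∈ Finset.range d, pairWeight ε κ x y N (t + i)) * algebraMap K L (ev t b) *
        f (t + d) N := by
  have hletter : ∀ {f : ℤ → ℕ → L} (_ : ∀ t j, N < j → f t j = 0) {b : A}
      (_ : b ∈ letterSpan F a), (∀ t j, N < j → φ b f t j = 0) ∧ ∀ t : ℤ, φ b f t N =
      pairWeight ε κ x y N t * algebraMap K L (ev t b) * f (t + 1) N := by
    intro f hf b hb
    refine Submodule.span_induction ?_ (by simp) ?_ ?_ hb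
    · rintro _ ⟨⟨p, q⟩, rfl⟩
      refine ⟨fun t j hj => ?_, fun t => ?_⟩
      · rw [hφ, pairOp_apply, hf (t + 1) j hj, hf (t - 1) (j + 1) (by omega)]
        simp
      · rw [hφ, pairOp_apply, hf (t - 1) (N + 1) (by omega), hev.letter, map_mul, hx, hx]
        cases p <;> cases q <;> simp [letterVal]
    · intro u v _ _ hu hv
      simp only [map_add, LinearMap.add_apply, Pi.add_apply]
      refine ⟨fun t j hj => by rw [hu.1 t j hj, hv.1 t j hj, add_zero], fun t => ?_⟩
      rw [hu.2, hv.2]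
      ring
    · intro r u _ hu
      simp only [map_smul, LinearMap.smul_apply, Pi.smul_apply]
      refine ⟨fun t j hj => by rw [hu.1 t j hj, smul_zero], fun t => ?_⟩
      rw [hu.2, Algebra.smul_def, Algebra.smul_def, map_mul, ← IsScalarTower.algebraMap_apply]
      ring
  induction d with
  | zero =>
    intro f hf b hb
    obtain ⟨r, rfl⟩ := Submodule.mem_one.1 (by simpa using hb)
    rw [AlgHom.commutes]
    refine ⟨fun t j hj => ?_, fun t => ?_⟩
    · rw [Module.algebraMap_end_apply, Pi.smul_apply, Pi.smul_apply, hf t j hj, smul_zero]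
    · rw [Module.algebraMap_end_apply, Pi.smul_apply, Pi.smul_apply,
        Algebra.algebraMap_eq_smul_one (A := A), map_smul, hev.one, Algebra.smul_def,
        Algebra.smul_def, mul_one, ← IsScalarTower.algebraMap_apply]
      simp
  | succ d ih =>
    intro f hf b hb
    rw [pow_succ] at hb
    refine Submodule.mul_induction_on hb ?_ ?_
    · intro u hu v hv
      obtain ⟨hv1, hv2⟩ := hletter hf hv
      obtain ⟨hu1, hu2⟩ := ih hv1 hu
      rw [map_mul]
      refine ⟨fun t j hj => hu1 t j hj, fun t => ?_⟩
      rw [Module.End.mul_apply, hu2, hv2, hev.mul d t hu, Finset.prod_range_succ, map_mul,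
        Nat.cast_succ, add_assoc]
      ring
    · intro u v hu hv
      simp only [map_add, LinearMap.add_apply, Pi.add_apply]
      refine ⟨fun t j hj => by rw [hu.1 t j hj, hv.1 t j hj, add_zero], fun t => ?_⟩
      rw [hu.2, hv.2]
      ring

end

variable {e c : F}

theorem pairRep_central (h : OrbitPair (algebraMap F L e) (algebraMap F L c) x y)
    (hφ : ∀ p q, φ (a p q) = pairOp F (algebraMap F L e) (algebraMap F L c) x y p q)
    (f : ℤ → ℕ → L) (t : ℤ) (m n j : ℕ) :
    φ (centralOne e c a ^ m * centralTwo e c a ^ n) f t j =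
      (∏ i ∈ Finset.range (m + n), pairFactor (algebraMap F L e) (algebraMap F L c) x y (j + i) t) *
        pairRatio (algebraMap F L e) (algebraMap F L c) x y t ^ n * f t (j + (m + n)) := by
  have h1 : φ (centralOne e c a) = _ := map_centralOne φ
  have h2 : φ (centralTwo e c a) = _ := map_centralTwo φ
  simp only [hφ] at h1 h2
  induction m generalizing j with
  | zero =>
    rw [pow_zero, one_mul, zero_add]
    induction n generalizing j with
    | zero => simp
    | succ n ih =>
      rw [pow_succ', map_mul, Module.End.mul_apply, h2, h.centralTwo_apply, ih,
        Finset.prod_range_succ', add_zero, show j + 1 + n = j + (n + 1) by omega]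
      simp only [show ∀ i, j + 1 + i = j + (i + 1) by omega]
      ring
  | succ m ih =>
    rw [pow_succ', mul_assoc, map_mul, Module.End.mul_apply, h1, h.centralOne_apply, ih,
      show m + 1 + n = m + n + 1 by omega, Finset.prod_range_succ', add_zero,
      show j + 1 + (m + n) = j + (m + n + 1) by omega]
    simp only [show ∀ i, j + 1 + i = j + (i + 1) by omega]
    ring

variable (φ) in
/-- The coefficient at the origin of the image of the indicator function of a point. -/
def originCoeff (d M : ℕ) : A →ₗ[F] L :=
  LinearMap.proj 0 ∘ₗ LinearMap.proj 0 ∘ₗ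
    LinearMap.applyₗ (fun (t : ℤ) (j : ℕ) => if t = d ∧ j = M then (1 : L) else 0) ∘ₗ φ.toLinearMap

theorem originCoeff_apply (d M : ℕ) (b : A) : originCoeff φ d M b =
    φ b (fun t j => if t = d ∧ j = M then 1 else 0) 0 0 := rfl

theorem originCoeff_eq_zero (hφ : ∀ p q, φ (a p q) = pairOp F ε κ x y p q) {d M n : ℕ}
    (hn : n ≠ d + 2 * M) {b : A} (hb : b ∈ letterSpan F a ^ n) : originCoeff φ d M b = 0 := by
  refine pairRep_support hφ (M := d + 2 * M) (fun t j h => if_neg ?_) hb 0 0 ?_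
  · rintro ⟨rfl, rfl⟩
    exact h rfl
  · push_cast
    omega

theorem exists_originCoeff (h2 : (2 : F) ≠ 0) (ha : WordRel e c a)
    (h : OrbitPair (algebraMap F L e) (algebraMap F L c) x y)
    (hφ : ∀ p q, φ (a p q) = pairOp F (algebraMap F L e) (algebraMap F L c) x y p q)
    {x' : ℤ → K} (hx : ∀ j, x j = algebraMap K L (x' j)) {ev : ℤ → A →ₗ[F] K}
    (hev : IsWordEval a x' ev) (d M : ℕ) : ∃ C : L, C ≠ 0 ∧ ∀ m n, m + n = M →
      ∀ b ∈ letterSpan F a ^ d,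
        originCoeff φ d M (b * (centralOne e c a ^ m * centralTwo e c a ^ n)) =
          C * (pairRatio (algebraMap F L e) (algebraMap F L c) x y 0 ^ n *
            algebraMap K L (ev 0 b)) := by
  refine ⟨(∏ i ∈ Finset.range M, pairFactor (algebraMap F L e) (algebraMap F L c) x y i 0) *
    ∏ i ∈ Finset.range d, pairWeight (algebraMap F L e) (algebraMap F L c) x y M i,
    mul_ne_zero (Finset.prod_ne_zero_iff.2 fun i _ => h.pairFactor_ne i 0)
      (Finset.prod_ne_zero_iff.2 fun i _ => h.pairWeight_ne M i), ?_⟩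
  rintro m n rfl b hb
  have hc : Commute b (centralOne e c a ^ m * centralTwo e c a ^ n) :=
    ((commute_of_mem_letterSpan_pow (ha.centralOne_comm h2) hb).pow_right m).mul_right
      ((commute_of_mem_letterSpan_pow (ha.centralTwo_comm h2) hb).pow_right n)
  rw [hc.eq, originCoeff_apply, map_mul, Module.End.mul_apply, pairRep_central h hφ, zero_add,
    (pairRep_path hφ hx hev (N := m + n) (fun t j hj => if_neg (by omega)) hb).2 0]
  simp only [zero_add, and_self, if_true, mul_one]
  ring

theorem sum_pow_mul_ne_zero {z : L} (hz : Transcendental K z) {m : ℕ} {u : ℕ → K}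
    (hu : ∃ j ≤ m, u j ≠ 0) :
    ∑ j ∈ Finset.range (m + 1), z ^ j * algebraMap K L (u j) ≠ 0 := by
  obtain ⟨i, hi, hne⟩ := hu
  intro h0
  have h1 : ∑ j ∈ Finset.range (m + 1), Polynomial.monomial j (u j) = 0 := by
    refine transcendental_iff.1 hz _ ?_
    rw [map_sum, ← h0]
    exact Finset.sum_congr rfl fun j _ => by rw [Polynomial.aeval_monomial, mul_comm]
  have h2 := congrArg (Polynomial.coeff · i) h1
  simp only [Polynomial.finsetSum_coeff, Polynomial.coeff_monomial, Polynomial.coeff_zero] at h2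
  rw [Finset.sum_ite_eq' _ i, if_pos (by simpa [Nat.lt_succ_iff] using hi)] at h2
  exact hne h2

theorem centralSum_mul (h2 : (2 : F) ≠ 0) (ha : WordRel e c a) {m m' l' : ℕ} {b b' : ℕ → A}
    (hb' : ∀ j, b' j ∈ letterSpan F a ^ l') :
    centralSum e c a m b * centralSum e c a m' b' =
      ∑ i ∈ Finset.range (m + 1), ∑ j ∈ Finset.range (m' + 1),
        b i * b' j * (centralOne e c a ^ (m - i + (m' - j)) * centralTwo e c a ^ (i + j)) := by
  have hcomm : Commute (centralTwo e c a) (centralOne e c a) :=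
    commute_of_mem_letterSpan_pow (ha.centralOne_comm h2) centralTwo_mem
  rw [centralSum, centralSum, Finset.sum_mul_sum]
  refine Finset.sum_congr rfl fun i _ => Finset.sum_congr rfl fun j _ => ?_
  have hc : Commute (b' j) (centralOne e c a ^ (m - i) * centralTwo e c a ^ i) :=
    ((commute_of_mem_letterSpan_pow (ha.centralOne_comm h2) (hb' j)).pow_right _).mul_right
      ((commute_of_mem_letterSpan_pow (ha.centralTwo_comm h2) (hb' j)).pow_right _)
  rw [mul_assoc, ← mul_assoc _ (b' j), ← hc.eq, mul_assoc (b' j), mul_assoc (b i), pow_add, pow_add,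
    mul_assoc (_ ^ (m - i)), ← mul_assoc (_ ^ i), (hcomm.pow_pow i (m' - j)).eq]
  simp only [mul_assoc]

theorem CurveOrbit.mul_ne_zero [IsAlgClosed F] (hp : GoodParams e c) (ha : WordRel e c a)
    {x : ℤ → K} (hx : CurveOrbit F (algebraMap F K e) (algebraMap F K c) x)
    (h : OrbitPair (algebraMap F L e) (algebraMap F L c) (fun j => algebraMap K L (x j)) y)
    (hz : Transcendental K
      (pairRatio (algebraMap F L e) (algebraMap F L c) (fun j => algebraMap K L (x j)) y 0))
    (hφ : ∀ p q, φ (a p q) =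
      pairOp F (algebraMap F L e) (algebraMap F L c) (fun j => algebraMap K L (x j)) y p q)
    {ev : ℤ → A →ₗ[F] K} (hev : IsWordEval a x ev) (hV : ⨆ n : ℕ, letterSpan F a ^ n = ⊤)
    {s t : A} (hs : s ≠ 0) (ht : t ≠ 0) : s * t ≠ 0 := by
  refine mul_ne_zero_of_leading_parts (L := L) (letterSpan F a) hV ?_ hs ht
  intro n n' u hu u' hu' hu0 hu0'
  have hsum : ∀ (n : ℕ) (u : A), u ∈ letterSpan F a ^ n → u ≠ 0 → ∃ l m b, n = l + 2 * m ∧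
      (∀ j, b j ∈ letterSpan F a ^ l) ∧ u = centralSum e c a m b ∧
      ∀ t : ℤ, ∃ j ≤ m, ev t (b j) ≠ 0 := by
    intro n u hu hu0
    have h1 : centralSum e c a 0 (fun _ => u) = u := by simp [centralSum]
    obtain ⟨l, m, b, hl, hb, hs, j, hj, hbj⟩ :=
      ha.exists_centralSum hp.two_ne n 0 (fun _ => u) (fun _ => hu) (by rwa [h1])
    refine ⟨l, m, b, by simpa using hl, hb, h1 ▸ hs, fun t => ⟨j, hj, fun h0 => hbj ?_⟩⟩
    exact (hx.mem_centralIdeal_iff ha hp hev t (hb j)).2 h0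
  obtain ⟨l, m, b, rfl, hb, rfl, hne⟩ := hsum n u hu hu0
  obtain ⟨l', m', b', rfl, hb', rfl, hne'⟩ := hsum n' u' hu' hu0'
  refine ⟨originCoeff φ (l + l') (m + m'),
    fun d hd v hv => originCoeff_eq_zero hφ (by omega) hv, ?_⟩
  obtain ⟨C, hC, hχ⟩ := exists_originCoeff hp.two_ne ha h hφ (fun _ => rfl) hev (l + l') (m + m')
  rw [centralSum_mul hp.two_ne ha hb', map_sum]
  have hterm : ∀ i ∈ Finset.range (m + 1), originCoeff φ (l + l') (m + m')
      (∑ j ∈ Finset.range (m' + 1), b i * b' j *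
        (centralOne e c a ^ (m - i + (m' - j)) * centralTwo e c a ^ (i + j))) =
      ∑ j ∈ Finset.range (m' + 1), C *
        ((pairRatio (algebraMap F L e) (algebraMap F L c) (fun j => algebraMap K L (x j)) y 0 ^ i *
          algebraMap K L (ev 0 (b i))) *
        (pairRatio (algebraMap F L e) (algebraMap F L c) (fun j => algebraMap K L (x j)) y 0 ^ j *
          algebraMap K L (ev l (b' j)))) := by
    intro i hi
    rw [map_sum]
    refine Finset.sum_congr rfl fun j hj => ?_
    rw [Finset.mem_range] at hi hj
    rw [hχ (m - i + (m' - j)) (i + j) (by omega) _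
      (by rw [pow_add]; exact Submodule.mul_mem_mul (hb i) (hb' j)), hev.mul l 0 (hb i), zero_add,
      map_mul]
    ring
  rw [Finset.sum_congr rfl hterm]
  simp only [← Finset.mul_sum]
  rw [← Finset.sum_mul]
  exact _root_.mul_ne_zero hC
    (_root_.mul_ne_zero (sum_pow_mul_ne_zero hz (hne 0)) (sum_pow_mul_ne_zero hz (hne' l)))

end PairRepresentation

universe u

/-- An algebra generated by four letters subject only to the quadratic relations is a right
Noetherian domain for all parameters in general position. -/
theorem WordRel.isNoetherianRing_op_and_isDomain {F : Type u} [Field F] [IsAlgClosed F]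
    {A : Type*} [Ring A] [Algebra F A] {e c : F} {a : Bool → Bool → A} (h : WordRel e c a)
    (hp : GoodParams e c) (hV : ⨆ n : ℕ, letterSpan F a ^ n = ⊤)
    (hlift : ∀ (B : Type u) [Ring B] [Algebra F B] (b : Bool → Bool → B), WordRel e c b →
      ∃ φ : A →ₐ[F] B, ∀ p q, φ (a p q) = b p q) :
    IsNoetherianRing Aᵐᵒᵖ ∧ IsDomain A := by
  let K := AlgebraicClosure (RatFunc F)
  let L := AlgebraicClosure (RatFunc K)
  have : IsScalarTower F K L := inferInstance
  obtain ⟨x, hx⟩ := exists_curveOrbit F hp.two_ne hp.e_ne hp.c_ne hp.c_ne₁ hp.c_ne₂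
  have hinj : Function.Injective (algebraMap F K) := (algebraMap F K).injective
  obtain ⟨y, hy⟩ : ∃ y : ℤ → L, CurveOrbit K (algebraMap F L e) (algebraMap F L c) y := by
    refine exists_curveOrbit K (e := algebraMap F K e) (c := algebraMap F K c) ?_ ?_ ?_ ?_ ?_
    · rw [← map_ofNat (algebraMap F K)]
      exact (map_ne_zero _).2 hp.two_ne
    · exact (map_ne_zero _).2 hp.e_ne
    · exact (map_ne_zero _).2 hp.c_ne
    · rw [← map_one (algebraMap F K), ← map_add, ← map_pow, ← map_pow]
      exact hinj.ne hp.c_ne₁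
    · rw [← map_one (algebraMap F K), ← map_sub, ← map_pow, ← map_pow]
      exact hinj.ne hp.c_ne₂
  obtain ⟨ψ, hψ⟩ := hlift _ _ hx.wordRel
  obtain ⟨ev, hev⟩ := exists_isWordEval ψ hψ
  have hpair := hx.orbitPair hy hp
  obtain ⟨φ, hφ⟩ := hlift _ _ (hpair.wordRel (F := F))
  refine ⟨isNoetherianRing_op_of_rightGN (letterSpan_fg a) hV ?_, ?_⟩
  · have hbot := isGradedIdeal_bot (letterSpan F a)
    refine RightGN.of_addNormal (letterSpan_fg a) hbot (h.isNormalMod_one hp.two_ne _) two_pos ?_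
    exact RightGN.of_addNormal (letterSpan_fg a) (h.isGradedIdeal_one hp.two_ne)
      (h.isNormalMod_two hp.two_ne _) two_pos (hx.rightGN_centralIdeal h hp hev)
  · have : Nontrivial A := ⟨1, 0, fun h0 => by simpa [h0] using hev.one 0⟩
    have : NoZeroDivisors A := ⟨fun {s t} hst => by
      by_contra! hne
      exact hx.mul_ne_zero hp h hpair (hx.transcendental_pairRatio hy hp) hφ hev hV hne.1 hne.2 hst⟩
    exact NoZeroDivisors.to_isDomain A

section LetterCombinations

variable {F B : Type*} [Field F] [Ring B] [Algebra F B]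

/-- The quadratic relations between letters, in terms of their sums and differences. -/
structure DiagonalRel (e c : F) (s m p n : B) : Prop where
  sub₁ : (e ^ 2 - 1) • (s * m - m * s) = (2 * c) • (p * n + n * p)
  add₁ : (2 * e * c) • (s * m + m * s) = (e ^ 2 - 1) • (p * n - n * p)
  sub₂ : (c * (e - 1)) • (s * p - p * s) = ((e + 1) * (e - 1 - c)) • (n * m + m * n)
  add₂ : ((e + 1) * (e - 1 + c)) • (s * p + p * s) = (c * (e - 1)) • (n * m - m * n)
  sub₃ : (c * (e + 1)) • (s * n - n * s) = ((e - 1) * (e + 1 - c)) • (m * p + p * m)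
  add₃ : ((e - 1) * (e + 1 + c)) • (s * n + n * s) = (-(c * (e + 1))) • (m * p - p * m)

theorem WordRel.diagonalRel {e c : F} {b : Bool → Bool → B} (h : WordRel e c b) :
    DiagonalRel e c (b false false + b true true) (b false false - b true true)
      (b false true + b true false) (b false true - b true false) := by
  obtain ⟨hl, hr, h1, h2⟩ := h
  have hlf := hl false
  have hlt := hl true
  have hrf := hr false
  have hrt := hr true
  simp only [leftCubic, rightCubic, cubicComb, Bool.not_false,
    Bool.not_true] at hlf hlt hrf hrt h1 h2
  constructor <;>
    simp only [mul_add, add_mul, mul_sub, sub_mul]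
  · linear_combination (norm := module) h2 - h1
  · linear_combination (norm := module) h1 + h2
  · linear_combination (norm := module) hrf + hrt - hlf - hlt
  · linear_combination (norm := module) hrf + hrt + hlf + hlt
  · linear_combination (norm := module) hrf - hrt + hlt - hlf
  · linear_combination (norm := module) hrf - hrt - hlt + hlf

theorem DiagonalRel.smul {e c : F} {s m p n : B} (h : DiagonalRel e c s m p n) (r : F) :
    DiagonalRel e c (r • s) (r • m) (r • p) (r • n) := by
  constructor <;> simp only [smul_mul_assoc, mul_smul_comm]
  · linear_combination (norm := module) (r * r) • h.sub₁
  · linear_combination (norm := module) (r * r) • h.add₁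
  · linear_combination (norm := module) (r * r) • h.sub₂
  · linear_combination (norm := module) (r * r) • h.add₂
  · linear_combination (norm := module) (r * r) • h.sub₃
  · linear_combination (norm := module) (r * r) • h.add₃

/-- The letters with given sums and differences, up to a factor of two. -/
def diagonalLetter (s m p n : B) : Bool → Bool → B
  | false, false => s + m
  | true, true => s - m
  | false, true => p + n
  | true, false => p - n

theorem DiagonalRel.wordRel {e c : F} {s m p n : B} (h : DiagonalRel e c s m p n) :
    WordRel e c (diagonalLetter s m p n) := by
  obtain ⟨h1, h2, h3, h4, h5, h6⟩ := h
  simp only [mul_add, add_mul, mul_sub, sub_mul] at h1 h2 h3 h4 h5 h6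
  have hl : leftCubic e c (diagonalLetter s m p n) true false = 0 ∧
      leftCubic e c (diagonalLetter s m p n) false true = 0 ∧
      rightCubic e c (diagonalLetter s m p n) false true = 0 ∧
      rightCubic e c (diagonalLetter s m p n) true false = 0 ∧
      leftCubic e c (diagonalLetter s m p n) false false =
        leftCubic e c (diagonalLetter s m p n) true true ∧
      rightCubic e c (diagonalLetter s m p n) false false =
        rightCubic e c (diagonalLetter s m p n) true true := by
    simp only [leftCubic, rightCubic, cubicComb, diagonalLetter, Bool.not_false, Bool.not_true,
      mul_add, add_mul, mul_sub, sub_mul]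
    refine ⟨?_, ?_, ?_, ?_, ?_, ?_⟩
    · linear_combination (norm := module) h4 - h3 + h5 - h6
    · linear_combination (norm := module) h4 - h3 - h5 + h6
    · linear_combination (norm := module) h4 + h3 + h5 + h6
    · linear_combination (norm := module) h4 + h3 - h5 - h6
    · linear_combination (norm := module) (2 : F) • (h2 - h1)
    · linear_combination (norm := module) (2 : F) • (h2 + h1)
  obtain ⟨hlt, hlf, hrf, hrt, hle, hre⟩ := hl
  refine ⟨?_, ?_, hle, hre⟩ <;> rintro (_ | _) <;> assumption

end LetterCombinations

section Presentation

variable {F : Type u} [Field F]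

/-- The six quadratic relations. -/
structure FourRel {B : Type*} [Ring B] [Algebra F B] (α β γ : F) (x₀ x₁ x₂ x₃ : B) : Prop where
  sub₁ : x₀ * x₁ - x₁ * x₀ = α • (x₂ * x₃ + x₃ * x₂)
  add₁ : x₀ * x₁ + x₁ * x₀ = x₂ * x₃ - x₃ * x₂
  sub₂ : x₀ * x₂ - x₂ * x₀ = β • (x₃ * x₁ + x₁ * x₃)
  add₂ : x₀ * x₂ + x₂ * x₀ = x₃ * x₁ - x₁ * x₃
  sub₃ : x₀ * x₃ - x₃ * x₀ = γ • (x₁ * x₂ + x₂ * x₁)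
  add₃ : x₀ * x₃ + x₃ * x₀ = x₁ * x₂ - x₂ * x₁

/-- An algebra with four generators subject only to the six quadratic relations. -/
structure IsFourAlgebra (α β γ : F) {A : Type u} [Ring A] [Algebra F A] (x₀ x₁ x₂ x₃ : A) :
    Prop where
  rel : FourRel α β γ x₀ x₁ x₂ x₃
  generate : ∀ S : Subalgebra F A, x₀ ∈ S → x₁ ∈ S → x₂ ∈ S → x₃ ∈ S → S = ⊤
  lift : ∀ {B : Type u} [Ring B] [Algebra F B] {y₀ y₁ y₂ y₃ : B}, FourRel α β γ y₀ y₁ y₂ y₃ →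
    ∃ φ : A →ₐ[F] B, φ x₀ = y₀ ∧ φ x₁ = y₁ ∧ φ x₂ = y₂ ∧ φ x₃ = y₃

theorem FourRel.cycle {B : Type*} [Ring B] [Algebra F B] {α β γ : F} {x₀ x₁ x₂ x₃ : B}
    (h : FourRel α β γ x₀ x₁ x₂ x₃) : FourRel β γ α x₀ x₂ x₃ x₁ :=
  ⟨h.sub₂, h.add₂, h.sub₃, h.add₃, h.sub₁, h.add₁⟩

theorem FourRel.op {B : Type*} [Ring B] [Algebra F B] {α β γ : F} {x₀ x₁ x₂ x₃ : B}
    (h : FourRel α β γ x₀ x₁ x₂ x₃) :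
    FourRel α β γ (MulOpposite.op (-x₀)) (MulOpposite.op x₁) (MulOpposite.op x₂)
      (MulOpposite.op x₃) := by
  constructor <;> rw [← MulOpposite.unop_inj] <;>
    simp only [MulOpposite.unop_sub, MulOpposite.unop_add, MulOpposite.unop_mul,
      MulOpposite.unop_smul, MulOpposite.unop_op, mul_neg, neg_mul]
  · rw [add_comm (x₃ * x₂), ← h.sub₁]; abel
  · rw [← neg_sub (x₂ * x₃), ← h.add₁]; abel
  · rw [add_comm (x₁ * x₃), ← h.sub₂]; abel
  · rw [← neg_sub (x₃ * x₁), ← h.add₂]; abel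
  · rw [add_comm (x₂ * x₁), ← h.sub₃]; abel
  · rw [← neg_sub (x₁ * x₂), ← h.add₃]; abel

variable {α β γ : F} {A : Type u} [Ring A] [Algebra F A] {x₀ x₁ x₂ x₃ : A}

theorem IsFourAlgebra.cycle (h : IsFourAlgebra α β γ x₀ x₁ x₂ x₃) :
    IsFourAlgebra β γ α x₀ x₂ x₃ x₁ where
  rel := h.rel.cycle
  generate S h0 h1 h2 h3 := h.generate S h0 h3 h1 h2
  lift hy := by
    obtain ⟨φ, h0, h1, h2, h3⟩ := h.lift hy.cycle.cycle
    exact ⟨φ, h0, h2, h3, h1⟩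

theorem IsFourAlgebra.op (h : IsFourAlgebra α β γ x₀ x₁ x₂ x₃) :
    IsFourAlgebra α β γ (MulOpposite.op (-x₀)) (MulOpposite.op x₁) (MulOpposite.op x₂)
      (MulOpposite.op x₃) where
  rel := h.rel.op
  generate S h0 h1 h2 h3 := by
    have h4 := h.generate S.unop (by simpa using neg_mem h0) h1 h2 h3
    refine Algebra.eq_top_iff.2 fun x => ?_
    have h5 : x.unop ∈ S.unop := h4 ▸ Algebra.mem_top
    exact h5
  lift {B _ _ y₀ y₁ y₂ y₃} hy := by
    obtain ⟨φ, h0, h1, h2, h3⟩ := h.lift hy.op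
    refine ⟨AlgHom.opComm φ, ?_, ?_, ?_, ?_⟩ <;> simp [*]

/-- The powers of a space of generators span the algebra. -/
theorem iSup_pow_eq_top {V : Submodule F A}
    (hV : ∀ S : Subalgebra F A, V ≤ Subalgebra.toSubmodule S → S = ⊤) :
    ⨆ n : ℕ, V ^ n = ⊤ := by
  have h1 : (1 : A) ∈ ⨆ n : ℕ, V ^ n :=
    le_iSup (fun n : ℕ => V ^ n) 0 (one_mem_pow_zero V)
  have hmul : ∀ x y, x ∈ ⨆ n : ℕ, V ^ n → y ∈ ⨆ n : ℕ, V ^ n → x * y ∈ ⨆ n : ℕ, V ^ n := by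
    intro x y hx hy
    have hle : (⨆ n : ℕ, V ^ n) * (⨆ n : ℕ, V ^ n) ≤ ⨆ n : ℕ, V ^ n := by
      rw [Submodule.iSup_mul]
      refine iSup_le fun n => ?_
      rw [Submodule.mul_iSup]
      refine iSup_le fun m => ?_
      rw [← pow_add]
      exact le_iSup (fun n : ℕ => V ^ n) (n + m)
    exact hle (Submodule.mul_mem_mul hx hy)
  have h2 := hV ((⨆ n : ℕ, V ^ n).toSubalgebra h1 hmul) fun x hx =>
    (le_iSup (fun n : ℕ => V ^ n) 1) (by simpa using hx)
  have h3 := congrArg Subalgebra.toSubmodule h2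
  simpa using h3

end Presentation

section GenericParameters

variable {F : Type u} [Field F]

theorem exists_quadratic_root [IsAlgClosed F] (h2 : (2 : F) ≠ 0) {p q : F} (hp : p ≠ 0) :
    ∃ e : F, e ≠ 0 ∧ p * e ^ 2 + q * e + p = 0 := by
  have : NeZero (2 : F) := ⟨h2⟩
  obtain ⟨s, hs⟩ := IsAlgClosed.exists_eq_mul_self (discrim p q p)
  obtain ⟨e, he⟩ := exists_quadratic_eq_zero hp ⟨s, hs⟩
  refine ⟨e, ?_, by linear_combination he⟩
  rintro rfl
  exact hp (by linear_combination he)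

theorem exists_modulus [IsAlgClosed F] (h2 : (2 : F) ≠ 0) {α β γ : F}
    (hS : α + β + γ + α * β * γ = 0) (h1 : ¬(α = -1 ∧ β = 1)) (h2' : ¬(β = -1 ∧ γ = 1))
    (h3 : ¬(α = 1 ∧ γ = -1)) (hα : α ≠ 0) :
    ∃ e : F, e ≠ 0 ∧ e ^ 2 ≠ 1 ∧ α * (β * (e - 1) ^ 2 + (e + 1) ^ 2) = 4 * e ∧
      α * (γ * (e + 1) ^ 2 - (e - 1) ^ 2) = -4 * e := by
  have h4 : (4 : F) ≠ 0 := by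
    rw [show (4 : F) = 2 * 2 by norm_num]
    exact mul_ne_zero h2 h2
  by_cases hβ : β = -1
  · subst hβ
    have hγ : γ - 1 ≠ 0 := fun h => h2' ⟨rfl, sub_eq_zero.1 h⟩
    obtain rfl : α = 1 := by
      have : (γ - 1) * (α - 1) = 0 := by linear_combination -hS
      exact sub_eq_zero.1 ((mul_eq_zero.1 this).resolve_left hγ)
    obtain ⟨e, he, hq⟩ := exists_quadratic_root h2 (q := 2 * γ + 6) hγ
    refine ⟨e, he, fun h => ?_, by ring, by linear_combination hq⟩
    have h5 : (e - 1) * (e + 1) = 0 := by linear_combination h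
    rcases mul_eq_zero.1 h5 with h6 | h6
    · obtain rfl := sub_eq_zero.1 h6
      exact h3 ⟨rfl, mul_left_cancel₀ h4 (by linear_combination hq)⟩
    · obtain rfl := eq_neg_of_add_eq_zero_left h6
      exact mul_ne_zero h2 h4 (by linear_combination -hq)
  · have hβ' : α * (β + 1) ≠ 0 := mul_ne_zero hα fun h => hβ (eq_neg_of_add_eq_zero_left h)
    have hαβ : 1 + α * β ≠ 0 := by
      intro h
      have h5 : α + β = 0 := by linear_combination hS - γ * h
      have h6 : (β + 1) * (β - 1) = 0 := by linear_combination β * h5 - h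
      rcases mul_eq_zero.1 h6 with h7 | h7
      · exact hβ (eq_neg_of_add_eq_zero_left h7)
      · exact h1 ⟨by linear_combination h5 - h7, sub_eq_zero.1 h7⟩
    obtain ⟨e, he, hq⟩ := exists_quadratic_root h2 (q := α * (2 - 2 * β) - 4) hβ'
    have hR : α * (β * (e - 1) ^ 2 + (e + 1) ^ 2) = 4 * e := by linear_combination hq
    refine ⟨e, he, fun h => ?_, hR, ?_⟩
    · have h5 : (e - 1) * (e + 1) = 0 := by linear_combination h
      rcases mul_eq_zero.1 h5 with h6 | h6
      · obtain rfl := sub_eq_zero.1 h6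
        obtain rfl : α = 1 := mul_left_cancel₀ h4 (by linear_combination hR)
        have h7 : (1 + β) * (1 + γ) = 0 := by linear_combination hS
        rcases mul_eq_zero.1 h7 with h8 | h8
        · exact hβ (by linear_combination h8)
        · exact h3 ⟨rfl, by linear_combination h8⟩
      · obtain rfl := eq_neg_of_add_eq_zero_left h6
        exact hαβ (mul_left_cancel₀ h4 (by linear_combination hR))
    · refine mul_left_cancel₀ hαβ ?_
      linear_combination (-α - 1) * hR + α * (e + 1) ^ 2 * hS

/-- Parameters of the quadratic relations between letters, with the scalings of the sums and
differences of letters that turn them into the six relations. -/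
structure ScaledParams (α β γ e c l₁ l₂ l₃ : F) : Prop where
  good : GoodParams e c
  ne₁ : l₁ ≠ 0
  ne₂ : l₂ ≠ 0
  ne₃ : l₃ ≠ 0
  add₁ : 2 * e * c * (l₂ * l₃) = l₁ * (e ^ 2 - 1)
  add₂ : (e + 1) * (e - 1 + c) * (l₃ * l₁) = l₂ * (c * (e - 1))
  add₃ : (e - 1) * (e + 1 + c) * (l₁ * l₂) = l₃ * -(c * (e + 1))
  sub₁ : (e ^ 2 - 1) * (α * (l₂ * l₃)) = l₁ * (2 * c)
  sub₂ : c * (e - 1) * (β * (l₃ * l₁)) = l₂ * ((e + 1) * (e - 1 - c))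
  sub₃ : c * (e + 1) * (γ * (l₁ * l₂)) = l₃ * ((e - 1) * (e + 1 - c))

theorem exists_scaledParams [IsAlgClosed F] (h2 : (2 : F) ≠ 0) {α β γ : F}
    (hS : α + β + γ + α * β * γ = 0) (h1 : ¬(α = -1 ∧ β = 1)) (h2' : ¬(β = -1 ∧ γ = 1))
    (h3 : ¬(α = 1 ∧ γ = -1)) (hα : α ≠ 0) (hβ : β ≠ 0) (hγ : γ ≠ 0) :
    ∃ e c l₁ l₂ l₃ : F, ScaledParams α β γ e c l₁ l₂ l₃ := by
  obtain ⟨e, he, he1, hR, hR'⟩ := exists_modulus h2 hS h1 h2' h3 hα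
  have h4 : (4 : F) ≠ 0 := by
    rw [show (4 : F) = 2 * 2 by norm_num]
    exact mul_ne_zero h2 h2
  have hE : e ^ 2 - 1 ≠ 0 := sub_ne_zero.2 he1
  have hem : e - 1 ≠ 0 := fun h => hE (by linear_combination (e + 1) * h)
  have hep : e + 1 ≠ 0 := fun h => hE (by linear_combination (e - 1) * h)
  obtain ⟨c, hc⟩ := IsAlgClosed.exists_pow_nat_eq (α * (e ^ 2 - 1) ^ 2 / (4 * e)) two_pos
  have hα' : α * (e ^ 2 - 1) ^ 2 = 4 * e * c ^ 2 := by
    rw [hc]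
    field_simp
  have hc0 : c ≠ 0 := by
    rintro rfl
    exact mul_ne_zero hα (pow_ne_zero 2 hE) (by linear_combination hα')
  have hβ' : β * c ^ 2 * (e - 1) ^ 2 = (e + 1) ^ 2 * ((e - 1) ^ 2 - c ^ 2) := by
    refine mul_left_cancel₀ hα ?_
    linear_combination c ^ 2 * hR - hα'
  have hγ' : γ * c ^ 2 * (e + 1) ^ 2 = -((e - 1) ^ 2 * ((e + 1) ^ 2 - c ^ 2)) := by
    refine mul_left_cancel₀ hα ?_
    linear_combination c ^ 2 * hR' + hα'
  have hgood : GoodParams e c := by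
    refine ⟨h2, he, hc0, he1, fun h => ?_, fun h => ?_⟩
    · refine mul_ne_zero (mul_ne_zero hγ (pow_ne_zero 2 hc0)) (pow_ne_zero 2 hep) ?_
      linear_combination hγ' + (e - 1) ^ 2 * h
    · refine mul_ne_zero (mul_ne_zero hβ (pow_ne_zero 2 hc0)) (pow_ne_zero 2 hem) ?_
      linear_combination hβ' - (e + 1) ^ 2 * h
  have hmc : e - 1 + c ≠ 0 := fun h => hgood.c_ne₂ (by linear_combination (c + 1 - e) * h)
  have hpc : e + 1 + c ≠ 0 := fun h => hgood.c_ne₁ (by linear_combination (c - 1 - e) * h)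
  set b₁ := (e ^ 2 - 1) / (2 * e * c) with hb₁
  set b₂ := c * (e - 1) / ((e + 1) * (e - 1 + c)) with hb₂
  set b₃ := -(c * (e + 1)) / ((e - 1) * (e + 1 + c)) with hb₃
  have hb₁0 : b₁ ≠ 0 := div_ne_zero hE (mul_ne_zero (mul_ne_zero h2 he) hc0)
  have hb₂0 : b₂ ≠ 0 := div_ne_zero (mul_ne_zero hc0 hem) (mul_ne_zero hep hmc)
  have hb₃0 : b₃ ≠ 0 := div_ne_zero (neg_ne_zero.2 (mul_ne_zero hc0 hep)) (mul_ne_zero hem hpc)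
  have hd₁ : 2 * e * c * b₁ = e ^ 2 - 1 := by rw [hb₁]; field_simp
  have hd₂ : (e + 1) * (e - 1 + c) * b₂ = c * (e - 1) := by rw [hb₂]; field_simp
  have hd₃ : (e - 1) * (e + 1 + c) * b₃ = -(c * (e + 1)) := by rw [hb₃]; field_simp
  clear_value b₁ b₂ b₃
  obtain ⟨l₁, hl₁⟩ := IsAlgClosed.exists_pow_nat_eq (b₂ * b₃) two_pos
  obtain ⟨l₂, hl₂⟩ := IsAlgClosed.exists_pow_nat_eq (b₁ * b₃) two_pos
  have hl₁0 : l₁ ≠ 0 := by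
    rintro rfl
    exact mul_ne_zero hb₂0 hb₃0 (by rw [← hl₁]; ring)
  have hl₂0 : l₂ ≠ 0 := by
    rintro rfl
    exact mul_ne_zero hb₁0 hb₃0 (by rw [← hl₂]; ring)
  obtain ⟨l₃, hl₃⟩ : ∃ l₃, l₂ * l₃ = l₁ * b₁ := ⟨l₁ * b₁ / l₂, by field_simp⟩
  have h31 : l₃ * l₁ = l₂ * b₂ := by
    refine mul_left_cancel₀ hl₂0 ?_
    linear_combination l₁ * hl₃ + b₁ * hl₁ - b₂ * hl₂
  have h12 : l₁ * l₂ = l₃ * b₃ := by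
    refine mul_left_cancel₀ hl₂0 ?_
    linear_combination l₁ * hl₂ - b₃ * hl₃
  have hl₃0 : l₃ ≠ 0 := by
    rintro rfl
    exact mul_ne_zero hl₁0 hb₁0 (by rw [← hl₃, mul_zero])
  refine ⟨e, c, l₁, l₂, l₃, hgood, hl₁0, hl₂0, hl₃0, ?_, ?_, ?_, ?_, ?_, ?_⟩
  · rw [hl₃, ← hd₁]; ring
  · rw [h31, ← hd₂]; ring
  · rw [h12, ← hd₃]; ring
  · refine mul_left_cancel₀ (mul_ne_zero (mul_ne_zero h2 he) hc0) ?_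
    linear_combination 2 * e * c * (e ^ 2 - 1) * α * hl₃ + (e ^ 2 - 1) * α * l₁ * hd₁ + l₁ * hα'
  · refine mul_left_cancel₀ (mul_ne_zero hep hmc) ?_
    linear_combination (e + 1) * (e - 1 + c) * c * (e - 1) * β * h31 +
      c * (e - 1) * β * l₂ * hd₂ + l₂ * hβ'
  · refine mul_left_cancel₀ (mul_ne_zero hem hpc) ?_
    linear_combination (e - 1) * (e + 1 + c) * c * (e + 1) * γ * h12 +
      c * (e + 1) * γ * l₃ * hd₃ - l₃ * hγ'

theorem smul_eq_smul_of_mul_eq {B : Type*} [AddCommGroup B] [Module F B] {k l r t : F} {x y : B}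
    (hk : k ≠ 0) (h : k • x = l • y) (hkt : k * t = r * l) : r • x = t • y := by
  refine smul_right_injective B hk ?_
  simp only
  rw [smul_comm, h, smul_smul, smul_smul, hkt]

section Translation

variable {α β γ e c l₁ l₂ l₃ : F} {B : Type*} [Ring B] [Algebra F B] {s m p n : B}

theorem ScaledParams.ne (h : ScaledParams α β γ e c l₁ l₂ l₃) :
    e ^ 2 - 1 ≠ 0 ∧ 2 * e * c ≠ 0 ∧ c * (e - 1) ≠ 0 ∧ (e + 1) * (e - 1 + c) ≠ 0 ∧
      c * (e + 1) ≠ 0 ∧ (e - 1) * (e + 1 + c) ≠ 0 := by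
  have hg := h.good
  have hE : e ^ 2 - 1 ≠ 0 := sub_ne_zero.2 hg.sq_ne
  have hem : e - 1 ≠ 0 := fun h => hE (by linear_combination (e + 1) * h)
  have hep : e + 1 ≠ 0 := fun h => hE (by linear_combination (e - 1) * h)
  exact ⟨hE, mul_ne_zero (mul_ne_zero hg.two_ne hg.e_ne) hg.c_ne, mul_ne_zero hg.c_ne hem,
    mul_ne_zero hep fun h => hg.c_ne₂ (by linear_combination (c + 1 - e) * h),
    mul_ne_zero hg.c_ne hep,
    mul_ne_zero hem fun h => hg.c_ne₁ (by linear_combination (c - 1 - e) * h)⟩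

theorem ScaledParams.fourRel (h : ScaledParams α β γ e c l₁ l₂ l₃)
    (hd : DiagonalRel e c s m p n) : FourRel α β γ s (l₁ • m) (l₂ • p) (l₃ • n) := by
  obtain ⟨n1, n2, n3, n4, n5, n6⟩ := h.ne
  constructor <;> simp only [smul_mul_assoc, mul_smul_comm]
  · linear_combination (norm := module) smul_eq_smul_of_mul_eq n1 hd.sub₁ h.sub₁
  · linear_combination (norm := module) smul_eq_smul_of_mul_eq n2 hd.add₁ h.add₁
  · linear_combination (norm := module) smul_eq_smul_of_mul_eq n3 hd.sub₂ h.sub₂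
  · linear_combination (norm := module) smul_eq_smul_of_mul_eq n4 hd.add₂ h.add₂
  · linear_combination (norm := module) smul_eq_smul_of_mul_eq n5 hd.sub₃ h.sub₃
  · linear_combination (norm := module) smul_eq_smul_of_mul_eq n6 hd.add₃ h.add₃

theorem ScaledParams.diagonalRel (h : ScaledParams α β γ e c l₁ l₂ l₃)
    (hd : FourRel α β γ s (l₁ • m) (l₂ • p) (l₃ • n)) : DiagonalRel e c s m p n := by
  obtain ⟨h1, h2, h3, h4, h5, h6⟩ := hd
  simp only [smul_mul_assoc, mul_smul_comm] at h1 h2 h3 h4 h5 h6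
  constructor
  · refine smul_eq_smul_of_mul_eq h.ne₁ (l := α * (l₂ * l₃)) ?_ h.sub₁.symm
    linear_combination (norm := module) h1
  · refine smul_eq_smul_of_mul_eq h.ne₁ (l := l₂ * l₃) ?_ h.add₁.symm
    linear_combination (norm := module) h2
  · refine smul_eq_smul_of_mul_eq h.ne₂ (l := β * (l₃ * l₁)) ?_ h.sub₂.symm
    linear_combination (norm := module) h3
  · refine smul_eq_smul_of_mul_eq h.ne₂ (l := l₃ * l₁) ?_ h.add₂.symm
    linear_combination (norm := module) h4
  · refine smul_eq_smul_of_mul_eq h.ne₃ (l := γ * (l₁ * l₂)) ?_ h.sub₃.symm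
    linear_combination (norm := module) h5
  · refine smul_eq_smul_of_mul_eq h.ne₃ (l := l₁ * l₂) ?_ h.add₃.symm
    linear_combination (norm := module) h6

end Translation

theorem IsFourAlgebra.isNoetherianRing_op_and_isDomain_of_ne_zero [IsAlgClosed F]
    (h2 : (2 : F) ≠ 0) {α β γ : F} {A : Type u} [Ring A] [Algebra F A] {x₀ x₁ x₂ x₃ : A}
    (h : IsFourAlgebra α β γ x₀ x₁ x₂ x₃)
    (hS : α + β + γ + α * β * γ = 0) (h1 : ¬(α = -1 ∧ β = 1)) (h2' : ¬(β = -1 ∧ γ = 1))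
    (h3 : ¬(α = 1 ∧ γ = -1)) (hα : α ≠ 0) (hβ : β ≠ 0) (hγ : γ ≠ 0) :
    IsNoetherianRing Aᵐᵒᵖ ∧ IsDomain A := by
  obtain ⟨e, c, l₁, l₂, l₃, hp⟩ := exists_scaledParams h2 hS h1 h2' h3 hα hβ hγ
  have hrel : FourRel α β γ x₀ (l₁ • l₁⁻¹ • x₁) (l₂ • l₂⁻¹ • x₂) (l₃ • l₃⁻¹ • x₃) := by
    rw [smul_inv_smul₀ hp.ne₁, smul_inv_smul₀ hp.ne₂, smul_inv_smul₀ hp.ne₃]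
    exact h.rel
  have hhalf : ∀ {B : Type u} [Ring B] [Algebra F B] (x y : B),
      (2⁻¹ : F) • (x + y) + (2⁻¹ : F) • (x - y) = x ∧
      (2⁻¹ : F) • (x + y) - (2⁻¹ : F) • (x - y) = y := by
    intro B _ _ x y
    have h22 : (2⁻¹ : F) * 2 = 1 := inv_mul_cancel₀ h2
    constructor
    · rw [show (2⁻¹ : F) • (x + y) + (2⁻¹ : F) • (x - y) = (2⁻¹ * 2 : F) • x by module, h22,
        one_smul]
    · rw [show (2⁻¹ : F) • (x + y) - (2⁻¹ : F) • (x - y) = (2⁻¹ * 2 : F) • y by module, h22,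
        one_smul]
  refine (hp.diagonalRel hrel).wordRel.isNoetherianRing_op_and_isDomain hp.good
    (iSup_pow_eq_top fun S hVS => ?_) fun B _ _ b hb => ?_
  · have hmem : ∀ p q, diagonalLetter x₀ (l₁⁻¹ • x₁) (l₂⁻¹ • x₂) (l₃⁻¹ • x₃) p q ∈ S :=
      fun p q => hVS (mem_letterSpan _ p q)
    have hcomb : ∀ x y : A, x + y ∈ S → x - y ∈ S → x ∈ S ∧ y ∈ S := by
      intro x y hxy hxy'
      have h5 := S.smul_mem hxy (2⁻¹ : F)
      have h6 := S.smul_mem hxy' (2⁻¹ : F)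
      have h7 := hhalf x y
      exact ⟨h7.1 ▸ add_mem h5 h6, h7.2 ▸ sub_mem h5 h6⟩
    have hsm := hcomb _ _ (hmem false false) (hmem true true)
    have hpn := hcomb _ _ (hmem false true) (hmem true false)
    refine h.generate S hsm.1 ?_ ?_ ?_
    · exact smul_inv_smul₀ hp.ne₁ x₁ ▸ S.smul_mem hsm.2 l₁
    · exact smul_inv_smul₀ hp.ne₂ x₂ ▸ S.smul_mem hpn.1 l₂
    · exact smul_inv_smul₀ hp.ne₃ x₃ ▸ S.smul_mem hpn.2 l₃
  · obtain ⟨φ, h0, h1, h2, h3⟩ := h.lift (hp.fourRel (hb.diagonalRel.smul 2⁻¹))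
    refine ⟨φ, fun p q => ?_⟩
    have hd := hhalf (b false false) (b true true)
    have ho := hhalf (b false true) (b true false)
    cases p <;> cases q <;> simp only [diagonalLetter, map_add, map_sub, map_smul, h0, h1, h2, h3,
      inv_smul_smul₀ hp.ne₁, inv_smul_smul₀ hp.ne₂, inv_smul_smul₀ hp.ne₃]
    exacts [hd.1, ho.1, ho.2, hd.2]

end GenericParameters

section GeneralizedWeyl

variable {F R : Type*} [Field F] [CommRing R] [Algebra F R]

/-- Multiplication by `r` on sequences, twisted by the powers of an automorphism. -/
def twistedMul (θ : R ≃ₐ[F] R) : R →ₐ[F] Module.End F (ℤ → R) :=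
  (Algebra.lmul F (ℤ → R)).comp (AlgHom.pi fun n : ℤ => ((θ ^ n : R ≃ₐ[F] R) : R →ₐ[F] R))

theorem twistedMul_apply (θ : R ≃ₐ[F] R) (r : R) (f : ℤ → R) (n : ℤ) :
    twistedMul θ r f n = (θ ^ n) r * f n := rfl

variable (F R) in
/-- The shift of sequences. -/
def shiftUp : Module.End F (ℤ → R) := LinearMap.funLeft F R fun n : ℤ => n + 1

theorem shiftUp_apply (f : ℤ → R) (n : ℤ) : shiftUp F R f n = f (n + 1) := rfl

/-- The backward shift of sequences, followed by a twisted multiplication. -/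
def shiftDown (θ : R ≃ₐ[F] R) (Z : R) : Module.End F (ℤ → R) :=
  twistedMul θ Z * LinearMap.funLeft F R fun n : ℤ => n - 1

theorem shiftDown_apply (θ : R ≃ₐ[F] R) (Z : R) (f : ℤ → R) (n : ℤ) :
    shiftDown θ Z f n = (θ ^ n) Z * f (n - 1) := rfl

theorem shiftUp_mul_twistedMul (θ : R ≃ₐ[F] R) (r : R) :
    shiftUp F R * twistedMul θ r = twistedMul θ (θ r) * shiftUp F R := by
  refine LinearMap.ext fun f => funext fun n => ?_
  simp only [Module.End.mul_apply, shiftUp_apply, twistedMul_apply, zpow_add_one,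
    AlgEquiv.mul_apply]

theorem shiftDown_mul_twistedMul (θ : R ≃ₐ[F] R) (Z r : R) :
    shiftDown θ Z * twistedMul θ r = twistedMul θ (θ.symm r) * shiftDown θ Z := by
  refine LinearMap.ext fun f => funext fun n => ?_
  have h : (θ ^ (n - 1)) r = (θ ^ n) (θ.symm r) := by
    rw [zpow_sub_one, AlgEquiv.mul_apply]
    rfl
  simp only [Module.End.mul_apply, shiftDown_apply, twistedMul_apply, h]
  ring

theorem shiftUp_mul_shiftDown (θ : R ≃ₐ[F] R) (Z : R) :
    shiftUp F R * shiftDown θ Z = twistedMul θ (θ Z) := by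
  refine LinearMap.ext fun f => funext fun n => ?_
  simp only [Module.End.mul_apply, shiftUp_apply, shiftDown_apply, twistedMul_apply, zpow_add_one,
    AlgEquiv.mul_apply, add_sub_cancel_right]

theorem shiftDown_mul_shiftUp (θ : R ≃ₐ[F] R) (Z : R) :
    shiftDown θ Z * shiftUp F R = twistedMul θ Z := by
  refine LinearMap.ext fun f => funext fun n => ?_
  simp only [Module.End.mul_apply, shiftUp_apply, shiftDown_apply, twistedMul_apply,
    sub_add_cancel]

/-- The first nonvanishing entry of a sequence moves by exactly `N` places. -/
def HasOrder (T : Module.End F (ℤ → R)) (N : ℤ) : Prop :=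
  ∀ f : ℤ → R, ∀ m, f m ≠ 0 → (∀ l < m, f l = 0) → T f (m - N) ≠ 0 ∧ ∀ l < m - N, T f l = 0

theorem HasOrder.mul {S T : Module.End F (ℤ → R)} {M N : ℤ} (hS : HasOrder S M)
    (hT : HasOrder T N) : HasOrder (S * T) (N + M) := by
  intro f m h0 hl
  obtain ⟨h1, h2⟩ := hT f m h0 hl
  simpa only [Module.End.mul_apply, sub_add_eq_sub_sub] using hS _ _ h1 h2

theorem HasOrder.ne_zero [Nontrivial R] {T : Module.End F (ℤ → R)} {N : ℤ} (hT : HasOrder T N) :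
    T ≠ 0 := by
  rintro rfl
  refine (hT (Pi.single 0 1) 0 (by simp) fun l hl => ?_).1 rfl
  rw [Pi.single_eq_of_ne hl.ne]

variable {A : Type*} [Ring A] [Algebra F A]

/-- The defining relations of a generalized Weyl algebra. -/
structure IsGeneralizedWeyl (θ : R ≃ₐ[F] R) (Z : R) (d : R →ₐ[F] A) (w t : A) : Prop where
  up : ∀ r, w * d r = d (θ r) * w
  down : ∀ r, t * d r = d (θ.symm r) * t
  down_up : t * w = d Z
  up_down : w * t = d (θ Z)

/-- The monomials of positive and negative degree in the two shifts. -/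
def shiftPow (w t : A) : ℤ → A
  | .ofNat n => w ^ n
  | .negSucc n => t ^ (n + 1)

/-- The linear map that writes an element in terms of its homogeneous coefficients. -/
def homogeneousSum (d : R →ₐ[F] A) (w t : A) : (ℤ →₀ R) →ₗ[F] A :=
  Finsupp.lsum F fun n => (LinearMap.mulRight F (shiftPow w t n)).comp d.toLinearMap

theorem homogeneousSum_single (d : R →ₐ[F] A) (w t : A) (n : ℤ) (r : R) :
    homogeneousSum d w t (Finsupp.single n r) = d r * shiftPow w t n := by
  simp [homogeneousSum]

theorem homogeneousSum_apply (d : R →ₐ[F] A) (w t : A) (h : ℤ →₀ R) :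
    homogeneousSum d w t h = ∑ n ∈ h.support, d (h n) * shiftPow w t n := by
  simp [homogeneousSum, Finsupp.sum]

variable {θ : R ≃ₐ[F] R} {Z : R} {d : R →ₐ[F] A} {w t : A}

theorem IsGeneralizedWeyl.up_shiftPow (h : IsGeneralizedWeyl θ Z d w t) :
    ∀ n, ∃ r m, w * shiftPow w t n = d r * shiftPow w t m
  | .ofNat n => ⟨1, .ofNat (n + 1), by simp [shiftPow, pow_succ']⟩
  | .negSucc 0 => ⟨θ Z, .ofNat 0, by simp [shiftPow, h.up_down]⟩
  | .negSucc (n + 1) => ⟨θ Z, .negSucc n, by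
      simp only [shiftPow]
      rw [pow_succ' t (n + 1), ← mul_assoc, h.up_down]⟩

theorem IsGeneralizedWeyl.down_shiftPow (h : IsGeneralizedWeyl θ Z d w t) :
    ∀ n, ∃ r m, t * shiftPow w t n = d r * shiftPow w t m
  | .ofNat 0 => ⟨1, .negSucc 0, by simp [shiftPow]⟩
  | .ofNat (n + 1) => ⟨Z, .ofNat n, by
      simp only [shiftPow]
      rw [pow_succ' w n, ← mul_assoc, h.down_up]⟩
  | .negSucc n => ⟨1, .negSucc (n + 1), by simp [shiftPow, pow_succ' t (n + 1)]⟩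

theorem IsGeneralizedWeyl.homogeneousSum_surjective (h : IsGeneralizedWeyl θ Z d w t)
    (hgen : ∀ S : Subalgebra F A, (∀ r, d r ∈ S) → w ∈ S → t ∈ S → S = ⊤) (a : A) :
    ∃ g, homogeneousSum d w t g = a := by
  let W : Submodule F A := LinearMap.range (homogeneousSum d w t)
  have hW : ∀ r n, d r * shiftPow w t n ∈ W := fun r n => ⟨_, homogeneousSum_single d w t n r⟩
  let S : Subalgebra F A :=
    { carrier := {x | ∀ b ∈ W, x * b ∈ W}
      mul_mem' := fun {x y} hx hy b hb => by rw [mul_assoc]; exact hx _ (hy b hb)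
      add_mem' := fun {x y} hx hy b hb => by rw [add_mul]; exact add_mem (hx b hb) (hy b hb)
      algebraMap_mem' := fun r b hb => by
        rw [← Algebra.smul_def]
        exact W.smul_mem r hb }
  have hS : ∀ x, (∀ r n, x * (d r * shiftPow w t n) ∈ W) → x ∈ S := by
    rintro x hx _ ⟨g, rfl⟩
    induction g using Finsupp.induction_linear with
    | zero => simp
    | add g g' hg hg' => rw [map_add, mul_add]; exact add_mem hg hg'
    | single n r => rw [homogeneousSum_single]; exact hx r n
  have htop : S = ⊤ := by
    refine hgen S (fun r => hS _ fun s n => ?_) (hS _ fun s n => ?_) (hS _ fun s n => ?_)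
    · rw [← mul_assoc, ← map_mul]
      exact hW _ _
    · obtain ⟨r, m, hm⟩ := h.up_shiftPow n
      rw [← mul_assoc, h.up, mul_assoc, hm, ← mul_assoc, ← map_mul]
      exact hW _ _
    · obtain ⟨r, m, hm⟩ := h.down_shiftPow n
      rw [← mul_assoc, h.down, mul_assoc, hm, ← mul_assoc, ← map_mul]
      exact hW _ _
  have h1 : (1 : A) ∈ W := by simpa [shiftPow] using hW 1 (.ofNat 0)
  have ha : a ∈ S := htop ▸ Algebra.mem_top
  simpa [W] using ha 1 h1

theorem shiftUp_pow_apply (f : ℤ → R) (n : ℕ) (m : ℤ) : (shiftUp F R ^ n) f m = f (m + n) := by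
  induction n generalizing m with
  | zero => simp
  | succ n ih =>
    rw [pow_succ', Module.End.mul_apply, shiftUp_apply, ih]
    congr 1
    push_cast
    ring

theorem exists_shiftDown_pow_apply [IsDomain R] (hZ : Z ≠ 0) (n : ℕ) :
    ∃ p : ℤ → R, (∀ m, p m ≠ 0) ∧ ∀ f m, (shiftDown θ Z ^ n) f m = p m * f (m - n) := by
  induction n with
  | zero => exact ⟨1, fun m => one_ne_zero, fun f m => by simp⟩
  | succ n ih =>
    obtain ⟨p, hp, hf⟩ := ih
    refine ⟨fun m => (θ ^ m) Z * p (m - 1), fun m => mul_ne_zero ?_ (hp _), fun f m => ?_⟩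
    · exact (map_ne_zero_iff _ (θ ^ m).injective).2 hZ
    · rw [pow_succ', Module.End.mul_apply, shiftDown_apply, hf, mul_assoc]
      congr 3
      push_cast
      ring

theorem exists_shiftPow_apply [IsDomain R] (hZ : Z ≠ 0) :
    ∀ n, ∃ p : ℤ → R, (∀ m, p m ≠ 0) ∧
      ∀ f m, shiftPow (shiftUp F R) (shiftDown θ Z) n f m = p m * f (m + n)
  | .ofNat n => ⟨1, fun _ => one_ne_zero, fun f m => by
      simpa [shiftPow] using shiftUp_pow_apply f n m⟩
  | .negSucc n => by
      obtain ⟨p, hp, hf⟩ := exists_shiftDown_pow_apply (θ := θ) hZ (n + 1)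
      exact ⟨p, hp, fun f m => by rw [shiftPow, hf, Int.negSucc_eq]; congr 2⟩

theorem map_shiftPow {B : Type*} [Ring B] [Algebra F B] (φ : A →ₐ[F] B) :
    ∀ n, φ (shiftPow w t n) = shiftPow (φ w) (φ t) n
  | .ofNat n => map_pow φ w n
  | .negSucc n => map_pow φ t (n + 1)

theorem hasOrder_homogeneousSum [IsDomain R] (hZ : Z ≠ 0) {g : ℤ →₀ R} (hg : g ≠ 0) :
    ∃ N, HasOrder (homogeneousSum (twistedMul θ) (shiftUp F R) (shiftDown θ Z) g) N := by
  have hne : g.support.Nonempty := Finsupp.support_nonempty_iff.2 hg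
  set N := g.support.max' hne with hN
  have hNmem : g N ≠ 0 := Finsupp.mem_support_iff.1 (g.support.max'_mem hne)
  choose p hp hpf using exists_shiftPow_apply (F := F) (θ := θ) hZ
  have happ : ∀ f m, homogeneousSum (twistedMul θ) (shiftUp F R) (shiftDown θ Z) g f m =
      ∑ n ∈ g.support, (θ ^ m) (g n) * (p n m * f (m + n)) := by
    intro f m
    rw [homogeneousSum_apply, LinearMap.sum_apply, Finset.sum_apply]
    exact Finset.sum_congr rfl fun n _ => by
      rw [Module.End.mul_apply, twistedMul_apply, hpf]
  refine ⟨N, fun f m hm hl => ⟨?_, fun l hlm => ?_⟩⟩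
  · rw [happ, Finset.sum_eq_single_of_mem N (g.support.max'_mem hne) fun n hn hnN => ?_]
    · rw [sub_add_cancel]
      exact mul_ne_zero ((map_ne_zero_iff _ (θ ^ _).injective).2 hNmem) (mul_ne_zero (hp _ _) hm)
    · have := lt_of_le_of_ne (g.support.le_max' n hn) hnN
      rw [hl _ (by omega), mul_zero, mul_zero]
  · rw [happ]
    refine Finset.sum_eq_zero fun n hn => ?_
    have := g.support.le_max' n hn
    rw [hl _ (by omega), mul_zero, mul_zero]

/-- A generalized Weyl algebra that acts on sequences by twisted multiplications and shifts is a
domain. -/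
theorem IsGeneralizedWeyl.isDomain [IsDomain R] (h : IsGeneralizedWeyl θ Z d w t) (hZ : Z ≠ 0)
    (hgen : ∀ S : Subalgebra F A, (∀ r, d r ∈ S) → w ∈ S → t ∈ S → S = ⊤)
    (φ : A →ₐ[F] Module.End F (ℤ → R)) (hd : ∀ r, φ (d r) = twistedMul θ r)
    (hw : φ w = shiftUp F R) (ht : φ t = shiftDown θ Z) : IsDomain A := by
  have hord : ∀ a : A, a ≠ 0 → ∃ N, HasOrder (φ a) N := by
    intro a ha
    obtain ⟨g, rfl⟩ := h.homogeneousSum_surjective hgen a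
    have hmap : φ (homogeneousSum d w t g) =
        homogeneousSum (twistedMul θ) (shiftUp F R) (shiftDown θ Z) g := by
      simp only [homogeneousSum_apply, map_sum, map_mul, hd, map_shiftPow, hw, ht]
    rw [hmap]
    exact hasOrder_homogeneousSum hZ fun h0 => ha (by rw [h0, map_zero])
  have hnt : Nontrivial A := by
    have hB : Nontrivial (Module.End F (ℤ → R)) := inferInstance
    exact φ.toRingHom.domain_nontrivial
  have hnz : NoZeroDivisors A := by
    refine ⟨fun {a b} hab => ?_⟩
    by_contra! hne
    obtain ⟨M, hM⟩ := hord a hne.1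
    obtain ⟨N, hN⟩ := hord b hne.2
    refine (hM.mul hN).ne_zero ?_
    rw [← map_mul, hab, map_zero]
  exact NoZeroDivisors.to_isDomain A

end GeneralizedWeyl

section VanishingParameter

variable {F : Type u} [Field F]

/-- The relations of a skew polynomial type presentation of the algebra with first parameter
zero. -/
structure WeylRel {B : Type*} [Ring B] [Algebra F B] (c p q κ : F) (u v w t : B) : Prop where
  comm : u * v = v * u
  up₀ : w * u = (c • u + p • v) * w
  up₁ : w * v = (c • v + q • u) * w
  down₀ : t * u = (c • u - p • v) * t
  down₁ : t * v = (c • v - q • u) * t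
  up_down : w * t = t * w + κ • (u * v)

/-- The parameters of the presentation of `WeylRel` for given `β` and square root of `-1`. -/
structure WeylParams (β i c p q : F) : Prop where
  two_ne : (2 : F) ≠ 0
  ne : 1 + β ≠ 0
  sq : i * i = -1
  diag : (1 + β) * c = 1 - β
  upper : (1 + β) * p = 2 * β * i
  lower : (1 + β) * q = 2 * i

variable {β i c p q : F} {B : Type*} [Ring B] [Algebra F B] {x₀ x₁ x₂ x₃ : B}

theorem WeylParams.exists [IsAlgClosed F] (h2 : (2 : F) ≠ 0) (hβ : β ≠ -1) :
    ∃ i c p q : F, WeylParams β i c p q := by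
  have hne : 1 + β ≠ 0 := fun h => hβ (by linear_combination h)
  obtain ⟨i, hi⟩ := IsAlgClosed.exists_eq_mul_self (-1 : F)
  refine ⟨i, (1 - β) / (1 + β), 2 * β * i / (1 + β), 2 * i / (1 + β), h2, hne, hi.symm, ?_, ?_, ?_⟩
  all_goals field_simp

theorem WeylParams.det (h : WeylParams β i c p q) : c * c - p * q = 1 := by
  refine mul_left_cancel₀ (mul_ne_zero h.ne h.ne) ?_
  linear_combination ((1 + β) * c + 1 - β) * h.diag - (1 + β) * q * h.upper - 2 * β * i * h.lower
    - 4 * β * h.sq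

theorem WeylParams.lower_ne (h : WeylParams β i c p q) : q ≠ 0 := by
  rintro rfl
  have hi : i ≠ 0 := fun h0 => by simpa [h0] using h.sq
  exact mul_ne_zero h.two_ne hi (by linear_combination -h.lower)

theorem WeylParams.weylRel (h : WeylParams β i c p q) (hr : FourRel 0 β (-β) x₀ x₁ x₂ x₃) :
    WeylRel c p q (-4 * i) x₀ x₁ (x₂ + i • x₃) (x₂ - i • x₃) := by
  obtain ⟨h2, hne, hi, hc, hp, hq⟩ := h
  obtain ⟨s1, a1, s2, a2, s3, a3⟩ := hr
  have hcomm : x₀ * x₁ = x₁ * x₀ := by linear_combination (norm := module) s1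
  constructor
  · exact hcomm
  · refine smul_right_injective B hne ?_
    simp only [mul_add, add_mul, smul_mul_assoc, mul_smul_comm]
    linear_combination (norm := module) β • a2 - s2 + (i * β) • a3 - i • s3 -
      hc • (x₀ * x₂) - (hc • (i • (x₀ * x₃))) - hp • (x₁ * x₂) - hp • (i • (x₁ * x₃)) -
      (2 * β * hi) • (x₁ * x₃)
  · refine smul_right_injective B hne ?_
    simp only [mul_add, add_mul, smul_mul_assoc, mul_smul_comm]
    linear_combination (norm := module) a3 + s3 - i • (a2 + s2) -
      hc • (x₁ * x₂) - (hc • (i • (x₁ * x₃))) - hq • (x₀ * x₂) - hq • (i • (x₀ * x₃)) -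
      (2 * hi) • (x₀ * x₃)
  · refine smul_right_injective B hne ?_
    simp only [mul_sub, sub_mul, smul_mul_assoc, mul_smul_comm]
    linear_combination (norm := module) β • a2 - s2 - (i * β) • a3 + i • s3 -
      hc • (x₀ * x₂) + (hc • (i • (x₀ * x₃))) + hp • (x₁ * x₂) - hp • (i • (x₁ * x₃)) -
      (2 * β * hi) • (x₁ * x₃)
  · refine smul_right_injective B hne ?_
    simp only [mul_sub, sub_mul, smul_mul_assoc, mul_smul_comm]
    linear_combination (norm := module) a3 + s3 + i • (a2 + s2) -
      hc • (x₁ * x₂) + (hc • (i • (x₁ * x₃))) + hq • (x₀ * x₂) - hq • (i • (x₀ * x₃)) -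
      (2 * hi) • (x₀ * x₃)
  · simp only [mul_sub, sub_mul, mul_add, add_mul, smul_mul_assoc, mul_smul_comm]
    linear_combination (norm := module) (2 * i) • a1 + (2 * i) • hcomm

theorem WeylParams.fourRel (h : WeylParams β i c p q)
    (hr : WeylRel c p q (-4 * i) x₀ x₁ (x₂ + i • x₃) (x₂ - i • x₃)) :
    FourRel 0 β (-β) x₀ x₁ x₂ x₃ := by
  obtain ⟨h2, hne, hi, hc, hp, hq⟩ := h
  obtain ⟨hcomm, wu, wv, tu, tv, wt⟩ := hr
  simp only [mul_sub, sub_mul, mul_add, add_mul, smul_mul_assoc, mul_smul_comm] at wu wv tu tv wt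
  have hi2 : 2 * i ≠ 0 := mul_ne_zero h2 fun h0 => by simp [h0] at hi
  have r1 : (1 + β) • (x₂ * x₁) = (1 - β) • (x₁ * x₂) - (2 : F) • (x₀ * x₃) := by
    refine smul_right_injective B h2 ?_
    simp only
    linear_combination (norm := module) (1 + β) • (wv + tv) + (2 * hc) • (x₁ * x₂) +
      (2 * i * hq) • (x₀ * x₃) + (4 * hi) • (x₀ * x₃)
  have r2 : (1 + β) • (x₃ * x₁) = (1 - β) • (x₁ * x₃) + (2 : F) • (x₀ * x₂) := by
    refine smul_right_injective B hi2 ?_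
    simp only
    linear_combination (norm := module) (1 + β) • (wv - tv) + (2 * i * hc) • (x₁ * x₃) +
      (2 * hq) • (x₀ * x₂)
  have r3 : (1 + β) • (x₂ * x₀) = (1 - β) • (x₀ * x₂) - (2 * β) • (x₁ * x₃) := by
    refine smul_right_injective B h2 ?_
    simp only
    linear_combination (norm := module) (1 + β) • (wu + tu) + (2 * hc) • (x₀ * x₂) +
      (2 * i * hp) • (x₁ * x₃) + (4 * β * hi) • (x₁ * x₃)
  have r4 : (1 + β) • (x₃ * x₀) = (1 - β) • (x₀ * x₃) + (2 * β) • (x₁ * x₂) := by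
    refine smul_right_injective B hi2 ?_
    simp only
    linear_combination (norm := module) (1 + β) • (wu - tu) + (2 * i * hc) • (x₀ * x₃) +
      (2 * hp) • (x₁ * x₂)
  constructor
  · linear_combination (norm := module) hcomm
  · refine smul_right_injective B hi2 ?_
    simp only
    linear_combination (norm := module) wt - (2 * i) • hcomm
  all_goals refine smul_right_injective B hne ?_
  all_goals simp only
  · linear_combination (norm := module) -β • r2 - r3
  · linear_combination (norm := module) r3 - r2
  · linear_combination (norm := module) β • r1 - r4
  · linear_combination (norm := module) r4 + r1

end VanishingParameter

section NormalGenerators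

variable {F A : Type*} [Field F] [Ring A] [Algebra F A]

theorem isNormalMod_of_span {s : Set A} {J : ℕ → Submodule F A} {z : A} {d : ℕ}
    (hz : z ∈ Submodule.span F s ^ d)
    (hl : ∀ x ∈ s, ∃ y ∈ Submodule.span F s, x * z - z * y ∈ J (d + 1))
    (hr : ∀ x ∈ s, ∃ y ∈ Submodule.span F s, z * x - y * z ∈ J (d + 1)) :
    IsNormalMod (Submodule.span F s) J z d where
  mem := hz
  left x hx := by
    induction hx using Submodule.span_induction with
    | mem x hx => exact hl x hx
    | zero => exact ⟨0, zero_mem _, by simp⟩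
    | add x x' _ _ h h' =>
      obtain ⟨y, hy, hxy⟩ := h
      obtain ⟨y', hy', hxy'⟩ := h'
      refine ⟨y + y', add_mem hy hy', ?_⟩
      rw [add_mul, mul_add, add_sub_add_comm]
      exact add_mem hxy hxy'
    | smul r x _ h =>
      obtain ⟨y, hy, hxy⟩ := h
      refine ⟨r • y, Submodule.smul_mem _ r hy, ?_⟩
      rw [smul_mul_assoc, mul_smul_comm, ← smul_sub]
      exact Submodule.smul_mem _ r hxy
  right x hx := by
    induction hx using Submodule.span_induction with
    | mem x hx => exact hr x hx
    | zero => exact ⟨0, zero_mem _, by simp⟩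
    | add x x' _ _ h h' =>
      obtain ⟨y, hy, hxy⟩ := h
      obtain ⟨y', hy', hxy'⟩ := h'
      refine ⟨y + y', add_mem hy hy', ?_⟩
      rw [mul_add, add_mul, add_sub_add_comm]
      exact add_mem hxy hxy'
    | smul r x _ h =>
      obtain ⟨y, hy, hxy⟩ := h
      refine ⟨r • y, Submodule.smul_mem _ r hy, ?_⟩
      rw [smul_mul_assoc, mul_smul_comm, ← smul_sub]
      exact Submodule.smul_mem _ r hxy

theorem mem_addNormal_self (V : Submodule F A) (J : ℕ → Submodule F A) (z : A) (d : ℕ) :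
    z ∈ addNormal V J z d d :=
  mem_addNormal.2 (Or.inr ⟨0, zero_add d, 1, one_mem_pow_zero V, by simp⟩)

theorem le_addNormal (V : Submodule F A) (J : ℕ → Submodule F A) (z : A) (d n : ℕ) :
    J n ≤ addNormal V J z d n := fun _ hx => mem_addNormal.2 (Or.inl hx)

theorem IsGradedIdeal.mul_mem_left {V : Submodule F A} {J : ℕ → Submodule F A}
    (hJ : IsGradedIdeal V J) {n : ℕ} {x y : A} (hx : x ∈ V) (hy : y ∈ J n) : x * y ∈ J (n + 1) :=
  hJ.left n (Submodule.mul_mem_mul hx hy)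

theorem IsGradedIdeal.mul_mem_right {V : Submodule F A} {J : ℕ → Submodule F A}
    (hJ : IsGradedIdeal V J) {n : ℕ} {x y : A} (hx : x ∈ J n) (hy : y ∈ V) : x * y ∈ J (n + 1) :=
  hJ.right n (Submodule.mul_mem_mul hx hy)

theorem IsGradedIdeal.rightGN {V : Submodule F A} {J : ℕ → Submodule F A}
    (hJ : IsGradedIdeal V J) (h : V ≤ J 1) : RightGN V J := by
  refine fun I _ hIV _ => ⟨0, fun n _ => ?_⟩
  refine (hIV _).trans (le_trans ?_ le_sup_right)
  rw [pow_succ]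
  exact (mul_le_mul_right h _).trans (hJ.pow_mul_le n 1)

end NormalGenerators

section WeylNoetherian

variable {F A : Type*} [Field F] [Ring A] [Algebra F A] {c p q κ μ : F} {u v w t : A}

theorem WeylRel.rightGN_span (h : WeylRel c p q κ u v w t) (hdet : c * c - p * q = 1)
    (hq : q ≠ 0) (hμ : μ * μ = p * q) :
    RightGN (Submodule.span F {u, v, w, t}) fun _ => ⊥ := by
  obtain ⟨hc, wu, wv, tu, tv, wt⟩ := h
  set V := Submodule.span F {u, v, w, t} with hV
  have hFG : V.FG := Submodule.fg_span (by simp)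
  have hu : u ∈ V := Submodule.subset_span (by simp)
  have hv : v ∈ V := Submodule.subset_span (by simp)
  have hw : w ∈ V := Submodule.subset_span (by simp)
  have ht : t ∈ V := Submodule.subset_span (by simp)
  simp only [add_mul, sub_mul, smul_mul_assoc] at wu wv tu tv
  have hdet' : (c + μ) * (c - μ) = 1 := by linear_combination hdet - hμ
  set X := q • u + μ • v with hX
  have hXV : X ∈ V := add_mem (V.smul_mem q hu) (V.smul_mem μ hv)
  have wX : w * X = (c + μ) • (X * w) := by
    simp only [hX, mul_add, add_mul, smul_mul_assoc, mul_smul_comm]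
    linear_combination (norm := module) q • wu + μ • wv - hμ • (v * w)
  have tX : t * X = (c - μ) • (X * t) := by
    simp only [hX, mul_add, add_mul, smul_mul_assoc, mul_smul_comm]
    linear_combination (norm := module) q • tu + μ • tv + hμ • (v * t)
  have uX : u * X = X * u := by
    simp only [hX, mul_add, add_mul, smul_mul_assoc, mul_smul_comm]
    linear_combination (norm := module) μ • hc
  have vX : v * X = X * v := by
    simp only [hX, mul_add, add_mul, smul_mul_assoc, mul_smul_comm]
    linear_combination (norm := module) -q • hc
  have n1 : IsNormalMod V (fun _ => ⊥) X 1 := by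
    refine isNormalMod_of_span (by simpa using hXV) ?_ ?_ <;>
      simp only [Set.mem_insert_iff, Set.mem_singleton_iff, forall_eq_or_imp, forall_eq,
        Submodule.mem_bot, sub_eq_zero]
    · refine ⟨⟨u, hu, uX⟩, ⟨v, hv, vX⟩, ⟨(c + μ) • w, V.smul_mem _ hw, ?_⟩,
        ⟨(c - μ) • t, V.smul_mem _ ht, ?_⟩⟩
      · rw [mul_smul_comm, wX]
      · rw [mul_smul_comm, tX]
    · refine ⟨⟨u, hu, uX.symm⟩, ⟨v, hv, vX.symm⟩, ⟨(c - μ) • w, V.smul_mem _ hw, ?_⟩,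
        ⟨(c + μ) • t, V.smul_mem _ ht, ?_⟩⟩
      · rw [smul_mul_assoc, wX, smul_smul, mul_comm, hdet', one_smul]
      · rw [smul_mul_assoc, tX, smul_smul, hdet', one_smul]
  set J₁ := addNormal V (fun _ => ⊥) X 1 with hJ₁
  have hJ1 : IsGradedIdeal V J₁ := addNormal_isGradedIdeal (isGradedIdeal_bot V) n1
  have hX1 : X ∈ J₁ 1 := mem_addNormal_self _ _ _ _
  have n2 : IsNormalMod V J₁ v 1 := by
    have hXw : X * w ∈ J₁ (1 + 1) := hJ1.mul_mem_right hX1 hw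
    have hXt : X * t ∈ J₁ (1 + 1) := hJ1.mul_mem_right hX1 ht
    have ev : w * v = (c - μ) • (v * w) + X * w := by
      simp only [hX, add_mul, smul_mul_assoc]
      linear_combination (norm := module) wv
    have et : t * v = (c + μ) • (v * t) - X * t := by
      simp only [hX, add_mul, smul_mul_assoc]
      linear_combination (norm := module) tv
    refine isNormalMod_of_span (by simpa using hv) ?_ ?_ <;>
      simp only [Set.mem_insert_iff, Set.mem_singleton_iff, forall_eq_or_imp, forall_eq]
    · refine ⟨⟨u, hu, ?_⟩, ⟨v, hv, ?_⟩, ⟨(c - μ) • w, V.smul_mem _ hw, ?_⟩,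
        ⟨(c + μ) • t, V.smul_mem _ ht, ?_⟩⟩
      · rw [hc, sub_self]; exact zero_mem _
      · rw [sub_self]; exact zero_mem _
      · rwa [ev, mul_smul_comm, add_sub_cancel_left]
      · rw [et, mul_smul_comm, sub_sub_cancel_left]; exact neg_mem hXt
    · refine ⟨⟨u, hu, ?_⟩, ⟨v, hv, ?_⟩, ⟨(c + μ) • w, V.smul_mem _ hw, ?_⟩,
        ⟨(c - μ) • t, V.smul_mem _ ht, ?_⟩⟩
      · rw [hc, sub_self]; exact zero_mem _
      · rw [sub_self]; exact zero_mem _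
      · rw [show v * w - (c + μ) • w * v = -(c + μ) • (X * w) by
          rw [smul_mul_assoc, ev]
          linear_combination (norm := module) -hdet' • (v * w)]
        exact Submodule.smul_mem _ _ hXw
      · rw [show v * t - (c - μ) • t * v = (c - μ) • (X * t) by
          rw [smul_mul_assoc, et]
          linear_combination (norm := module) -hdet' • (v * t)]
        exact Submodule.smul_mem _ _ hXt
  set J₂ := addNormal V J₁ v 1 with hJ₂
  have hJ2 : IsGradedIdeal V J₂ := addNormal_isGradedIdeal hJ1 n2
  have hv2 : v ∈ J₂ 1 := mem_addNormal_self _ _ _ _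
  have hu2 : u ∈ J₂ 1 := by
    have h1 : q • u ∈ J₂ 1 := by
      rw [show q • u = X - μ • v by rw [hX, add_sub_cancel_right]]
      exact sub_mem (le_addNormal _ _ _ _ _ hX1) (Submodule.smul_mem _ μ hv2)
    simpa [smul_smul, inv_mul_cancel₀ hq] using (J₂ 1).smul_mem q⁻¹ h1
  have n3 : IsNormalMod V J₂ w 1 := by
    have hwt : w * t - t * w ∈ J₂ (1 + 1) := by
      rw [wt, add_sub_cancel_left]
      exact Submodule.smul_mem _ _ (hJ2.mul_mem_left hu hv2)
    have htw : t * w - w * t ∈ J₂ (1 + 1) := by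
      rw [← neg_sub]
      exact neg_mem hwt
    refine isNormalMod_of_span (by simpa using hw) ?_ ?_ <;>
      simp only [Set.mem_insert_iff, Set.mem_singleton_iff, forall_eq_or_imp, forall_eq]
    · refine ⟨⟨0, zero_mem _, ?_⟩, ⟨0, zero_mem _, ?_⟩, ⟨w, hw, ?_⟩, ⟨t, ht, htw⟩⟩
      · rw [mul_zero, sub_zero]; exact hJ2.mul_mem_right hu2 hw
      · rw [mul_zero, sub_zero]; exact hJ2.mul_mem_right hv2 hw
      · rw [sub_self]; exact zero_mem _
    · refine ⟨⟨0, zero_mem _, ?_⟩, ⟨0, zero_mem _, ?_⟩, ⟨w, hw, ?_⟩, ⟨t, ht, hwt⟩⟩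
      · rw [zero_mul, sub_zero]; exact hJ2.mul_mem_left hw hu2
      · rw [zero_mul, sub_zero]; exact hJ2.mul_mem_left hw hv2
      · rw [sub_self]; exact zero_mem _
  set J₃ := addNormal V J₂ w 1 with hJ₃
  have hJ3 : IsGradedIdeal V J₃ := addNormal_isGradedIdeal hJ2 n3
  have hw3 : w ∈ J₃ 1 := mem_addNormal_self _ _ _ _
  have hu3 : u ∈ J₃ 1 := le_addNormal _ _ _ _ _ hu2
  have hv3 : v ∈ J₃ 1 := le_addNormal _ _ _ _ _ hv2
  have n4 : IsNormalMod V J₃ t 1 := by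
    refine isNormalMod_of_span (by simpa using ht) ?_ ?_ <;>
      simp only [Set.mem_insert_iff, Set.mem_singleton_iff, forall_eq_or_imp, forall_eq]
    · refine ⟨⟨0, zero_mem _, ?_⟩, ⟨0, zero_mem _, ?_⟩, ⟨0, zero_mem _, ?_⟩, ⟨t, ht, ?_⟩⟩
      · rw [mul_zero, sub_zero]; exact hJ3.mul_mem_right hu3 ht
      · rw [mul_zero, sub_zero]; exact hJ3.mul_mem_right hv3 ht
      · rw [mul_zero, sub_zero]; exact hJ3.mul_mem_right hw3 ht
      · rw [sub_self]; exact zero_mem _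
    · refine ⟨⟨0, zero_mem _, ?_⟩, ⟨0, zero_mem _, ?_⟩, ⟨0, zero_mem _, ?_⟩, ⟨t, ht, ?_⟩⟩
      · rw [zero_mul, sub_zero]; exact hJ3.mul_mem_left ht hu3
      · rw [zero_mul, sub_zero]; exact hJ3.mul_mem_left ht hv3
      · rw [zero_mul, sub_zero]; exact hJ3.mul_mem_left ht hw3
      · rw [sub_self]; exact zero_mem _
  have hJ4 : IsGradedIdeal V (addNormal V J₃ t 1) := addNormal_isGradedIdeal hJ3 n4
  refine .of_addNormal hFG (isGradedIdeal_bot V) n1 one_pos ?_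
  refine .of_addNormal hFG hJ1 n2 one_pos ?_
  refine .of_addNormal hFG hJ2 n3 one_pos ?_
  refine .of_addNormal hFG hJ3 n4 one_pos (hJ4.rightGN ?_)
  refine Submodule.span_le.2 ?_
  rintro x (rfl | rfl | rfl | rfl)
  exacts [le_addNormal _ _ _ _ _ hu3, le_addNormal _ _ _ _ _ hv3, le_addNormal _ _ _ _ _ hw3,
    mem_addNormal_self _ _ _ _]

end WeylNoetherian

section CommutingFamily

variable {F A : Type*} [Field F] [Ring A] [Algebra F A]

open scoped IsMulCommutative in
theorem exists_aeval_of_commute {n : ℕ} (s : Fin n → A) (hs : ∀ i j, s i * s j = s j * s i) :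
    ∃ d : MvPolynomial (Fin n) F →ₐ[F] A, ∀ i, d (MvPolynomial.X i) = s i := by
  have hcomm : ∀ a ∈ Set.range s, ∀ b ∈ Set.range s, a * b = b * a := by
    rintro _ ⟨i, rfl⟩ _ ⟨j, rfl⟩
    exact hs i j
  have := Algebra.isMulCommutative_adjoin F hcomm
  let s' : Fin n → Algebra.adjoin F (Set.range s) := fun i =>
    ⟨s i, Algebra.subset_adjoin (Set.mem_range_self i)⟩
  exact ⟨(Algebra.adjoin F (Set.range s)).val.comp (MvPolynomial.aeval s'), fun i => by
    rw [AlgHom.comp_apply, MvPolynomial.aeval_X]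
    rfl⟩

theorem mul_map_eq_of_forall_X {n : ℕ} (d : MvPolynomial (Fin n) F →ₐ[F] A)
    (ψ : MvPolynomial (Fin n) F →ₐ[F] MvPolynomial (Fin n) F) (x : A)
    (hx : ∀ i, x * d (MvPolynomial.X i) = d (ψ (MvPolynomial.X i)) * x)
    (r : MvPolynomial (Fin n) F) : x * d r = d (ψ r) * x := by
  induction r using MvPolynomial.induction_on with
  | C a =>
    rw [← MvPolynomial.algebraMap_eq, AlgHom.commutes, AlgHom.commutes, AlgHom.commutes]
    exact (Algebra.commutes a x).symm
  | add f g hf hg => rw [map_add, map_add, map_add, mul_add, add_mul, hf, hg]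
  | mul_X f i hf =>
    rw [map_mul, map_mul, map_mul, ← mul_assoc, hf, mul_assoc, hx, mul_assoc]

end CommutingFamily

section WeylTwist

open MvPolynomial

variable {F : Type*} [Field F] (c p q κ : F)

/-- The automorphism of polynomials in three variables by which the two shifts act, as a
homomorphism. -/
def weylHom : MvPolynomial (Fin 3) F →ₐ[F] MvPolynomial (Fin 3) F :=
  aeval ![c • X 0 + p • X 1, c • X 1 + q • X 0, X 2 + κ • (X 0 * X 1)]

/-- The inverse of `weylHom`. -/
def weylInv : MvPolynomial (Fin 3) F →ₐ[F] MvPolynomial (Fin 3) F :=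
  aeval ![c • X 0 - p • X 1, c • X 1 - q • X 0,
    X 2 - κ • ((c • X 0 - p • X 1) * (c • X 1 - q • X 0))]

theorem weylHom_X₀ : weylHom c p q κ (X 0) = c • X 0 + p • X 1 := by simp [weylHom]

theorem weylHom_X₁ : weylHom c p q κ (X 1) = c • X 1 + q • X 0 := by simp [weylHom]

theorem weylHom_X₂ : weylHom c p q κ (X 2) = X 2 + κ • (X 0 * X 1) := by simp [weylHom]

theorem weylInv_X₀ : weylInv c p q κ (X 0) = c • X 0 - p • X 1 := by simp [weylInv]

theorem weylInv_X₁ : weylInv c p q κ (X 1) = c • X 1 - q • X 0 := by simp [weylInv]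

theorem weylInv_X₂ : weylInv c p q κ (X 2) =
    X 2 - κ • ((c • X 0 - p • X 1) * (c • X 1 - q • X 0)) := by simp [weylInv]

variable {c p q}

/-- The automorphism of polynomials in three variables by which the two shifts act. -/
def weylTwist (hdet : c * c - p * q = 1) :
    MvPolynomial (Fin 3) F ≃ₐ[F] MvPolynomial (Fin 3) F := by
  have hdet' : (C c * C c - C p * C q : MvPolynomial (Fin 3) F) = 1 := by
    rw [← map_mul, ← map_mul, ← map_sub, hdet, map_one]
  refine AlgEquiv.ofAlgHom (weylHom c p q κ) (weylInv c p q κ) (algHom_ext fun i => ?_)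
    (algHom_ext fun i => ?_)
  · fin_cases i <;>
    simp only [AlgHom.comp_apply, AlgHom.id_apply, weylHom_X₀, weylHom_X₁, weylHom_X₂, weylInv_X₀,
      weylInv_X₁, weylInv_X₂, map_sub, map_smul, map_mul, Fin.zero_eta,
      Fin.mk_one, Fin.reduceFinMk] <;>
    simp only [smul_eq_C_mul]
    · linear_combination X 0 * hdet'
    · linear_combination X 1 * hdet'
    · linear_combination -C κ * X 0 * X 1 * (C c * C c - C p * C q + 1) * hdet'
  · fin_cases i <;>
    simp only [AlgHom.comp_apply, AlgHom.id_apply, weylHom_X₀, weylHom_X₁, weylHom_X₂, weylInv_X₀,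
      weylInv_X₁, weylInv_X₂, map_add, map_smul, map_mul, Fin.zero_eta,
      Fin.mk_one, Fin.reduceFinMk] <;>
    simp only [smul_eq_C_mul]
    · linear_combination X 0 * hdet'
    · linear_combination X 1 * hdet'
    · ring

theorem weylTwist_apply (hdet : c * c - p * q = 1) (r : MvPolynomial (Fin 3) F) :
    weylTwist κ hdet r = weylHom c p q κ r := rfl

theorem weylTwist_symm_apply (hdet : c * c - p * q = 1) (r : MvPolynomial (Fin 3) F) :
    (weylTwist κ hdet).symm r = weylInv c p q κ r := rfl

variable {κ} {A : Type*} [Ring A] [Algebra F A]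

theorem WeylRel.exists_isGeneralizedWeyl {u v w t : A} (h : WeylRel c p q κ u v w t)
    (hdet : c * c - p * q = 1) :
    ∃ d : MvPolynomial (Fin 3) F →ₐ[F] A, d (X 0) = u ∧ d (X 1) = v ∧
      IsGeneralizedWeyl (weylTwist κ hdet) (X 2) d w t := by
  obtain ⟨hc, wu, wv, tu, tv, wt⟩ := h
  have hu : u * (t * w) = t * w * u := by
    rw [mul_assoc t w u, wu, ← mul_assoc t, mul_add, mul_smul_comm, mul_smul_comm, tu, tv]
    simp only [add_mul, sub_mul, smul_mul_assoc, mul_assoc]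
    linear_combination (norm := module) -hdet • (u * (t * w))
  have hv : v * (t * w) = t * w * v := by
    rw [mul_assoc t w v, wv, ← mul_assoc t, mul_add, mul_smul_comm, mul_smul_comm, tu, tv]
    simp only [add_mul, sub_mul, smul_mul_assoc, mul_assoc]
    linear_combination (norm := module) -hdet • (v * (t * w))
  obtain ⟨d, hd⟩ := exists_aeval_of_commute (F := F) ![u, v, t * w] (by
    intro i j
    fin_cases i <;> fin_cases j <;> simp [hc, hu, hv])
  have hd0 : d (X 0) = u := hd 0
  have hd1 : d (X 1) = v := hd 1
  have hd2 : d (X 2) = t * w := hd 2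
  refine ⟨d, hd0, hd1, ⟨mul_map_eq_of_forall_X d (weylHom c p q κ) w fun i => ?_,
    mul_map_eq_of_forall_X d (weylInv c p q κ) t fun i => ?_, hd2.symm, ?_⟩⟩
  · fin_cases i
    · simpa [weylHom_X₀, hd0, hd1] using wu
    · simpa [weylHom_X₁, hd0, hd1] using wv
    · simp only [Fin.reduceFinMk, weylHom_X₂, map_add, map_smul, map_mul, hd0, hd1, hd2]
      rw [← mul_assoc, wt]
  · fin_cases i
    · simpa [weylInv_X₀, hd0, hd1] using tu
    · simpa [weylInv_X₁, hd0, hd1] using tv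
    · simp only [Fin.reduceFinMk, weylInv_X₂, map_sub, map_smul, map_mul, hd0, hd1, hd2]
      have h1 : t * (u * v) = (c • u - p • v) * (c • v - q • u) * t := by
        rw [← mul_assoc, tu, mul_assoc, tv, mul_assoc]
      rw [sub_mul, smul_mul_assoc, ← h1, mul_assoc t w t, wt, mul_add, mul_smul_comm,
        add_sub_cancel_right]
  · rw [weylTwist_apply, weylHom_X₂, map_add, map_smul, map_mul, hd0, hd1, hd2, wt]

theorem IsGeneralizedWeyl.weylRel {hdet : c * c - p * q = 1} {d : MvPolynomial (Fin 3) F →ₐ[F] A}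
    {w t : A} (h : IsGeneralizedWeyl (weylTwist κ hdet) (X 2) d w t) :
    WeylRel c p q κ (d (X 0)) (d (X 1)) w t where
  comm := by rw [← map_mul, ← map_mul, mul_comm]
  up₀ := by rw [h.up, weylTwist_apply, weylHom_X₀, map_add, map_smul, map_smul]
  up₁ := by rw [h.up, weylTwist_apply, weylHom_X₁, map_add, map_smul, map_smul]
  down₀ := by rw [h.down, weylTwist_symm_apply, weylInv_X₀, map_sub, map_smul, map_smul]
  down₁ := by rw [h.down, weylTwist_symm_apply, weylInv_X₁, map_sub, map_smul, map_smul]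
  up_down := by
    rw [h.up_down, h.down_up, weylTwist_apply, weylHom_X₂, map_add, map_smul, map_mul]

theorem isGeneralizedWeyl_shift {R : Type*} [CommRing R] [Algebra F R] (θ : R ≃ₐ[F] R) (Z : R) :
    IsGeneralizedWeyl θ Z (twistedMul θ) (shiftUp F R) (shiftDown θ Z) :=
  ⟨shiftUp_mul_twistedMul θ, shiftDown_mul_twistedMul θ Z, shiftDown_mul_shiftUp θ Z,
    shiftUp_mul_shiftDown θ Z⟩

end WeylTwist

section VanishingParameter

open MvPolynomial

variable {F : Type u} [Field F]

theorem exists_add_smul_eq_and_sub_smul_eq {B : Type*} [AddCommGroup B] [Module F B] {i : F}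
    (h2 : (2 : F) ≠ 0) (hi : i * i = -1) (w t : B) : ∃ x y, x + i • y = w ∧ x - i • y = t := by
  have h22 : (2⁻¹ : F) * 2 = 1 := inv_mul_cancel₀ h2
  refine ⟨(2⁻¹ : F) • (w + t), -(2⁻¹ * i) • (w - t), ?_, ?_⟩
  · linear_combination (norm := module) h22 • w - ((2⁻¹ : F) * hi) • (w - t)
  · linear_combination (norm := module) h22 • t + ((2⁻¹ : F) * hi) • (w - t)

theorem IsFourAlgebra.isNoetherianRing_op_and_isDomain_of_eq_zero [IsAlgClosed F]
    (h2 : (2 : F) ≠ 0) {α β γ : F} {A : Type u} [Ring A] [Algebra F A] {x₀ x₁ x₂ x₃ : A}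
    (h : IsFourAlgebra α β γ x₀ x₁ x₂ x₃)
    (hS : α + β + γ + α * β * γ = 0) (h2' : ¬(β = -1 ∧ γ = 1)) (hα : α = 0) :
    IsNoetherianRing Aᵐᵒᵖ ∧ IsDomain A := by
  subst hα
  obtain rfl : γ = -β := by linear_combination hS
  obtain ⟨i, c, p, q, hp⟩ := WeylParams.exists h2 (β := β) fun hβ => h2' ⟨hβ, by rw [hβ, neg_neg]⟩
  have hrel := hp.weylRel h.rel
  have hgen : ∀ S : Subalgebra F A, x₀ ∈ S → x₁ ∈ S → x₂ + i • x₃ ∈ S → x₂ - i • x₃ ∈ S →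
      S = ⊤ := by
    intro S s0 s1 sw st
    have hh := inv_mul_cancel₀ h2
    refine h.generate S s0 s1 ?_ ?_
    · rw [show x₂ = (2⁻¹ : F) • ((x₂ + i • x₃) + (x₂ - i • x₃)) by
        linear_combination (norm := module) -hh • x₂]
      exact S.smul_mem (add_mem sw st) _
    · rw [show x₃ = -(2⁻¹ * i) • ((x₂ + i • x₃) - (x₂ - i • x₃)) by
        linear_combination (norm := module) -hh • x₃ + ((2⁻¹ : F) * 2 * hp.sq) • x₃]
      exact S.smul_mem (sub_mem sw st) _
  constructor
  · obtain ⟨μ, hμ⟩ := IsAlgClosed.exists_eq_mul_self (p * q)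
    refine isNoetherianRing_op_of_rightGN (Submodule.fg_span (by simp))
      (iSup_pow_eq_top fun S hS => ?_) (hrel.rightGN_span hp.det hp.lower_ne hμ.symm)
    exact hgen S (hS (Submodule.subset_span (by simp))) (hS (Submodule.subset_span (by simp)))
      (hS (Submodule.subset_span (by simp))) (hS (Submodule.subset_span (by simp)))
  · obtain ⟨d, hd0, hd1, hd⟩ := hrel.exists_isGeneralizedWeyl hp.det
    let θ := weylTwist (-4 * i) hp.det
    have hB := (isGeneralizedWeyl_shift θ (X 2)).weylRel
    obtain ⟨y₂, y₃, hy, hy'⟩ := exists_add_smul_eq_and_sub_smul_eq h2 hp.sq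
      (shiftUp F (MvPolynomial (Fin 3) F)) (shiftDown θ (X 2))
    rw [← hy, ← hy'] at hB
    obtain ⟨φ, h0, h1, h2, h3⟩ := h.lift (hp.fourRel hB)
    have hw : φ (x₂ + i • x₃) = shiftUp F _ := by rw [map_add, map_smul, h2, h3, hy]
    have ht : φ (x₂ - i • x₃) = shiftDown θ (X 2) := by rw [map_sub, map_smul, h2, h3, hy']
    refine hd.isDomain (X_ne_zero 2) (fun S hS => ?_) φ (fun r => ?_) hw ht
    · exact hgen S (hd0 ▸ hS (X 0)) (hd1 ▸ hS (X 1))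
    · have hφ : φ.comp d = twistedMul θ := by
        refine algHom_ext fun j => ?_
        fin_cases j
        · exact (congrArg φ hd0).trans h0
        · exact (congrArg φ hd1).trans h1
        · refine (congrArg φ hd.down_up.symm).trans ?_
          rw [map_mul, hw, ht]
          exact shiftDown_mul_shiftUp θ (X 2)
      exact DFunLike.congr_fun hφ r

end VanishingParameter

section MainResult

variable {F : Type u} [Field F]

theorem IsFourAlgebra.isNoetherianRing_op_and_isDomain [IsAlgClosed F]
    (h2 : (2 : F) ≠ 0) {α β γ : F} {A : Type u} [Ring A] [Algebra F A] {x₀ x₁ x₂ x₃ : A}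
    (h : IsFourAlgebra α β γ x₀ x₁ x₂ x₃)
    (hS : α + β + γ + α * β * γ = 0) (h1 : ¬(α = -1 ∧ β = 1)) (h2' : ¬(β = -1 ∧ γ = 1))
    (h3 : ¬(α = 1 ∧ γ = -1)) : IsNoetherianRing Aᵐᵒᵖ ∧ IsDomain A := by
  by_cases hα : α = 0
  · exact h.isNoetherianRing_op_and_isDomain_of_eq_zero h2 hS h2' hα
  by_cases hβ : β = 0
  · exact h.cycle.isNoetherianRing_op_and_isDomain_of_eq_zero h2 (by linear_combination hS)
      (fun h => h3 h.symm) hβ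
  by_cases hγ : γ = 0
  · exact h.cycle.cycle.isNoetherianRing_op_and_isDomain_of_eq_zero h2
      (by linear_combination hS) h1 hγ
  exact h.isNoetherianRing_op_and_isDomain_of_ne_zero h2 hS h1 h2' h3 hα hβ hγ

theorem fourRel_agen (α β γ : F) :
    FourRel α β γ (agen F α β γ 0) (agen F α β γ 1) (agen F α β γ 2) (agen F α β γ 3) := by
  have hrel : ∀ {a : FreeAlgebra F (Fin 4)}, fourRel F α β γ a 0 →
      RingQuot.mkAlgHom F (fourRel F α β γ) a = 0 := fun h => by
    rw [RingQuot.mkAlgHom_rel F h, map_zero]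
  constructor <;> refine sub_eq_zero.1 ?_
  · simpa only [agen, map_sub, map_add, map_mul, map_smul, ← Algebra.smul_def] using
      hrel ⟨rfl, .inl rfl⟩
  · simpa only [agen, map_sub, map_add, map_mul] using hrel ⟨rfl, .inr (.inl rfl)⟩
  · simpa only [agen, map_sub, map_add, map_mul, map_smul, ← Algebra.smul_def] using
      hrel ⟨rfl, .inr (.inr (.inl rfl))⟩
  · simpa only [agen, map_sub, map_add, map_mul] using hrel ⟨rfl, .inr (.inr (.inr (.inl rfl)))⟩
  · simpa only [agen, map_sub, map_add, map_mul, map_smul, ← Algebra.smul_def] using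
      hrel ⟨rfl, .inr (.inr (.inr (.inr (.inl rfl))))⟩
  · simpa only [agen, map_sub, map_add, map_mul] using
      hrel ⟨rfl, .inr (.inr (.inr (.inr (.inr rfl))))⟩

theorem isFourAlgebra_agen (α β γ : F) :
    IsFourAlgebra α β γ (agen F α β γ 0) (agen F α β γ 1) (agen F α β γ 2)
      (agen F α β γ 3) where
  rel := fourRel_agen α β γ
  generate S h0 h1 h2 h3 := by
    have hle : Algebra.adjoin F (Set.range (FreeAlgebra.ι F (X := Fin 4))) ≤
        S.comap (RingQuot.mkAlgHom F (fourRel F α β γ)) := by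
      rw [Algebra.adjoin_le_iff]
      rintro _ ⟨i, rfl⟩
      fin_cases i <;> assumption
    rw [FreeAlgebra.adjoin_range_ι] at hle
    refine Algebra.eq_top_iff.2 fun x => ?_
    obtain ⟨a, rfl⟩ := RingQuot.mkAlgHom_surjective F (fourRel F α β γ) x
    exact hle (Algebra.mem_top (x := a))
  lift {B _ _ y₀ y₁ y₂ y₃} hy := by
    let f := FreeAlgebra.lift F ![y₀, y₁, y₂, y₃]
    have h0 : f (g4 F 0) = y₀ := FreeAlgebra.lift_ι_apply _ _
    have h1 : f (g4 F 1) = y₁ := FreeAlgebra.lift_ι_apply _ _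
    have h2 : f (g4 F 2) = y₂ := FreeAlgebra.lift_ι_apply _ _
    have h3 : f (g4 F 3) = y₃ := FreeAlgebra.lift_ι_apply _ _
    have hf : ∀ ⦃a b⦄, fourRel F α β γ a b → f a = f b := by
      rintro a b ⟨rfl, hab⟩
      rw [map_zero]
      rcases hab with rfl | rfl | rfl | rfl | rfl | rfl <;>
        simp only [map_sub, map_add, map_mul, map_smul, ← Algebra.smul_def, h0, h1, h2, h3,
          sub_eq_zero]
      exacts [hy.sub₁, hy.add₁, hy.sub₂, hy.add₂, hy.sub₃, hy.add₃]
    exact ⟨RingQuot.liftAlgHom F ⟨f, hf⟩, (RingQuot.liftAlgHom_mkAlgHom_apply ..).trans h0,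
      (RingQuot.liftAlgHom_mkAlgHom_apply ..).trans h1,
      (RingQuot.liftAlgHom_mkAlgHom_apply ..).trans h2,
      (RingQuot.liftAlgHom_mkAlgHom_apply ..).trans h3⟩

end MainResult

end SklyaninFour

/-- Under the stated non-degeneracy conditions, the four-dimensional Sklyanin algebra
`S(α,β,γ)` is a left and right Noetherian domain. -/
theorem sklyanin4_noetherian_domain [IsAlgClosed k] (hchar : ringChar k ≠ 2) (α β γ : k)
    (hS : α + β + γ + α * β * γ = 0)
    (h1 : ¬(α = -1 ∧ β = 1)) (h2 : ¬(β = -1 ∧ γ = 1)) (h3 : ¬(α = 1 ∧ γ = -1)) :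
    IsNoetherianRing (SklyA k α β γ) ∧ IsNoetherianRing (SklyA k α β γ)ᵐᵒᵖ ∧
      IsDomain (SklyA k α β γ) := by
  have h2' : (2 : k) ≠ 0 := Ring.two_ne_zero hchar
  have h := SklyaninFour.isFourAlgebra_agen α β γ
  obtain ⟨hN, hD⟩ := h.isNoetherianRing_op_and_isDomain h2' hS h1 h2 h3
  obtain ⟨hN', -⟩ := h.op.isNoetherianRing_op_and_isDomain h2' hS h1 h2 h3
  exact ⟨isNoetherianRing_of_ringEquiv _ (RingEquiv.opOp (SklyA k α β γ)).symm, hN, hD⟩
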